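/- arXiv:1605.00598 — 2 statements merged into one kernel-verified Lean document; each statement's English description precedes it below -/
import Mathlib

section
/- Suppose in addition that f and t are computable. Then the global conjugacy problem of G is decidable if and only if A is decidable; that is, the predicate on F × F sending (u, v) to the truth value of 'mk(u) is conjugate to mk(v) in G' is computable if and only if the predicate (j ∈ A) on ℕ is computable, where A = {f(i) : i ≥ 1}. -/
/-- A word over the alphabet `α`: a list of generators with signs. -/
abbrev Word (α : Type*) := List (α × Bool)

/-- The formal inverse of a word. -/
def wordInv {α : Type*} (w : Word α) : Word α := FreeGroup.invRev w

/-- A word is reduced if it equals its free reduction. -/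
def Reduced {α : Type*} [DecidableEq α] (w : Word α) : Prop := FreeGroup.reduce w = w

/-- A word is cyclically reduced if it is reduced and its first letter is not
the inverse of its last letter. -/
def CyclicallyReduced {α : Type*} [DecidableEq α] (w : Word α) : Prop :=
  Reduced w ∧ ∀ a ∈ w.head?, ∀ b ∈ w.getLast?, a ≠ (b.1, !b.2)

/-- A nonempty word `b` is a piece relative to `R` if it is an initial segment of two
distinct elements of `R`. -/
def Piece {α : Type*} (R : Set (Word α)) (b : Word α) : Prop :=
  b ≠ [] ∧ ∃ r₁ ∈ R, ∃ r₂ ∈ R, r₁ ≠ r₂ ∧ b <+: r₁ ∧ b <+: r₂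

/-- The symmetrized closure of a set of (cyclically reduced) words: all cyclic
permutations of the words and of their formal inverses. -/
def symClosure {α : Type*} (S : Set (Word α)) : Set (Word α) :=
  {w | ∃ r ∈ S, w ~r r ∨ w ~r wordInv r}

/-! The 46 generators: `a₁,…,a₂₀` are `0,…,19`, `b₁,…,b₂₀` are `20,…,39`,
`c₁,c₂,c₃` are `40,41,42` and `d₁,d₂,d₃` are `43,44,45`. -/

def genA (k : Fin 20) : Fin 46 := ⟨(k : ℕ), by have := k.isLt; omega⟩
def genB (k : Fin 20) : Fin 46 := ⟨20 + (k : ℕ), by have := k.isLt; omega⟩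
def genC (k : Fin 3) : Fin 46 := ⟨40 + (k : ℕ), by have := k.isLt; omega⟩
def genD (k : Fin 3) : Fin 46 := ⟨43 + (k : ℕ), by have := k.isLt; omega⟩

/-- The word `x^n` (with sign `s`: `true` is `x^n`, `false` is `x^{-n}`). -/
def genPow (x : Fin 46) (s : Bool) (n : ℕ) : Word (Fin 46) := List.replicate n (x, s)

/-- The word `a₁^j a₂^j ⋯ a₂₀^j`. -/
def aWord (j : ℕ) : Word (Fin 46) :=
  (List.ofFn fun k : Fin 20 => genPow (genA k) true j).flatten

/-- The word `b₁^j b₂^j ⋯ b₂₀^j`. -/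
def bWord (j : ℕ) : Word (Fin 46) :=
  (List.ofFn fun k : Fin 20 => genPow (genB k) true j).flatten

/-- The word `b₂₀^{-j} b₁₉^{-j} ⋯ b₁^{-j}`. -/
def bWordRevInv (j : ℕ) : Word (Fin 46) :=
  (List.ofFn fun k : Fin 20 => genPow (genB k.rev) false j).flatten

/-- The conjugating word `c₁^i d₁^{t} c₂^i d₂^{t} c₃^i d₃^{t}`. -/
def conjWord (i ti : ℕ) : Word (Fin 46) :=
  genPow (genC 0) true i ++ genPow (genD 0) true ti ++
  genPow (genC 1) true i ++ genPow (genD 1) true ti ++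
  genPow (genC 2) true i ++ genPow (genD 2) true ti

/-- The inverse conjugating word `d₃^{-t} c₃^{-i} d₂^{-t} c₂^{-i} d₁^{-t} c₁^{-i}`. -/
def conjWordInv (i ti : ℕ) : Word (Fin 46) :=
  genPow (genD 2) false ti ++ genPow (genC 2) false i ++
  genPow (genD 1) false ti ++ genPow (genC 1) false i ++
  genPow (genD 0) false ti ++ genPow (genC 0) false i

/-- The relator
`r_i = a₁^j ⋯ a₂₀^j · c₁^i d₁^{t(i)} ⋯ c₃^i d₃^{t(i)} · b₂₀^{-j} ⋯ b₁^{-j} · d₃^{-t(i)} ⋯ c₁^{-i}`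
where `j = f i`. -/
def relatorWord (f t : ℕ → ℕ) (i : ℕ) : Word (Fin 46) :=
  aWord (f i) ++ conjWord i (t i) ++ bWordRevInv (f i) ++ conjWordInv i (t i)

/-- The set of relators `{r_i : i ≥ 1}` as elements of the free group. -/
def relatorSet (f t : ℕ → ℕ) : Set (FreeGroup (Fin 46)) :=
  {r | ∃ i : ℕ, 1 ≤ i ∧ r = FreeGroup.mk (relatorWord f t i)}

/-- The group `G`: the quotient of the free group on the 46 generators by the
normal closure of the relators `r_i`, `i ≥ 1`. -/
abbrev GroupG (f t : ℕ → ℕ) : Type :=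
  FreeGroup (Fin 46) ⧸ Subgroup.normalClosure (relatorSet f t)

/-- The quotient map `mk : F → G` (on words). -/
def mkG (f t : ℕ → ℕ) (w : Word (Fin 46)) : GroupG f t :=
  QuotientGroup.mk (FreeGroup.mk w)


namespace CD

section Amalg
variable {G : Type*} [Group G]

def P (w : List (Bool × G)) : G := (w.map Prod.snd).prod

@[simp] lemma P_nil : P ([] : List (Bool × G)) = 1 := rfl
@[simp] lemma P_cons (x : Bool × G) (w) : P (x :: w) = x.2 * P w := by simp [P]
@[simp] lemma P_append (v w : List (Bool × G)) : P (v ++ w) = P v * P w := by simp [P]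

def winv (w : List (Bool × G)) : List (Bool × G) := (w.map fun x => (x.1, x.2⁻¹)).reverse

@[simp] lemma winv_nil : winv ([] : List (Bool × G)) = [] := rfl
@[simp] lemma winv_cons (x : Bool × G) (w) : winv (x :: w) = winv w ++ [(x.1, x.2⁻¹)] := by
  simp [winv]

@[simp] lemma P_winv (w : List (Bool × G)) : P (winv w) = (P w)⁻¹ := by
  induction w with
  | nil => simp
  | cons x w ih => simp [ih]

lemma ty_winv (w : List (Bool × G)) : (winv w).map Prod.fst = (w.map Prod.fst).reverse := by
  simp [winv, Function.comp_def]

/-- reduced words: syllables outside the base, alternating -/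
def Red (H : Bool → Subgroup G) (B : Subgroup G) (w : List (Bool × G)) : Prop :=
  (∀ x ∈ w, x.2 ∈ H x.1 ∧ x.2 ∉ B) ∧ (w.map Prod.fst).IsChain (· ≠ ·)

def CycRed (H : Bool → Subgroup G) (B : Subgroup G) (w : List (Bool × G)) : Prop :=
  w ≠ [] ∧ Red H B w ∧ (w.map Prod.fst).head? ≠ (w.map Prod.fst).getLast?

structure Amalg (H : Bool → Subgroup G) (B : Subgroup G) : Prop where
  le : ∀ l, B ≤ H l
  kt : ∀ w, w ≠ [] → Red H B w → P w ∉ B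
  gen : ∀ S : Subgroup G, (∀ l, H l ≤ S) → S = ⊤
  mal : ∀ l, ∀ s ∈ H l, s ∉ B → ∀ b ∈ B, s⁻¹ * b * s ∈ B → b = 1

variable {H : Bool → Subgroup G} {B : Subgroup G}

lemma Red.nil : Red H B [] := by simp [Red]

lemma Red.tail {x : Bool × G} {w} (h : Red H B (x :: w)) : Red H B w :=
  ⟨fun y hy => h.1 y (List.mem_cons_of_mem _ hy), by
    have := h.2; simp only [List.map_cons] at this; exact this.tail⟩

/-- replacing the first syllable. -/
lemma Red.head_congr {l : Bool} {s s' : G} {w} (h : Red H B ((l, s) :: w))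
    (hs : s' ∈ H l) (hs' : s' ∉ B) : Red H B ((l, s') :: w) := by
  refine ⟨?_, h.2⟩
  intro x hx
  rcases List.mem_cons.1 hx with rfl | hx
  · exact ⟨hs, hs'⟩
  · exact h.1 x (List.mem_cons_of_mem _ hx)

lemma winv_mem {w : List (Bool × G)} (h : ∀ x ∈ w, x.2 ∈ H x.1 ∧ x.2 ∉ B) :
    ∀ x ∈ winv w, x.2 ∈ H x.1 ∧ x.2 ∉ B := by
  intro x hx
  simp only [winv, List.mem_reverse, List.mem_map] at hx
  obtain ⟨y, hy, rfl⟩ := hx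
  simpa using h y hy

lemma mul_mem_B {l : Bool} {s b : G} (hb : b ∈ B) (hs : s ∈ H l ∧ s ∉ B) (A : ∀ l, B ≤ H l) :
    b * s ∈ H l ∧ b * s ∉ B :=
  ⟨mul_mem (A l hb) hs.1, fun h => hs.2 (by simpa using mul_mem (inv_mem hb) h)⟩

lemma rev_chain {t : List Bool} (h : t.IsChain (· ≠ ·)) : t.reverse.IsChain (· ≠ ·) := by
  rw [List.isChain_reverse]
  exact h.imp fun a b h => h.symm

lemma chain_mid {t m s : List Bool} {l : Bool} (h1 : (t ++ l :: m).IsChain (· ≠ ·))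
    (h2 : (l :: s).IsChain (· ≠ ·)) (h3 : m = []) : (t ++ l :: s).IsChain (· ≠ ·) := by
  subst h3
  rw [List.isChain_split]
  exact ⟨h1, h2⟩

lemma chain_rev_cons {t s : List Bool} {l : Bool} (h1 : (l :: t).IsChain (· ≠ ·))
    (h2 : (l :: s).IsChain (· ≠ ·)) : (t.reverse ++ l :: s).IsChain (· ≠ ·) := by
  refine chain_mid (m := []) ?_ h2 rfl
  simpa using rev_chain h1

lemma chain_app {t s : List Bool} {l : Bool} (h1 : (t ++ [l]).IsChain (· ≠ ·))
    (h2 : (l :: s).IsChain (· ≠ ·)) : (t ++ l :: s).IsChain (· ≠ ·) :=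
  chain_mid (m := []) h1 h2 rfl

theorem link (A : Amalg H B) : ∀ (w v : List (Bool × G)), Red H B w → Red H B v → ∀ b ∈ B,
    b * P w = P v → w.map Prod.fst = v.map Prod.fst ∧
      ∀ x ∈ w.head?, ∀ y ∈ v.head?, ∃ b' ∈ B, b * x.2 = y.2 * b' := by
  intro w
  induction w with
  | nil =>
    intro v hw hv b hb h
    rcases v with _ | ⟨y, v⟩
    · simp
    · exact absurd (by rw [← h]; simpa using hb) (A.kt _ (by simp) hv)
  | cons x w ih =>
    intro v hw hv b hb h
    rcases v with _ | ⟨y, v⟩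
    · refine absurd ?_ (A.kt _ (by simp) hw)
      have : P (x :: w) = b⁻¹ := by
        rw [P_nil] at h; exact eq_inv_of_mul_eq_one_right h
      rw [this]; exact inv_mem hb
    · obtain ⟨l, s⟩ := x
      obtain ⟨l', s'⟩ := y
      have hs := hw.1 (l, s) (by simp)
      have hs' := hv.1 (l', s') (by simp)
      have hbs := mul_mem_B hb hs A.le
      simp only [P_cons] at h
      by_cases hl : l' = l
      · subst hl
        by_cases hB : s'⁻¹ * (b * s) ∈ B
        · have := ih v hw.tail hv.tail _ hB (by rw [mul_assoc, mul_assoc, h]; group)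
          refine ⟨by simp [this.1], ?_⟩
          simp only [List.head?_cons, Option.mem_def, Option.some.injEq]
          rintro _ rfl _ rfl
          exact ⟨_, hB, by group⟩
        · exfalso
          refine A.kt (winv v ++ (l', s'⁻¹ * (b * s)) :: w) (by simp) ⟨?_, ?_⟩ ?_
          · intro x hx
            rcases List.mem_append.1 hx with hx | hx
            · exact winv_mem hv.tail.1 x hx
            · rcases List.mem_cons.1 hx with rfl | hx
              · exact ⟨mul_mem (inv_mem hs'.1) hbs.1, hB⟩
              · exact hw.tail.1 x hx
          · have h1 := hv.2
            have h2 := hw.2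
            simp only [List.map_append, ty_winv, List.map_cons] at h1 h2 ⊢
            exact chain_rev_cons h1 h2
          · have : P (winv v ++ (l', s'⁻¹ * (b * s)) :: w) = 1 := by
              simp only [P_append, P_winv, P_cons]
              rw [mul_assoc s'⁻¹, mul_assoc b, h]; group
            rw [this]; exact one_mem _
      · exfalso
        refine A.kt (winv ((l', s') :: v) ++ (l, b * s) :: w) (by simp) ⟨?_, ?_⟩ ?_
        · intro x hx
          rcases List.mem_append.1 hx with hx | hx
          · exact winv_mem hv.1 x hx
          · rcases List.mem_cons.1 hx with rfl | hx
            · exact hbs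
            · exact hw.tail.1 x hx
        · have h1 := hv.2
          have h2 := hw.2
          simp only [List.map_append, ty_winv, List.map_cons, List.reverse_cons,
            List.append_assoc, List.singleton_append] at h1 h2 ⊢
          exact chain_rev_cons h1 (List.isChain_cons_cons.2 ⟨hl, h2⟩)
        · have : P (winv ((l', s') :: v) ++ (l, b * s) :: w) = 1 := by
            rw [P_append, P_winv, P_cons, P_cons, ← h]; group
          rw [this]; exact one_mem _

lemma link_ty (A : Amalg H B) {w v : List (Bool × G)} (hw : Red H B w) (hv : Red H B v)
    (h : P w = P v) : w.map Prod.fst = v.map Prod.fst :=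
  (link A w v hw hv 1 (one_mem _) (by simpa using h)).1

/-- `g` is `b` times a reduced word of length at most `n`. -/
def Len (H : Bool → Subgroup G) (B : Subgroup G) (n : ℕ) (g : G) : Prop :=
  ∃ w, Red H B w ∧ w.length ≤ n ∧ ∃ b ∈ B, g = b * P w

lemma Len.cases (A : Amalg H B) {n : ℕ} {g : G} (h : Len H B n g) :
    g ∈ B ∨ ∃ m l s w, n = m + 1 ∧ Red H B ((l, s) :: w) ∧ w.length ≤ m ∧ g = s * P w := by
  obtain ⟨w, hw, hn, b, hb, rfl⟩ := h
  rcases w with _ | ⟨⟨l, s⟩, w⟩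
  · left; simpa using hb
  · right
    obtain ⟨m, rfl⟩ : ∃ m, n = m + 1 := ⟨n - 1, by simp at hn; omega⟩
    have := mul_mem_B hb (hw.1 (l, s) (by simp)) A.le
    exact ⟨m, l, b * s, w, rfl, hw.head_congr this.1 this.2, by simpa using hn, by simp [mul_assoc]⟩

theorem exists_len (A : Amalg H B) (g : G) : ∃ n, Len H B n g := by
  let T : Set G := {g | ∃ n, Len H B n g}
  have key : ∀ l, ∀ h ∈ H l, ∀ g ∈ T, h * g ∈ T := by
    rintro l h hh g ⟨n, hg⟩
    by_cases hB : h ∈ B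
    · obtain ⟨w, hw, -, b, hb, rfl⟩ := hg
      exact ⟨_, w, hw, le_rfl, h * b, mul_mem hB hb, by group⟩
    · rcases hg.cases A with hb | ⟨m, l', s, w, rfl, hw, hm, rfl⟩
      · refine ⟨1, [(l, h * g)], ⟨?_, by simp⟩, by simp, 1, one_mem _, by simp⟩
        simp only [List.mem_singleton, forall_eq]
        exact ⟨mul_mem hh (A.le _ hb), fun h' => hB (by simpa using mul_mem h' (inv_mem hb))⟩
      · by_cases hl : l = l'
        · subst hl
          by_cases hB' : h * s ∈ B
          · exact ⟨_, w, hw.tail, le_rfl, _, hB', by group⟩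
          · exact ⟨_, (l, h * s) :: w, hw.head_congr (mul_mem hh (hw.1 (l, s) (by simp)).1) hB',
              le_rfl, 1, one_mem _, by simp [mul_assoc]⟩
        · refine ⟨_, (l, h) :: (l', s) :: w, ⟨?_, ?_⟩, le_rfl, 1, one_mem _, by simp⟩
          · intro x hx
            rcases List.mem_cons.1 hx with rfl | hx
            · exact ⟨hh, hB⟩
            · exact hw.1 x hx
          · have := hw.2
            simp only [List.map_cons] at this ⊢
            exact List.isChain_cons_cons.2 ⟨hl, this⟩
  have h1 : (1 : G) ∈ T := ⟨0, [], Red.nil, by simp, 1, one_mem _, by simp⟩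
  let S : Subgroup G :=
    { carrier := {x | (∀ g ∈ T, x * g ∈ T) ∧ (∀ g ∈ T, x⁻¹ * g ∈ T)}
      one_mem' := by simp
      mul_mem' := by
        rintro a b ⟨ha, ha'⟩ ⟨hb, hb'⟩
        refine ⟨fun g hg => ?_, fun g hg => ?_⟩
        · rw [mul_assoc]; exact ha _ (hb _ hg)
        · rw [mul_inv_rev, mul_assoc]; exact hb' _ (ha' _ hg)
      inv_mem' := by
        rintro a ⟨ha, ha'⟩
        exact ⟨ha', by simpa using ha⟩ }
  have hS := A.gen S fun l h hh => ⟨key l h hh, key l _ (inv_mem hh)⟩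
  have : g ∈ S := by rw [hS]; trivial
  have := this.1 1 h1
  rwa [mul_one] at this

lemma pal (t m m' : List Bool) (l : Bool) :
    (t.reverse ++ l :: m).head? = (m' ++ l :: t).getLast? := by
  rw [List.head?_append, List.getLast?_append, List.head?_reverse, List.getLast?_cons]
  cases t.getLast? <;> simp

lemma bool_of_ne {a b c : Bool} (h : a ≠ b) : c = a ∨ c = b := by
  revert a b c; decide

theorem conj_cyc (A : Amalg H B) {w : List (Bool × G)} (hw : CycRed H B w) : ∀ (n : ℕ) (g : G)
    (w' : List (Bool × G)), Len H B n g → CycRed H B w' → g⁻¹ * P w' * g = P w →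
    ∃ w'' b, w'' ~r w' ∧ CycRed H B w'' ∧ b ∈ B ∧ b⁻¹ * P w'' * b = P w := by
  intro n
  induction n with
  | zero =>
    intro g w' hg hw' h
    rcases hg.cases A with hb | ⟨m, _, _, _, hm, -⟩
    · exact ⟨w', g, List.IsRotated.refl _, hw', hb, h⟩
    · omega
  | succ n ih =>
    intro g w' hg hw' h
    rcases hg.cases A with hb | ⟨m, l, s, gl, hm, hgl, hlen, rfl⟩
    · exact ⟨w', g, List.IsRotated.refl _, hw', hb, h⟩
    obtain rfl : n = m := by omega
    obtain ⟨hne, hred, hty⟩ := hw'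
    have hs := hgl.1 (l, s) (by simp)
    rcases w' with _ | ⟨⟨l1, s1⟩, w1⟩
    · exact absurd rfl hne
    rcases List.eq_nil_or_concat w1 with rfl | ⟨w2, ⟨l2, s2⟩, rfl⟩
    · simp at hty
    simp only [List.concat_eq_append] at *
    have hs1 := hred.1 (l1, s1) (by simp)
    have hs2 := hred.1 (l2, s2) (by simp)
    have hty' : l1 ≠ l2 := by
      intro h; apply hty; subst h; simp [List.getLast?_append, List.getLast?_cons]
    have hmid : ∀ x ∈ w2, x.2 ∈ H x.1 ∧ x.2 ∉ B := fun x hx => hred.1 x (by simp [hx])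
    have hc := hred.2
    have hcg := hgl.2
    have hglm := hgl.tail.1
    simp only [List.map_cons, List.map_append, List.map_nil] at hc hcg
    rcases bool_of_ne hty' (c := l) with rfl | rfl
    · by_cases hB : s⁻¹ * s1 ∈ B
      · have hcyc : CycRed H B ((w2 ++ [(l2, s2)]) ++ [(l, s1)]) := by
          refine ⟨by simp, ⟨?_, ?_⟩, ?_⟩
          · intro x hx; exact hred.1 x (by simp at hx ⊢; tauto)
          · simp only [List.map_append, List.map_cons, List.map_nil, List.append_assoc,
              List.singleton_append]
            exact chain_app (List.IsChain.tail hc) (by simpa using hty'.symm)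
          · rcases w2 with _ | ⟨x, w2⟩
            · simpa using hty'.symm
            · simp only [List.map_cons, List.map_append] at hc ⊢
              have : l ≠ x.1 := by
                simp only [List.cons_append] at hc
                exact (List.isChain_cons_cons.1 hc).1
              simp [List.getLast?_cons, List.getLast?_append]
              exact this.symm
        obtain ⟨w'', b, hr, h1, h2, h3⟩ := ih (s1⁻¹ * s * P gl) _
          ⟨gl, hgl.tail, hlen, s1⁻¹ * s, by simpa using inv_mem hB, rfl⟩ hcyc
          (by rw [← h]; simp; group)
        exact ⟨w'', b, hr.trans ⟨w2.length + 1, by simp [List.rotate_append_length_eq,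
          show w2.length + 1 = (w2 ++ [(l2, s2)]).length by simp, -List.length_append,
          -List.append_assoc]⟩, h1, h2, h3⟩
      · exfalso
        have hR : Red H B (winv gl ++ (l, s⁻¹ * s1) :: (w2 ++ [(l2, s2)]) ++ (l, s) :: gl) := by
          refine ⟨?_, ?_⟩
          · simp only [List.mem_append, List.mem_cons]
            rintro x ((hx | (rfl | hx)) | (rfl | hx))
            · exact winv_mem hglm x hx
            · exact ⟨mul_mem (inv_mem hs.1) hs1.1, hB⟩
            · exact hred.1 x (by simp at hx ⊢; tauto)
            · exact hs
            · exact hglm x hx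
          · simp only [List.map_append, List.map_cons, List.map_nil, ty_winv, List.append_assoc,
              List.cons_append, List.nil_append]
            refine chain_rev_cons hcg ?_
            have := chain_app (t := l :: w2.map Prod.fst) (l := l2) hc
              (List.isChain_cons_cons.2 ⟨hty'.symm, hcg⟩)
            simpa using this
        have := link_ty A hw.2.1 hR (by rw [← h]; simp; group)
        apply hw.2.2
        rw [this]
        simp only [List.map_append, List.map_cons, ty_winv]
        rw [← pal (m := (w2 ++ [(l2, s2)]).map Prod.fst ++ l :: gl.map Prod.fst)]
        simp
    · by_cases hB : s2 * s ∈ B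
      · have hcyc : CycRed H B ((l, s2) :: ((l1, s1) :: w2)) := by
          refine ⟨by simp, ⟨?_, ?_⟩, ?_⟩
          · intro x hx; exact hred.1 x (by simp at hx ⊢; tauto)
          · simp only [List.map_cons]
            refine List.isChain_cons_cons.2 ⟨hty'.symm, ?_⟩
            have := ((List.isChain_append (l₁ := l1 :: w2.map Prod.fst) (l₂ := [l])).1 hc).1
            exact this
          · rcases List.eq_nil_or_concat w2 with rfl | ⟨w2, x, rfl⟩
            · simpa using hty'.symm
            · have := ((List.isChain_append (l₁ := l1 :: (w2.concat x).map Prod.fst) (l₂ := [l])).1 hc).2.2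
              simp only [List.concat_eq_append, List.map_cons, List.map_append, List.map_nil] at this ⊢
              have := this x.1 (by simp [List.getLast?_cons]) l (by simp)
              simp [List.getLast?_cons]
              exact this.symm
        obtain ⟨w'', b, hr, h1, h2, h3⟩ := ih (s2 * s * P gl) _
          ⟨gl, hgl.tail, hlen, s2 * s, hB, rfl⟩ hcyc
          (by rw [← h]; simp; group)
        exact ⟨w'', b, hr.trans ⟨1, by simp⟩, h1, h2, h3⟩
      · exfalso
        have hR : Red H B (winv gl ++ (l, s⁻¹) :: ((l1, s1) :: w2) ++ (l, s2 * s) :: gl) := by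
          refine ⟨?_, ?_⟩
          · simp only [List.mem_append, List.mem_cons]
            rintro x ((hx | (rfl | (rfl | hx))) | (rfl | hx))
            · exact winv_mem hglm x hx
            · simpa using hs
            · exact hs1
            · exact hmid x hx
            · exact ⟨mul_mem hs2.1 hs.1, hB⟩
            · exact hglm x hx
          · simp only [List.map_append, List.map_cons, ty_winv, List.append_assoc,
              List.cons_append]
            refine chain_rev_cons hcg (List.isChain_cons_cons.2 ⟨hty'.symm, ?_⟩)
            exact chain_app (t := l1 :: w2.map Prod.fst) (l := l) hc hcg
        have := link_ty A hw.2.1 hR (by rw [← h]; simp; group)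
        apply hw.2.2
        rw [this]
        simp only [List.map_append, List.map_cons, ty_winv, List.append_assoc, List.cons_append]
        rw [pal (m' := (gl.map Prod.fst).reverse ++ l :: l1 :: w2.map Prod.fst)]
        simp

/-- `y` is not conjugate in `H l` into the base. -/
def NC (H : Bool → Subgroup G) (B : Subgroup G) (l : Bool) (y : G) : Prop :=
  ∀ h ∈ H l, h⁻¹ * y * h ∉ B

lemma pal_red {t : List (Bool × G)} {l : Bool} {y : G} (ht : Red H B ((l, y) :: t)) :
    Red H B (winv t ++ (l, y) :: t) := by
  refine ⟨?_, ?_⟩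
  · simp only [List.mem_append]
    rintro x (hx | hx)
    · exact winv_mem ht.tail.1 x hx
    · exact ht.1 x hx
  · have := ht.2
    simp only [List.map_append, List.map_cons, ty_winv] at this ⊢
    exact chain_rev_cons this this

lemma pal_ne_cyc (A : Amalg H B) {t : List (Bool × G)} {l : Bool} {y : G}
    (ht : Red H B ((l, y) :: t)) {w} (hw : CycRed H B w) : (P t)⁻¹ * y * P t ≠ P w := by
  intro h
  have := link_ty A hw.2.1 (pal_red ht) (by rw [← h]; simp; group)
  apply hw.2.2
  rw [this]
  simp only [List.map_append, List.map_cons, ty_winv]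
  rw [pal]

lemma nc_conj (A : Amalg H B) : ∀ (n : ℕ) (g : G) (l : Bool) (y : G),
    Len H B n g → y ∈ H l → NC H B l y →
    (∀ w, CycRed H B w → g⁻¹ * y * g ≠ P w) ∧
    (∀ l', g⁻¹ * y * g ∈ H l' → l = l' ∧ g ∈ H l) := by
  have base : ∀ (g : G) (l : Bool) (y : G), g ∈ B → y ∈ H l → NC H B l y →
    (∀ w, CycRed H B w → g⁻¹ * y * g ≠ P w) ∧
    (∀ l', g⁻¹ * y * g ∈ H l' → l = l' ∧ g ∈ H l) := by
    intro g l y hg hy hnc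
    have hx := hnc g (A.le _ hg)
    have hx' : g⁻¹ * y * g ∈ H l := mul_mem (mul_mem (inv_mem (A.le _ hg)) hy) (A.le _ hg)
    have hr : ∀ l', g⁻¹ * y * g ∈ H l' → Red H B [(l', g⁻¹ * y * g)] := by
      intro l' hl'
      exact ⟨by simpa using ⟨hl', hx⟩, by simp⟩
    refine ⟨fun w hw h => pal_ne_cyc A (hr l hx') hw (by simpa using h), fun l' hl' => ?_⟩
    have := link_ty A (hr l hx') (hr l' hl') rfl
    exact ⟨by simpa using this, A.le _ hg⟩
  intro n
  induction n with
  | zero =>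
    intro g l y hg
    rcases hg.cases A with hb | ⟨m, _, _, _, hm, -⟩
    · exact base g l y hb
    · omega
  | succ n ih =>
    intro g l y hg hy hnc
    rcases hg.cases A with hb | ⟨m, l1, s, gl, hm, hgl, hlen, rfl⟩
    · exact base g l y hb hy hnc
    obtain rfl : n = m := by omega
    have hs := hgl.1 (l1, s) (by simp)
    by_cases hl : l1 = l
    · subst hl
      have := ih (P gl) l1 (s⁻¹ * y * s) ⟨gl, hgl.tail, hlen, 1, one_mem _, by simp⟩
        (mul_mem (mul_mem (inv_mem hs.1) hy) hs.1) (by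
          intro h hh
          have := hnc (s * h) (mul_mem hs.1 hh)
          convert this using 1; group)
      have e : (s * P gl)⁻¹ * y * (s * P gl) = (P gl)⁻¹ * (s⁻¹ * y * s) * P gl := by group
      rw [e]
      exact ⟨this.1, fun l' hl' => ⟨(this.2 l' hl').1, mul_mem hs.1 (this.2 l' hl').2⟩⟩
    · have hyB : y ∉ B := by simpa using hnc 1 (one_mem _)
      have hR : Red H B ((l, y) :: (l1, s) :: gl) := by
        refine ⟨?_, ?_⟩
        · intro x hx
          rcases List.mem_cons.1 hx with rfl | hx
          · exact ⟨hy, hyB⟩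
          · exact hgl.1 x hx
        · have := hgl.2
          simp only [List.map_cons] at this ⊢
          exact List.isChain_cons_cons.2 ⟨fun h => hl h.symm, this⟩
      refine ⟨fun w hw => by simpa using pal_ne_cyc A hR hw, fun l' hl' => ?_⟩
      exfalso
      by_cases hB : (s * P gl)⁻¹ * y * (s * P gl) ∈ B
      · refine A.kt _ (by simp) (pal_red hR) ?_
        convert hB using 1
        simp; group
      · have := link_ty A (pal_red hR) (v := [(l', (s * P gl)⁻¹ * y * (s * P gl))])
          ⟨by simpa using ⟨by simpa using hl', by simpa using hB⟩, by simp⟩ (by simp; group)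
        have := congrArg List.length this
        simp at this
        omega

lemma base_conj (A : Amalg H B) (n : ℕ) (g : G) (e : G) (hg : Len H B n g)
    (he : e ∈ B) (he1 : e ≠ 1) :
    (∀ w, CycRed H B w → g⁻¹ * e * g ≠ P w) ∧ (g⁻¹ * e * g ∈ B → g ∈ B) := by
  rcases hg.cases A with hb | ⟨m, l, s, gl, hm, hgl, hlen, rfl⟩
  · refine ⟨fun w hw h => A.kt w hw.1 hw.2.1 ?_, fun _ => hb⟩
    rw [← h]; exact mul_mem (mul_mem (inv_mem hb) he) hb
  · have hs := hgl.1 (l, s) (by simp)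
    have hR : Red H B ((l, s⁻¹ * e * s) :: gl) :=
      hgl.head_congr (mul_mem (mul_mem (inv_mem hs.1) (A.le _ he)) hs.1)
        fun h => he1 (A.mal l s hs.1 hs.2 e he h)
    have e : (s * P gl)⁻¹ * e * (s * P gl) = (P gl)⁻¹ * (s⁻¹ * e * s) * P gl := by group
    rw [e]
    refine ⟨fun w hw => pal_ne_cyc A hR hw, fun h => ?_⟩
    exfalso
    refine A.kt _ (by simp) (pal_red hR) ?_
    convert h using 1
    simp; group

theorem ell_hyp (A : Amalg H B) {l y} (hy : y ∈ H l) {w} (hw : CycRed H B w) (g : G) :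
    g⁻¹ * y * g ≠ P w := by
  by_cases hnc : NC H B l y
  · obtain ⟨n, hn⟩ := exists_len A g
    exact (nc_conj A n g l y hn hy hnc).1 w hw
  · simp only [NC, not_forall, not_not] at hnc
    obtain ⟨h, hh, hB⟩ := hnc
    by_cases h1 : h⁻¹ * y * h = 1
    · have : y = 1 := by
        have : y = h * (h⁻¹ * y * h) * h⁻¹ := by group
        rw [this, h1]; group
      subst this
      intro h
      exact A.kt w hw.1 hw.2.1 (by rw [← h]; simp)
    · obtain ⟨n, hn⟩ := exists_len A (h⁻¹ * g)
      have := (base_conj A n _ _ hn hB h1).1 w hw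
      intro h'
      apply this
      rw [← h']; group

theorem ell_diff (A : Amalg H B) {l l' y g} (hy : y ∈ H l) (hy' : g⁻¹ * y * g ∈ H l')
    (hl : l ≠ l') : ¬ NC H B l y := by
  intro hnc
  obtain ⟨n, hn⟩ := exists_len A g
  exact hl ((nc_conj A n g l y hn hy hnc).2 l' hy').1

theorem ell_same (A : Amalg H B) {l y g} (hy : y ∈ H l) (hy' : g⁻¹ * y * g ∈ H l) :
    ∃ h ∈ H l, h⁻¹ * y * h = g⁻¹ * y * g := by
  by_cases hnc : NC H B l y
  · obtain ⟨n, hn⟩ := exists_len A g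
    exact ⟨g, ((nc_conj A n g l y hn hy hnc).2 l hy').2, rfl⟩
  by_cases hnc' : NC H B l (g⁻¹ * y * g)
  · obtain ⟨n, hn⟩ := exists_len A g⁻¹
    have := ((nc_conj A n _ l _ hn hy' hnc').2 l (by convert hy using 1; group)).2
    exact ⟨g, by simpa using this, rfl⟩
  · simp only [NC, not_forall, not_not] at hnc hnc'
    obtain ⟨h, hh, hB⟩ := hnc
    obtain ⟨h', hh', hB'⟩ := hnc'
    by_cases h1 : h⁻¹ * y * h = 1
    · have : y = 1 := by
        have : y = h * (h⁻¹ * y * h) * h⁻¹ := by group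
        rw [this, h1]; group
      subst this
      exact ⟨1, one_mem _, by group⟩
    · obtain ⟨n, hn⟩ := exists_len A (h⁻¹ * g * h')
      have := (base_conj A n _ _ hn hB h1).2 (by convert hB' using 1; group)
      refine ⟨h * (h⁻¹ * g * h') * h'⁻¹, mul_mem (mul_mem hh (A.le _ this)) (inv_mem hh'), ?_⟩
      group

theorem classify (A : Amalg H B) (g : G) :
    (∃ h l y, y ∈ H l ∧ g = h * y * h⁻¹) ∨ ∃ h w, CycRed H B w ∧ g = h * P w * h⁻¹ := by
  obtain ⟨n, hn⟩ := exists_len A g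
  induction n using Nat.strong_induction_on generalizing g with
  | _ n ih =>
  rcases hn.cases A with hb | ⟨m, l, s, w, rfl, hw, hlen, rfl⟩
  · exact Or.inl ⟨1, true, g, A.le _ hb, by simp⟩
  rcases List.eq_nil_or_concat w with rfl | ⟨w, ⟨l2, s2⟩, rfl⟩
  · exact Or.inl ⟨1, l, s, (hw.1 (l, s) (by simp)).1, by simp⟩
  simp only [List.concat_eq_append] at *
  by_cases hl : l = l2
  · subst hl
    have hm : m ≠ 0 := by rintro rfl; simp at hlen
    have hred : Red H B ((l, s) :: w) := by
      refine ⟨fun x hx => hw.1 x (by simp at hx ⊢; tauto), ?_⟩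
      have := hw.2
      simp only [List.map_cons, List.map_append, ← List.cons_append] at this
      exact (List.isChain_append.1 this).1
    have hs := hw.1 (l, s) (by simp)
    have hs2 := hw.1 (l, s2) (by simp)
    have key : ∃ k < m + 1, Len H B k (s2 * s * P w) := by
      simp at hlen
      by_cases hB : s2 * s ∈ B
      · exact ⟨m, by omega, w, hred.tail, by omega, _, hB, rfl⟩
      · exact ⟨m, by omega, (l, s2 * s) :: w, hred.head_congr (mul_mem hs2.1 hs.1) hB, by simpa using hlen,
          1, one_mem _, by simp⟩
    obtain ⟨k, hk, hL⟩ := key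
    rcases ih k hk _ hL with ⟨h, l', y, hy, he⟩ | ⟨h, w', hw', he⟩
    · refine Or.inl ⟨s2⁻¹ * h, l', y, hy, ?_⟩
      have : s * P (w ++ [(l, s2)]) = s2⁻¹ * (s2 * s * P w) * s2 := by simp; group
      rw [this, he]; group
    · refine Or.inr ⟨s2⁻¹ * h, w', hw', ?_⟩
      have : s * P (w ++ [(l, s2)]) = s2⁻¹ * (s2 * s * P w) * s2 := by simp; group
      rw [this, he]; group
  · refine Or.inr ⟨1, _, ⟨by simp, hw, ?_⟩, by simp⟩
    simpa [List.getLast?_cons] using hl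

end Amalg
end CD

namespace CD
section Push
open Monoid
variable {F : Type} {C : Type} [Group F] [Group C]

abbrev Pu (φ : Bool → C →* F) : Type := PushoutI (G := fun _ : Bool => F) φ
abbrev pof (φ : Bool → C →* F) (l : Bool) : F →* Pu φ := PushoutI.of (φ := φ) l

def HH (φ : Bool → C →* F) (l : Bool) : Subgroup (Pu φ) := (pof φ l).range
def BB (φ : Bool → C →* F) : Subgroup (Pu φ) := (PushoutI.base φ).range

variable {φ : Bool → C →* F} (hφ : ∀ l, Function.Injective (φ l))

include hφ in
lemma pof_inj (l : Bool) : Function.Injective (pof φ l) := PushoutI.of_injective hφ l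

lemma pof_phi (l : Bool) (c : C) : pof φ l (φ l c) = PushoutI.base φ c :=
  PushoutI.of_apply_eq_base φ l c

include hφ in
lemma pof_mem_BB {l : Bool} {y : F} : pof φ l y ∈ BB φ ↔ y ∈ (φ l).range := by
  constructor
  · rintro ⟨c, hc⟩
    refine ⟨c, pof_inj hφ l ?_⟩
    rw [pof_phi, hc]
  · rintro ⟨c, rfl⟩
    exact ⟨c, (pof_phi l c).symm⟩

def toP (φ : Bool → C →* F) (w : List (Bool × F)) : List (Bool × Pu φ) :=
  w.map fun x => (x.1, pof φ x.1 x.2)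

include hφ in
lemma amalg_push (hmal : ∀ l y, y ∉ (φ l).range → ∀ c d, φ l c * y = y * φ l d → c = 1) :
    Amalg (HH φ) (BB φ) := by
  constructor
  · rintro l _ ⟨c, rfl⟩
    exact ⟨φ l c, pof_phi l c⟩
  · intro w hne hred hmem
    obtain ⟨v, rfl⟩ : ∃ v, w = toP φ v := by
      have : ∀ x ∈ w, ∃ y : Bool × F, (y.1, pof φ y.1 y.2) = x := by
        intro x hx
        obtain ⟨y, hy⟩ := (hred.1 x hx).1
        exact ⟨(x.1, y), by simp [hy]⟩
      choose! k hk using this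
      refine ⟨w.map k, ?_⟩
      rw [toP, List.map_map]
      conv_lhs => rw [← List.map_id w]
      exact List.map_congr_left fun x hx => by simp [hk x hx]
    have hv : ∀ x ∈ v, x.2 ∉ (φ x.1).range := by
      intro x hx
      have := (hred.1 _ (List.mem_map_of_mem hx)).2
      exact fun h => this ((pof_mem_BB hφ).2 h)
    have hc := hred.2
    rw [toP, List.map_map] at hc
    let W : CoprodI.Word (fun _ : Bool => F) :=
      { toList := v.map fun x => ⟨x.1, x.2⟩
        ne_one := by
          intro l hl
          simp only [List.mem_map] at hl
          obtain ⟨x, hx, rfl⟩ := hl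
          intro h
          exact hv x hx (by simp only at h; rw [h]; exact one_mem _)
        chain_ne := by
          rw [List.isChain_map]
          rw [List.isChain_map] at hc
          exact hc }
    have hW : PushoutI.Reduced φ W := by
      intro g hg
      simp only [W, List.mem_map] at hg
      obtain ⟨x, hx, rfl⟩ := hg
      exact hv x hx
    have hp : PushoutI.ofCoprodI (φ := φ) W.prod = P (toP φ v) := by
      simp only [CoprodI.Word.prod, W, P, toP, List.map_map, map_list_prod, Function.comp_def]
      simp
    have := hW.eq_empty_of_mem_range hφ (by rw [hp]; exact hmem)
    have : W.toList = [] := by rw [this]; rfl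
    simp [W] at this
    subst this
    exact hne rfl
  · intro S hS
    rw [eq_top_iff]
    rintro g -
    induction g using PushoutI.induction_on with
    | of i g => exact hS i ⟨g, rfl⟩
    | base h => exact hS true ⟨φ true h, pof_phi _ _⟩
    | mul x y hx hy => exact mul_mem hx hy
  · rintro l _ ⟨y, rfl⟩ hy _ ⟨c, rfl⟩ ⟨d, hd⟩
    have : φ l c * y = y * φ l d := by
      apply pof_inj hφ l
      rw [map_mul, map_mul, pof_phi, pof_phi, hd]; group
    rw [hmal l y (fun h => hy ((pof_mem_BB hφ).2 h)) c d this, map_one]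

end Push
end CD

namespace CD
section FG
open FreeGroup

lemma red_left {β : Type*} {a b : List (β × Bool)} (h : FreeGroup.IsReduced (a ++ b)) :
    FreeGroup.IsReduced a := (List.isChain_append.1 h).1

lemma red_right {β : Type*} {a b : List (β × Bool)} (h : FreeGroup.IsReduced (a ++ b)) :
    FreeGroup.IsReduced b := (List.isChain_append.1 h).2.1
variable {α : Type*} [DecidableEq α]

lemma suffix_mul (g : FreeGroup α) (L : List (α × Bool)) :
    g.toWord.drop L.length <:+ (mk L * g).toWord := by
  induction L with
  | nil => simp [← one_eq_mk]
  | cons x L ih =>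
    have h1 : mk (x :: L) * g = mk [x] * (mk L * g) := by
      rw [← mul_assoc, mul_mk]; rfl
    rw [h1]
    generalize mk L * g = h at ih
    have h2 : (mk [x] * h).toWord = reduce (x :: h.toWord) := by
      rw [toWord_mul, toWord_mk]; rfl
    rw [h2, reduce.cons, reduce_toWord]
    have h3 : g.toWord.drop (L.length + 1) <:+ g.toWord.drop L.length := by
      rw [← List.drop_drop]; exact List.drop_suffix _ _
    rw [List.length_cons]
    cases hh : h.toWord with
    | nil =>
      rw [hh] at ih
      simp only [List.suffix_nil, List.drop_eq_nil_iff] at ih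
      rw [List.drop_eq_nil_iff.2 (by omega)]
      exact List.nil_suffix
    | cons y tl =>
      rw [hh] at ih
      simp only
      split_ifs
      · rcases List.suffix_cons_iff.1 ih with h | h
        · have : List.drop (L.length + 1) g.toWord = tl := by
            rw [← List.drop_drop, h]; rfl
          rw [this]
        · exact h3.trans h
      · exact (h3.trans ih).trans (List.suffix_cons _ _)

lemma suffix_mul' (g y : FreeGroup α) : g.toWord.drop y.norm <:+ (y * g).toWord := by
  have := suffix_mul g y.toWord
  rwa [mk_toWord] at this

lemma invRev_append' (L M : List (α × Bool)) : invRev (L ++ M) = invRev M ++ invRev L := by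
  simp [invRev]

lemma pfx_mul' (g y : FreeGroup α) : g.toWord.take (g.norm - y.norm) <+: (g * y).toWord := by
  obtain ⟨c, hc⟩ := suffix_mul' g⁻¹ y⁻¹
  rw [← mul_inv_rev, toWord_inv, toWord_inv, norm_inv_eq] at hc
  refine ⟨invRev c, ?_⟩
  have := congrArg invRev hc
  rw [invRev_append', invRev_invRev] at this
  rw [← this]
  congr 1
  simp only [invRev, List.map_reverse, List.drop_reverse, List.length_map, List.map_take, List.map_map, List.reverse_reverse]
  simp [FreeGroup.norm, Function.comp_def]

/-- Sandwich lemma. -/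
lemma sandwich (g y y' : FreeGroup α) (E1 J E3 : List (α × Bool)) (h : g.toWord = E1 ++ J ++ E3)
    (h1 : E1.length = y.norm) (h3 : E3.length = y'.norm) :
    ∃ c c', (y⁻¹ * g * y').toWord = c ++ J ++ c' ∧ mk c = y⁻¹ * mk E1 := by
  obtain ⟨c, hc⟩ := suffix_mul' g y⁻¹
  rw [h, norm_inv_eq, ← h1, List.append_assoc, List.drop_left] at hc
  obtain ⟨c', hc'⟩ := pfx_mul' (y⁻¹ * g) y'
  have hn : (y⁻¹ * g).norm = (c ++ J).length + y'.norm := by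
    rw [FreeGroup.norm, ← hc, ← h3]; simp; omega
  rw [hn, ← hc, Nat.add_sub_cancel, ← List.append_assoc, List.take_left] at hc'
  refine ⟨c, c', hc'.symm, ?_⟩
  have e1 : mk c * mk (J ++ E3) = y⁻¹ * g := by
    rw [mul_mk, hc, mk_toWord]
  have e2 : g = mk E1 * mk (J ++ E3) := by
    rw [mul_mk, ← List.append_assoc, ← h, mk_toWord]
  rw [e2, ← mul_assoc] at e1
  exact mul_right_cancel e1

lemma IsReduced.eq_of_mk {L M : List (α × Bool)} (hL : IsReduced L) (hM : IsReduced M)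
    (h : mk L = mk M) : L = M := by
  rw [← hL.reduce_eq, ← hM.reduce_eq]
  exact reduce.sound h

lemma isReduced_invRev {L : List (α × Bool)} (h : IsReduced L) : IsReduced (invRev L) := by
  rw [isReduced_iff_reduce_eq, reduce_invRev, h.reduce_eq]

lemma cyc_rot {x : α × Bool} {T : List (α × Bool)} (h : IsCyclicallyReduced (x :: T)) :
    IsCyclicallyReduced (T ++ [x]) := by
  obtain ⟨h1, h2⟩ := h
  rcases List.eq_nil_or_concat T with rfl | ⟨T, y, rfl⟩
  · exact ⟨h1, by simp⟩
  simp only [List.concat_eq_append] at *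
  refine ⟨?_, ?_⟩
  · unfold FreeGroup.IsReduced at *
    rw [List.isChain_append]
    refine ⟨h1.tail, by simp, ?_⟩
    intro a ha b hb
    simp at ha hb
    subst ha hb
    exact h2 y (by simp [List.getLast?_cons]) x (by simp)
  · intro a ha b hb
    simp only [List.getLast?_append, List.getLast?_singleton, Option.some_or, Option.mem_def, Option.some.injEq] at ha
    subst ha
    rcases T with _ | ⟨z, T⟩
    · simp at hb; subst hb
      exact (isReduced_cons_cons.1 h1).1
    · simp at hb; subst hb
      exact (isReduced_cons_cons.1 h1).1

lemma cyc_rot' {x : α × Bool} {T : List (α × Bool)} (h : IsCyclicallyReduced (T ++ [x])) :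
    IsCyclicallyReduced (x :: T) := by
  obtain ⟨h1, h2⟩ := h
  rcases T with _ | ⟨y, T⟩
  · exact ⟨h1, by simp⟩
  refine ⟨?_, ?_⟩
  · rw [isReduced_cons_cons]
    exact ⟨h2 x (by simp [List.getLast?_cons]) y (by simp),
      red_left (b := [x]) (by simpa using h1)⟩
  · intro a ha b hb
    simp at hb
    subst hb
    unfold FreeGroup.IsReduced at h1
    rw [List.isChain_append] at h1
    exact h1.2.2 a (by simpa [List.getLast?_cons] using ha) x (by simp)

lemma rot_of_conj (L : List (α × Bool)) (hL : IsCyclicallyReduced L) :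
    ∀ (gl L' : List (α × Bool)), IsReduced gl → IsCyclicallyReduced L' →
    (mk gl)⁻¹ * mk L' * mk gl = mk L → L ~r L' := by
  intro gl
  induction gl with
  | nil =>
    intro L' _ hL' h
    rw [← one_eq_mk] at h
    rw [IsReduced.eq_of_mk hL'.1 hL.1 (by simpa using h)]
  | cons x gl ih =>
    intro L' hgl hL' h
    rcases L' with _ | ⟨y, T⟩
    · rw [IsReduced.eq_of_mk hL.1 IsReduced.nil (by rw [← h, ← one_eq_mk]; group)]
    have hx : mk (x :: gl) = mk [x] * mk gl := by rw [mul_mk]; rfl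
    have hgl' : IsReduced gl := red_right (a := [x]) hgl
    by_cases hxy : x = y
    · subst hxy
      refine (ih (T ++ [x]) hgl' (cyc_rot hL') ?_).trans ⟨T.length, by simp⟩
      rw [← h, hx, show mk (x :: T) = mk [x] * mk T by rw [mul_mk]; rfl, ← mul_mk]; group
    rcases List.eq_nil_or_concat (y :: T) with h0 | ⟨U, z, hU⟩
    · simp at h0
    rw [List.concat_eq_append] at hU
    rw [hU] at hL' h ⊢
    by_cases hxz : x = (z.1, !z.2)
    · refine (ih (z :: U) hgl' (cyc_rot' hL') ?_).trans ⟨1, by simp⟩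
      have e : mk [x] = (mk [z])⁻¹ := by
        rw [hxz, inv_mk]; simp [invRev]
      rw [← h, hx, ← mul_mk, show mk (z :: U) = mk [z] * mk U by rw [mul_mk]; rfl, e]; group
    exfalso
    have hR : IsReduced (invRev (x :: gl) ++ (U ++ [z]) ++ (x :: gl)) := by
      refine IsReduced.append_overlap ?_ ?_ (by simp)
      · unfold FreeGroup.IsReduced
        rw [List.isChain_append]
        refine ⟨isReduced_invRev hgl, hL'.1, ?_⟩
        intro a ha b hb
        rw [← hU] at hb
        simp [invRev] at ha hb
        subst ha hb
        simp
        intro h1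
        by_contra h2
        exact hxy (Prod.ext h1 (by simpa using h2))
      · unfold FreeGroup.IsReduced
        rw [List.isChain_append]
        refine ⟨hL'.1, hgl, ?_⟩
        intro a ha b hb
        simp at ha hb
        subst ha hb
        intro h1
        by_contra h2
        exact hxz (Prod.ext h1.symm (by revert h2; cases x.2 <;> cases z.2 <;> simp))
    have e := IsReduced.eq_of_mk hR hL.1 (by rw [← h, inv_mk, mul_mk, mul_mk])
    have hc := hL.2
    rw [← e] at hc
    rcases List.eq_nil_or_concat (x :: gl) with h0 | ⟨V, u, hV⟩
    · simp at h0
    rw [hV, List.concat_eq_append] at hc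
    have := hc u (by simp [List.getLast?_cons]) (u.1, !u.2) (by simp [invRev])
    simp at this

/-- conjugacy in free groups, with conjugators made of prefixes -/
theorem conj_pfx {y y' : FreeGroup α} (h : IsConj y y') :
    ∃ k ≤ y.toWord.length, ∃ j ≤ y'.toWord.length,
      (mk (y.toWord.take k))⁻¹ * y * mk (y.toWord.take k) =
      (mk (y'.toWord.take j))⁻¹ * y' * mk (y'.toWord.take j) := by
  obtain ⟨g, hg⟩ := isConj_iff.1 h
  have e := reduceCyclically.conj_conjugator_reduceCyclically y.toWord
  have e' := reduceCyclically.conj_conjugator_reduceCyclically y'.toWord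
  have c := reduceCyclically.isCyclicallyReduced (isReduced_toWord (x := y))
  have c' := reduceCyclically.isCyclicallyReduced (isReduced_toWord (x := y'))
  generalize reduceCyclically y.toWord = w at *
  generalize reduceCyclically y'.toWord = w' at *
  generalize reduceCyclically.conjugator y.toWord = p at *
  generalize reduceCyclically.conjugator y'.toWord = p' at *
  have hy : y = mk p * mk w * (mk p)⁻¹ := by
    conv_lhs => rw [← mk_toWord (x := y), ← e]
    rw [inv_mk, mul_mk, mul_mk]
  have hy' : y' = mk p' * mk w' * (mk p')⁻¹ := by
    conv_lhs => rw [← mk_toWord (x := y'), ← e']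
    rw [inv_mk, mul_mk, mul_mk]
  have hrot : w' ~r w := by
    refine rot_of_conj w' c' ((mk p)⁻¹ * g⁻¹ * mk p').toWord w isReduced_toWord c ?_
    rw [mk_toWord]
    have : mk w' = (mk p')⁻¹ * y' * mk p' := by rw [hy']; group
    rw [this, ← hg, hy]; group
  obtain ⟨n, hn, hr⟩ := (List.isRotated_iff_mod.1 hrot.symm)
  rw [List.rotate_eq_drop_append_take hn] at hr
  refine ⟨p.length + n, ?_, p'.length, ?_, ?_⟩
  · rw [← e]; simp; omega
  · rw [← e']; simp
  · have t1 : y.toWord.take (p.length + n) = p ++ w.take n := by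
      rw [← e, List.append_assoc, List.take_length_add_append, List.take_append_of_le_length hn]
    have t2 : y'.toWord.take p'.length = p' := by
      rw [← e', List.append_assoc, List.take_left]
    rw [t1, t2, hy', hy, ← mul_mk]
    have : mk w' = mk (w.drop n) * mk (w.take n) := by rw [mul_mk, hr]
    have h2 : mk w = mk (w.take n) * mk (w.drop n) := by rw [mul_mk, List.take_append_drop]
    rw [this, h2]; group

end FG
end CD

namespace CD
section Leaf
open FreeGroup

structure Leaf (α : Type*) [DecidableEq α] where
  mkLeaf ::
  z : α
  p : ℕ → FreeGroup α
  q : ℕ → FreeGroup α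
  n : ℕ → ℕ
  e1 : FreeGroup α →* Multiplicative ℤ
  e2 : FreeGroup α →* Multiplicative ℤ
  n_inj : Function.Injective n
  n_pos : ∀ i, 1 ≤ n i
  zp : ∀ i, ∀ a ∈ (p i).toWord, a.1 ≠ z
  zq : ∀ i, ∀ a ∈ (q i).toWord, a.1 ≠ z
  e1_le : ∀ g, |(e1 g).toAdd| ≤ g.norm
  e2_le : ∀ g, |(e2 g).toAdd| ≤ g.norm
  e1_z : e1 (of z) = 1
  e2_z : e2 (of z) = 1
  e1_p : ∀ i, (e1 (p i)).toAdd = n i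
  e1_q : ∀ i, e1 (q i) = 1
  e2_p : ∀ i, e2 (p i) = 1
  e2_q : ∀ i, (e2 (q i)).toAdd = n i

variable {α : Type*} [DecidableEq α] (A : Leaf α)

namespace Leaf

def phi : FreeGroup ℕ →* FreeGroup α := FreeGroup.lift fun i => A.p i * of A.z ^ A.n i * A.q i

def hd (x : ℕ × Bool) : FreeGroup α := if x.2 then A.p x.1 else (A.q x.1)⁻¹
def tl (x : ℕ × Bool) : FreeGroup α := if x.2 then A.q x.1 else (A.p x.1)⁻¹
def run (x : ℕ × Bool) : List (α × Bool) := List.replicate (A.n x.1) (A.z, x.2)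

def wt (e : List (ℕ × Bool)) : ℕ := (e.map fun x => A.n x.1).sum

@[simp] lemma wt_nil : A.wt [] = 0 := rfl
@[simp] lemma wt_cons (x e) : A.wt (x :: e) = A.n x.1 + A.wt e := by simp [wt]
@[simp] lemma wt_append (e e') : A.wt (e ++ e') = A.wt e + A.wt e' := by simp [wt]

def U : ℕ × Bool → List (ℕ × Bool) → List (α × Bool)
  | x, [] => (A.tl x).toWord
  | x, y :: e => (A.tl x * A.hd y).toWord ++ A.run y ++ U y e

def E : List (ℕ × Bool) → List (α × Bool)
  | [] => []
  | x :: e => (A.hd x).toWord ++ A.run x ++ A.U x e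

def M : ℕ × Bool → List (ℕ × Bool) → ℕ × Bool → List (α × Bool)
  | x, [], w => (A.tl x * A.hd w).toWord
  | x, y :: e, w => (A.tl x * A.hd y).toWord ++ A.run y ++ M y e w

def Lw : List (ℕ × Bool) → ℕ × Bool → List (α × Bool)
  | [], w => (A.hd w).toWord
  | x :: e, w => (A.hd x).toWord ++ A.run x ++ A.M x e w

lemma U_split (e1 : List (ℕ × Bool)) : ∀ x w e2,
    A.U x (e1 ++ w :: e2) = A.M x e1 w ++ A.run w ++ A.U w e2 := by
  induction e1 with
  | nil => intros; simp [U, M]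
  | cons y e1 ih => intro x w e2; simp [U, M, ih]

lemma E_split (e1 : List (ℕ × Bool)) (w e2) :
    A.E (e1 ++ w :: e2) = A.Lw e1 w ++ A.run w ++ A.U w e2 := by
  cases e1 with
  | nil => simp [E, Lw]
  | cons y e1 => simp [E, Lw, U_split]

lemma mk_replicate (z : α) (n : ℕ) (b : Bool) :
    (mk (List.replicate n (z, b)) : FreeGroup α) = if b then of z ^ n else (of z ^ n)⁻¹ := by
  have : ∀ n, (mk (List.replicate n (z, true)) : FreeGroup α) = of z ^ n := by
    intro n
    rw [← toWord_of_pow, mk_toWord]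
  cases b
  · rw [← this, inv_mk]; simp [invRev]
  · simp [this]

lemma phi_letter (x : ℕ × Bool) : A.phi (mk [x]) = A.hd x * mk (A.run x) * A.tl x := by
  obtain ⟨i, b⟩ := x
  rw [run, mk_replicate]
  cases b
  · have : (mk [(i, false)] : FreeGroup ℕ) = (of i)⁻¹ := by rw [of, inv_mk]; rfl
    rw [this, _root_.map_inv]; simp [phi, hd, tl]; group
  · have : (mk [(i, true)] : FreeGroup ℕ) = of i := rfl
    rw [this]; simp [phi, hd, tl]

lemma mk_cons' {β : Type*} (x : β × Bool) (e : List (β × Bool)) : mk (x :: e) = mk [x] * mk e := by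
  rw [mul_mk]; rfl

lemma mk_U (e : List (ℕ × Bool)) : ∀ x, mk (A.U x e) = A.tl x * A.phi (mk e) := by
  induction e with
  | nil => intro x; rw [U, mk_toWord, ← one_eq_mk, _root_.map_one, mul_one]
  | cons y e ih =>
    intro x
    rw [U, ← mul_mk, ← mul_mk, ih, mk_toWord, mk_cons', _root_.map_mul, phi_letter]; group

lemma mk_M (e : List (ℕ × Bool)) : ∀ x w, mk (A.M x e w) = A.tl x * A.phi (mk e) * A.hd w := by
  induction e with
  | nil => intro x w; rw [M, mk_toWord, ← one_eq_mk, _root_.map_one, mul_one]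
  | cons y e ih =>
    intro x w
    rw [M, ← mul_mk, ← mul_mk, ih, mk_toWord, mk_cons', _root_.map_mul, phi_letter]; group

lemma mk_E (e : List (ℕ × Bool)) : mk (A.E e) = A.phi (mk e) := by
  cases e with
  | nil => rw [E, ← one_eq_mk, ← one_eq_mk, _root_.map_one]
  | cons x e =>
    rw [E, ← mul_mk, ← mul_mk, mk_toWord, mk_U, mk_cons', _root_.map_mul, phi_letter]; group

lemma mk_Lw (e : List (ℕ × Bool)) (w) : mk (A.Lw e w) = A.phi (mk e) * A.hd w := by
  cases e with
  | nil => rw [Lw, mk_toWord, ← one_eq_mk, _root_.map_one, one_mul]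
  | cons x e =>
    rw [Lw, ← mul_mk, ← mul_mk, mk_toWord, mk_M, mk_cons', _root_.map_mul, phi_letter]; group

def Zf (L : List (α × Bool)) : Prop := ∀ a ∈ L, a.1 ≠ A.z
def NS (L : List (α × Bool)) : Prop := ∀ a ∈ L.head?, a.1 ≠ A.z
def NE (L : List (α × Bool)) : Prop := ∀ a ∈ L.getLast?, a.1 ≠ A.z

lemma Zf.ns {L} (h : A.Zf L) : A.NS L := fun a ha => h a (List.mem_of_mem_head? ha)
lemma Zf.ne {L} (h : A.Zf L) : A.NE L := fun a ha => h a (List.mem_of_mem_getLast? ha)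

lemma zf_inv {g : FreeGroup α} (h : A.Zf g.toWord) : A.Zf (g⁻¹).toWord := by
  intro a ha
  rw [toWord_inv] at ha
  simp only [invRev, List.mem_reverse, List.mem_map] at ha
  obtain ⟨b, hb, rfl⟩ := ha
  exact h b hb

lemma zf_mul {g h : FreeGroup α} (hg : A.Zf g.toWord) (hh : A.Zf h.toWord) :
    A.Zf (g * h).toWord := by
  intro a ha
  rcases List.mem_append.1 ((toWord_mul_sublist g h).subset ha) with h | h
  · exact hg a h
  · exact hh a h

lemma zf_hd (x) : A.Zf (A.hd x).toWord := by
  unfold hd; split_ifs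
  · exact A.zp _
  · exact A.zf_inv (A.zq _)

lemma zf_tl (x) : A.Zf (A.tl x).toWord := by
  unfold tl; split_ifs
  · exact A.zq _
  · exact A.zf_inv (A.zp _)

lemma join_ne {x y : ℕ × Bool} (h : x.1 = y.1 → x.2 = y.2) : (A.tl x * A.hd y).toWord ≠ [] := by
  rw [Ne, toWord_eq_nil_iff]
  intro h1
  obtain ⟨i, b⟩ := x
  obtain ⟨k, c⟩ := y
  have a1 := congrArg (fun g => (A.e1 g).toAdd) h1
  have a2 := congrArg (fun g => (A.e2 g).toAdd) h1
  have pi := A.n_pos i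
  have pk := A.n_pos k
  have hik : A.n i = A.n k → i = k := fun h => A.n_inj h
  cases b <;> cases c <;>
    simp [hd, tl, A.e1_p, A.e1_q, A.e2_p, A.e2_q] at a1 a2 h
  · omega
  · exact h (hik (by omega))
  · exact h (hik (by omega))
  · omega

lemma red3 {j T : List (α × Bool)} (hj : FreeGroup.IsReduced j) (hz : A.Zf j)
    (hT : FreeGroup.IsReduced T) (hn : A.NS T) (x) :
    FreeGroup.IsReduced (j ++ A.run x ++ T) := by
  have hpos := A.n_pos x.1
  obtain ⟨m, hm⟩ : ∃ m, A.n x.1 = m + 1 := ⟨A.n x.1 - 1, by omega⟩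
  have hr : FreeGroup.IsReduced (A.run x) := by
    rw [isReduced_iff_reduce_eq, run, reduce_replicate]
  unfold FreeGroup.IsReduced at *
  rw [List.isChain_append, List.isChain_append]
  refine ⟨⟨hj, hr, ?_⟩, hT, ?_⟩
  · intro a ha b hb h
    have := Zf.ne A hz a ha
    simp only [run, hm, List.replicate_succ, List.head?_cons, Option.mem_def, Option.some.injEq] at hb
    subst hb
    exact absurd h this
  · intro a ha b hb h
    have := hn b hb
    have : a = (A.z, x.2) := by
      simp only [run, hm, List.replicate_succ', ← List.append_assoc, List.getLast?_append,
        List.getLast?_singleton, Option.some_or, Option.mem_def, Option.some.injEq] at ha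
      exact ha.symm
    subst this
    exact absurd h.symm (hn b hb)

lemma ns_append {j T : List (α × Bool)} (hj : A.Zf j) (h : j ≠ []) : A.NS (j ++ T) := by
  intro a ha
  rcases j with _ | ⟨b, j⟩
  · exact absurd rfl h
  · simp at ha; subst ha; exact hj _ (by simp)

lemma ne_append {j T : List (α × Bool)} (hj : A.NE T) (h : T ≠ []) : A.NE (j ++ T) := by
  intro a ha
  apply hj a
  rw [List.getLast?_append] at ha
  cases hT : T.getLast? with
  | none => exact absurd (List.getLast?_eq_none_iff.1 hT) h
  | some b => rw [hT] at ha; simpa using ha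

lemma U_red (e : List (ℕ × Bool)) : ∀ x, FreeGroup.IsReduced (x :: e) →
    FreeGroup.IsReduced (A.U x e) ∧ A.NS (A.U x e) := by
  induction e with
  | nil => intro x _; exact ⟨isReduced_toWord, Zf.ns A (A.zf_tl x)⟩
  | cons y e ih =>
    intro x h
    rw [isReduced_cons_cons] at h
    have hz := A.zf_mul (A.zf_tl x) (A.zf_hd y)
    obtain ⟨h1, h2⟩ := ih y h.2
    refine ⟨A.red3 isReduced_toWord hz h1 h2 y, ?_⟩
    rw [U, List.append_assoc]
    exact A.ns_append hz (A.join_ne h.1)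

lemma M_prop (e : List (ℕ × Bool)) : ∀ x w, FreeGroup.IsReduced (x :: e ++ [w]) →
    A.NE (A.M x e w) ∧ A.M x e w ≠ [] := by
  induction e with
  | nil =>
    intro x w h
    have h := (isReduced_cons_cons.1 h).1
    exact ⟨Zf.ne A (A.zf_mul (A.zf_tl x) (A.zf_hd w)), A.join_ne h⟩
  | cons y e ih =>
    intro x w h
    obtain ⟨h1, h2⟩ := ih y w (isReduced_cons_cons.1 h).2
    exact ⟨A.ne_append h1 h2, by simp [M, h2]⟩

lemma Lw_ne (e : List (ℕ × Bool)) (w) (h : FreeGroup.IsReduced (e ++ [w])) : A.NE (A.Lw e w) := by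
  cases e with
  | nil => exact Zf.ne A (A.zf_hd w)
  | cons x e =>
    obtain ⟨h1, h2⟩ := A.M_prop e x w h
    exact A.ne_append h1 h2

lemma E_red {e : List (ℕ × Bool)} (h : FreeGroup.IsReduced e) : FreeGroup.IsReduced (A.E e) := by
  cases e with
  | nil => exact IsReduced.nil
  | cons x e =>
    obtain ⟨h1, h2⟩ := A.U_red e x h
    exact A.red3 isReduced_toWord (A.zf_hd x) h1 h2 x

lemma toWord_phi {e : List (ℕ × Bool)} (h : FreeGroup.IsReduced e) :
    (A.phi (mk e)).toWord = A.E e := by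
  rw [← mk_E, toWord_mk, (A.E_red h).reduce_eq]

lemma wt_U (e : List (ℕ × Bool)) : ∀ x, A.wt e ≤ (A.U x e).length := by
  induction e with
  | nil => intro x; simp
  | cons y e ih => intro x; have := ih y; simp [U, run]; omega

lemma wt_M (e : List (ℕ × Bool)) : ∀ x w, A.wt e ≤ (A.M x e w).length := by
  induction e with
  | nil => intro x; simp
  | cons y e ih => intro x w; have := ih y w; simp [M, run]; omega

lemma wt_E (e : List (ℕ × Bool)) : A.wt e ≤ (A.E e).length := by
  cases e with
  | nil => simp
  | cons y e => have := A.wt_U e y; simp [E, run]; omega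

lemma wt_Lw (e : List (ℕ × Bool)) (w) : A.wt e ≤ (A.Lw e w).length := by
  cases e with
  | nil => simp
  | cons y e => have := A.wt_M e y w; simp [Lw, run]; omega

/-- L1 -/
theorem wt_le (c : FreeGroup ℕ) : A.wt c.toWord ≤ (A.phi c).norm := by
  have := A.toWord_phi (isReduced_toWord (x := c))
  rw [mk_toWord] at this
  rw [FreeGroup.norm, this]
  exact A.wt_E _

lemma wt_eq_zero {c : FreeGroup ℕ} (h : A.wt c.toWord = 0) : c = 1 := by
  rw [← toWord_eq_nil_iff]
  cases hc : c.toWord with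
  | nil => rfl
  | cons x e => rw [hc] at h; have := A.n_pos x.1; simp at h; omega

theorem phi_inj : Function.Injective A.phi := by
  rw [injective_iff_map_eq_one]
  intro c hc
  apply A.wt_eq_zero
  have := A.wt_le c
  rw [hc, FreeGroup.norm_one] at this
  omega

lemma rep_split : ∀ (m n : ℕ) (s s' : Bool) (T R : List (α × Bool)), 1 ≤ m → 1 ≤ n →
    A.NS T → A.NS R →
    List.replicate m (A.z, s') ++ T = List.replicate n (A.z, s) ++ R → m = n ∧ s' = s ∧ T = R := by
  intro m
  induction m with
  | zero => intros; omega
  | succ m ih =>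
    intro n s s' T R _ hn hT hR h
    obtain ⟨n, rfl⟩ : ∃ k, n = k + 1 := ⟨n - 1, by omega⟩
    simp only [List.replicate_succ, List.cons_append, List.cons.injEq, Prod.mk.injEq, true_and] at h
    obtain ⟨rfl, h⟩ := h
    rcases Nat.eq_zero_or_pos m with rfl | hm <;> rcases Nat.eq_zero_or_pos n with rfl | hn'
    · simpa using h
    · obtain ⟨n, rfl⟩ : ∃ k, n = k + 1 := ⟨n - 1, by omega⟩
      simp at h
      subst h
      exact absurd rfl (hT (A.z, s') (by simp [List.replicate_succ]))
    · obtain ⟨m, rfl⟩ : ∃ k, m = k + 1 := ⟨m - 1, by omega⟩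
      simp at h
      subst h
      exact absurd rfl (hR (A.z, s') (by simp [List.replicate_succ]))
    · have := ih n s' s' T R hm hn' hT hR h
      simp [this.1, this.2.2]

lemma split_lemma : ∀ (j T L R : List (α × Bool)) (m n : ℕ) (s s' : Bool), 1 ≤ m → 1 ≤ n →
    A.Zf j → A.NS T → A.NE L → A.NS R →
    j ++ List.replicate m (A.z, s') ++ T = L ++ List.replicate n (A.z, s) ++ R →
    (L = j ∧ m = n ∧ s' = s ∧ T = R) ∨
      ∃ L', L = j ++ List.replicate m (A.z, s') ++ L' ∧ A.NE L' ∧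
        T = L' ++ List.replicate n (A.z, s) ++ R := by
  intro j
  induction j with
  | nil =>
    intro T L R m n s s' hm hn hj hT hL hR h
    rcases L with _ | ⟨a, L⟩
    · left
      simp only [List.nil_append] at h
      exact ⟨rfl, A.rep_split m n s s' T R hm hn hT hR h⟩
    · right
      rw [List.nil_append, List.append_assoc] at h
      rcases List.append_eq_append_iff.1 h with ⟨L', h1, h2⟩ | ⟨L', h1, h2⟩
      · refine ⟨L', by simpa using h1, ?_, by simpa using h2⟩
        rcases List.eq_nil_or_concat L' with rfl | ⟨V, u, rfl⟩
        · intro a ha; simp at ha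
        · rw [h1] at hL
          intro a ha
          apply hL a
          simp at ha ⊢
          exact ha
      · exfalso
        obtain ⟨b, hb⟩ : ∃ b, b ∈ (a :: L).getLast? := ⟨(a :: L).getLast (by simp), by simp [List.getLast?_eq_getLast_of_ne_nil]⟩
        have hb' := hL b hb
        have : b ∈ List.replicate m (A.z, s') := by
          rw [h1]; exact List.mem_append_left _ (List.mem_of_mem_getLast? hb)
        rw [List.eq_of_mem_replicate this] at hb'
        exact hb' rfl
  | cons b j ih =>
    intro T L R m n s s' hm hn hj hT hL hR h
    rcases L with _ | ⟨a, L⟩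
    · exfalso
      obtain ⟨n, rfl⟩ : ∃ k, n = k + 1 := ⟨n - 1, by omega⟩
      simp [List.replicate_succ] at h
      exact hj b (by simp) (by rw [h.1])
    · simp only [List.cons_append, List.cons.injEq] at h
      obtain ⟨rfl, h⟩ := h
      have hL' : A.NE L := by
        intro x hx
        apply hL x
        rw [List.getLast?_cons]
        simp at hx ⊢
        simp [hx]
      rcases ih T L R m n s s' hm hn (fun x hx => hj x (List.mem_cons_of_mem _ hx)) hT hL' hR h with
        h | ⟨L', h1, h2, h3⟩
      · left; simpa using h
      · right; exact ⟨L', by simp [h1], h2, h3⟩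

lemma U_back (e : List (ℕ × Bool)) : ∀ x L R n s, FreeGroup.IsReduced (x :: e) → 1 ≤ n →
    A.NE L → A.NS R → A.U x e = L ++ List.replicate n (A.z, s) ++ R →
    ∃ e1 w e2, e = e1 ++ w :: e2 ∧ A.n w.1 = n ∧ w.2 = s ∧ L = A.M x e1 w := by
  induction e with
  | nil =>
    intro x L R n s _ hn hL hR h
    exfalso
    refine A.zf_tl x (A.z, s) ?_ rfl
    rw [U] at h
    rw [h]
    obtain ⟨n, rfl⟩ : ∃ k, n = k + 1 := ⟨n - 1, by omega⟩
    simp [List.replicate_succ]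
  | cons y e ih =>
    intro x L R n s hr hn hL hR h
    rw [U, run] at h
    have hr' := (isReduced_cons_cons.1 hr)
    rcases A.split_lemma _ _ L R _ n s y.2 (A.n_pos y.1) hn (A.zf_mul (A.zf_tl x) (A.zf_hd y))
      (A.U_red e y hr'.2).2 hL hR h with ⟨h1, h2, h3, -⟩ | ⟨L', h1, h2, h3⟩
    · exact ⟨[], y, e, rfl, h2, h3, h1⟩
    · obtain ⟨e1, w, e2, he, hn', hs, hM⟩ := ih y L' R n s hr'.2 hn h2 hR h3
      exact ⟨y :: e1, w, e2, by simp [he], hn', hs, by rw [h1, hM]; rfl⟩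

lemma E_back (e : List (ℕ × Bool)) (L R n s) (hr : FreeGroup.IsReduced e) (hn : 1 ≤ n)
    (hL : A.NE L) (hR : A.NS R) (h : A.E e = L ++ List.replicate n (A.z, s) ++ R) :
    ∃ e1 w e2, e = e1 ++ w :: e2 ∧ A.n w.1 = n ∧ w.2 = s ∧ L = A.Lw e1 w := by
  cases e with
  | nil =>
    exfalso
    obtain ⟨n, rfl⟩ : ∃ k, n = k + 1 := ⟨n - 1, by omega⟩
    simp [List.replicate_succ, E] at h
  | cons y e =>
    rw [E, run] at h
    rcases A.split_lemma _ _ L R _ n s y.2 (A.n_pos y.1) hn (A.zf_hd y)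
      (A.U_red e y hr).2 hL hR h with ⟨h1, h2, h3, -⟩ | ⟨L', h1, h2, h3⟩
    · exact ⟨[], y, e, rfl, h2, h3, h1⟩
    · obtain ⟨e1, w, e2, he, hn', hs, hM⟩ := A.U_back e y L' R n s hr hn h2 hR h3
      exact ⟨y :: e1, w, e2, by simp [he], hn', hs, by rw [h1, hM]; rfl⟩

lemma eta_phi (e : List (ℕ × Bool)) : |(A.e1 (A.phi (mk e))).toAdd| ≤ A.wt e ∧
    |(A.e2 (A.phi (mk e))).toAdd| ≤ A.wt e := by
  induction e with
  | nil => rw [← one_eq_mk]; simp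
  | cons x e ih =>
    obtain ⟨i, b⟩ := x
    have e1 : |(A.e1 (A.phi (mk [(i, b)]))).toAdd| = A.n i := by
      cases b
      · have : (mk [(i, false)] : FreeGroup ℕ) = (of i)⁻¹ := by rw [of, inv_mk]; rfl
        rw [this]; simp [phi, A.e1_p, A.e1_q, A.e1_z]
      · have : (mk [(i, true)] : FreeGroup ℕ) = of i := rfl
        rw [this]; simp [phi, A.e1_p, A.e1_q, A.e1_z]
    have e2 : |(A.e2 (A.phi (mk [(i, b)]))).toAdd| = A.n i := by
      cases b
      · have : (mk [(i, false)] : FreeGroup ℕ) = (of i)⁻¹ := by rw [of, inv_mk]; rfl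
        rw [this]; simp [phi, A.e2_p, A.e2_q, A.e2_z]
      · have : (mk [(i, true)] : FreeGroup ℕ) = of i := rfl
        rw [this]; simp [phi, A.e2_p, A.e2_q, A.e2_z]
    rw [mk_cons']; simp only [_root_.map_mul, toAdd_mul]
    have := abs_add_le (A.e1 (A.phi (mk [(i, b)]))).toAdd (A.e1 (A.phi (mk e))).toAdd
    have := abs_add_le (A.e2 (A.phi (mk [(i, b)]))).toAdd (A.e2 (A.phi (mk e))).toAdd
    simp only [wt_cons]
    push_cast
    constructor <;> omega

lemma n_le_Lw (e : List (ℕ × Bool)) (w) : A.n w.1 + A.wt e ≤ 3 * (A.Lw e w).length := by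
  have h0 := A.wt_Lw e w
  have h1 := A.e1_le (mk (A.Lw e w))
  have h2 := A.e2_le (mk (A.Lw e w))
  have h3 : ((mk (A.Lw e w)).norm : ℤ) ≤ (A.Lw e w).length := by exact_mod_cast norm_mk_le
  obtain ⟨h4, h5⟩ := A.eta_phi e
  rw [mk_Lw] at h1 h2 h3
  rw [_root_.map_mul, toAdd_mul] at h1 h2
  obtain ⟨i, b⟩ := w
  rw [abs_le] at *
  cases b <;> simp [hd, A.e1_p, A.e2_q] at h1 h2 h3 ⊢ <;> omega

lemma n_le_U (e : List (ℕ × Bool)) (w) : A.n w.1 + A.wt e ≤ 3 * (A.U w e).length := by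
  have h0 := A.wt_U e w
  have h1 := A.e1_le (mk (A.U w e))
  have h2 := A.e2_le (mk (A.U w e))
  have h3 : ((mk (A.U w e)).norm : ℤ) ≤ (A.U w e).length := by exact_mod_cast norm_mk_le
  obtain ⟨h4, h5⟩ := A.eta_phi e
  rw [mk_U] at h1 h2 h3
  rw [_root_.map_mul, toAdd_mul] at h1 h2
  obtain ⟨i, b⟩ := w
  rw [abs_le] at *
  cases b <;> simp [tl, A.e1_p, A.e2_q] at h1 h2 h3 ⊢ <;> omega

lemma wt_dichotomy (a b : ℕ) : ∀ e : List (ℕ × Bool), (∀ e1 w e2, e = e1 ++ w :: e2 →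
    A.wt e1 + A.n w.1 ≤ a ∨ A.n w.1 + A.wt e2 ≤ b) → A.wt e ≤ a + b := by
  intro e
  induction e using List.reverseRecOn with
  | nil => simp
  | append_singleton e w ih =>
    intro h
    rcases h e w [] rfl with h1 | h1
    · simp; omega
    · -- find from the front
      clear ih
      by_contra hcon
      -- every suffix is heavy: go by strong statement
      have key : ∀ e2 e1, e1 ++ e2 = e ++ [w] → A.wt e1 ≤ a → A.wt (e ++ [w]) ≤ a + b := by
        intro e2
        induction e2 with
        | nil => intro e1 h1 h2; rw [← h1]; simp; omega
        | cons x e2 ih =>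
          intro e1 h1 h2
          rcases h e1 x e2 h1.symm with h3 | h3
          · exact ih (e1 ++ [x]) (by simp [h1]) (by simpa using h3)
          · rw [← h1]; simp; omega
      exact hcon (key (e ++ [w]) [] (by simp) (by simp))

/-- L2 -/
theorem wt_le_of_eq {y y' : FreeGroup α} (hy : y ∉ A.phi.range) {c d : FreeGroup ℕ}
    (h : A.phi c * y' = y * A.phi d) : A.wt c.toWord ≤ 3 * y.norm + 3 * y'.norm := by
  have hE := A.toWord_phi (isReduced_toWord (x := c))
  rw [mk_toWord] at hE
  by_cases hlen : (A.phi c).norm < y.norm + y'.norm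
  · have := A.wt_le c; omega
  apply A.wt_dichotomy
  intro e1 w e2 he
  by_contra hcon
  push Not at hcon
  have b1 := A.n_le_Lw e1 w
  have b2 := A.n_le_U e2 w
  have hredc : FreeGroup.IsReduced c.toWord := isReduced_toWord
  rw [he] at hredc
  have hredL : FreeGroup.IsReduced (e1 ++ [w]) := red_left (b := e2) (by simpa using hredc)
  have hredR : FreeGroup.IsReduced (w :: e2) := red_right (a := e1) (by simpa using hredc)
  have l1 : y.norm < (A.Lw e1 w).length := by omega
  have l2 : y'.norm < (A.U w e2).length := by omega
  have hNE := A.Lw_ne e1 w hredL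
  have hNS := (A.U_red e2 w hredR).2
  have hmkL := A.mk_Lw e1 w
  rw [he, E_split] at hE
  generalize A.Lw e1 w = L at *
  generalize A.U w e2 = R at *
  have hE' : (A.phi c).toWord = L.take y.norm ++ (L.drop y.norm ++ A.run w ++
      R.take (R.length - y'.norm)) ++ R.drop (R.length - y'.norm) := by
    rw [hE]
    simp only [List.append_assoc, List.take_append_drop]
    rw [← List.append_assoc (List.take _ L), List.take_append_drop]
  obtain ⟨k, k', hk, hmk⟩ := sandwich (A.phi c) y y' _ _ _ hE' (by simp; omega) (by simp; omega)
  have hd : y⁻¹ * A.phi c * y' = A.phi d := by rw [mul_assoc, h]; group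
  rw [hd] at hk
  have hEd := A.toWord_phi (isReduced_toWord (x := d))
  rw [mk_toWord, hk] at hEd
  have hk2 : A.E d.toWord = (k ++ L.drop y.norm) ++ List.replicate (A.n w.1) (A.z, w.2) ++
      (R.take (R.length - y'.norm) ++ k') := by
    rw [← hEd]; simp [run]
  have hNE' : A.NE (k ++ L.drop y.norm) := by
    have hne : L.drop y.norm ≠ [] := by rw [Ne, List.drop_eq_nil_iff]; omega
    refine A.ne_append ?_ hne
    intro a ha
    rw [List.getLast?_drop] at ha
    rw [if_neg (by omega)] at ha
    exact hNE a ha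
  have hNS' : A.NS (R.take (R.length - y'.norm) ++ k') := by
    intro a ha
    rcases R with _ | ⟨r, R⟩
    · simp at l2
    · obtain ⟨m, hm⟩ : ∃ m, (r :: R).length - y'.norm = m + 1 := ⟨(r :: R).length - y'.norm - 1, by omega⟩
      rw [hm] at ha
      simp at ha
      subst ha
      exact hNS r (by simp)
  obtain ⟨d1, v, d2, hd', hn', hs', hL'⟩ := A.E_back _ _ _ _ _ isReduced_toWord (A.n_pos w.1) hNE' hNS' hk2
  have hvw : v = w := Prod.ext (A.n_inj hn') hs'
  subst hvw
  have m1 := A.mk_Lw d1 v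
  rw [← hL', ← mul_mk, hmk, mul_assoc, mul_mk, List.take_append_drop, hmkL, ← mul_assoc] at m1
  have m2 := mul_right_cancel m1
  apply hy
  refine ⟨mk e1 * (mk d1)⁻¹, ?_⟩
  rw [_root_.map_mul, _root_.map_inv, ← m2]; group

lemma wt_mul (g h : FreeGroup ℕ) : A.wt (g * h).toWord ≤ A.wt g.toWord + A.wt h.toWord := by
  rw [← wt_append]
  exact List.Sublist.sum_le_sum ((toWord_mul_sublist g h).map _) (by simp)

lemma wt_inv (g : FreeGroup ℕ) : A.wt (g⁻¹).toWord = A.wt g.toWord := by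
  rw [toWord_inv, invRev, wt, List.map_reverse, List.sum_reverse, List.map_map]; rfl

lemma exists_cyc (c : FreeGroup ℕ) : ∃ g c' : FreeGroup ℕ, c = g * c' * g⁻¹ ∧
    ∀ N, A.wt (c' ^ N).toWord = N * A.wt c'.toWord := by
  have e := reduceCyclically.conj_conjugator_reduceCyclically c.toWord
  have hc := reduceCyclically.isCyclicallyReduced (isReduced_toWord (x := c))
  generalize reduceCyclically c.toWord = w at *
  generalize reduceCyclically.conjugator c.toWord = p at *
  refine ⟨mk p, mk w, ?_, ?_⟩
  · conv_lhs => rw [← mk_toWord (x := c), ← e]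
    rw [inv_mk, mul_mk, mul_mk]
  · intro N
    rw [toWord_pow, toWord_mk, hc.1.reduce_eq, (hc.flatten_replicate N).1.reduce_eq]
    simp [wt, List.map_flatten, List.sum_flatten]

lemma le_of_forall_mul {a b k : ℕ} (h : ∀ N, N * a ≤ N * b + k) : a ≤ b := by
  by_contra hlt
  have := h (k + 1)
  have h2 : (k + 1) * (b + 1) ≤ (k + 1) * a := Nat.mul_le_mul_left _ (by omega)
  rw [mul_add] at h2
  omega

lemma norm_pow_le (y : FreeGroup α) (N : ℕ) : (y ^ N).norm ≤ N * y.norm := by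
  induction N with
  | zero => simp
  | succ N ih =>
    rw [pow_succ, add_mul, one_mul]
    exact (FreeGroup.norm_mul_le _ _).trans (by omega)

/-- L3 -/
theorem conj_range {y : FreeGroup α} {c : FreeGroup ℕ} (h : IsConj y (A.phi c)) :
    ∃ e, IsConj y (A.phi e) ∧ A.wt e.toWord ≤ y.norm := by
  obtain ⟨g, c', hc, hN⟩ := A.exists_cyc c
  have hconj : IsConj y (A.phi c') := by
    refine h.trans ?_
    rw [hc, _root_.map_mul, _root_.map_mul, _root_.map_inv, isConj_comm]
    exact isConj_iff.2 ⟨_, rfl⟩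
  refine ⟨c', hconj, ?_⟩
  obtain ⟨k, hk⟩ := isConj_iff.1 hconj
  refine le_of_forall_mul (k := 2 * k.norm) fun N => ?_
  rw [← hN]
  refine (A.wt_le _).trans ?_
  rw [_root_.map_pow, ← hk, conj_pow]
  have h1 := FreeGroup.norm_mul_le (k * y ^ N) k⁻¹
  have h2 := FreeGroup.norm_mul_le k (y ^ N)
  have h3 := norm_pow_le y N
  rw [norm_inv_eq] at h1
  omega

/-- malnormality -/
theorem malnormal {y : FreeGroup α} (hy : y ∉ A.phi.range) {c d : FreeGroup ℕ}
    (h : A.phi c * y = y * A.phi d) : c = 1 := by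
  obtain ⟨g, c', hc, hN⟩ := A.exists_cyc c
  have hp : ∀ N, A.phi (c ^ N) * y = y * A.phi (d ^ N) := by
    intro N
    have : A.phi d = y⁻¹ * A.phi c * y⁻¹⁻¹ := by rw [inv_inv, mul_assoc, h]; group
    rw [_root_.map_pow, _root_.map_pow, this, conj_pow]; group
  have h0 : A.wt c'.toWord ≤ 0 := by
    refine le_of_forall_mul (k := 6 * y.norm + 2 * A.wt g.toWord) fun N => ?_
    rw [← hN]
    have h1 := A.wt_le_of_eq hy (hp N)
    have e : c' ^ N = g⁻¹ * c ^ N * g := by rw [hc, conj_pow]; group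
    rw [e]
    have h2 := A.wt_mul (g⁻¹ * c ^ N) g
    have h3 := A.wt_mul g⁻¹ (c ^ N)
    rw [wt_inv] at h3
    omega
  have := A.wt_eq_zero (Nat.le_zero.1 h0)
  rw [hc, this]; group

end Leaf
end Leaf
end CD

namespace CD
section LeafInst
open FreeGroup

/-- exponent sum of the generator `x` -/
def ex (x : Fin 46) : FreeGroup (Fin 46) →* Multiplicative ℤ :=
  FreeGroup.lift fun a => if a = x then Multiplicative.ofAdd 1 else 1

lemma mk_cons2 {α : Type*} (x : α × Bool) (L : List (α × Bool)) :
    (mk (x :: L) : FreeGroup α) = (if x.2 then of x.1 else (of x.1)⁻¹) * mk L := by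
  rcases x with ⟨a, _ | _⟩
  · rw [of, inv_mk]; simp [invRev, mul_mk]
  · simp [of, mul_mk]

lemma ex_le_len (x : Fin 46) (L : List (Fin 46 × Bool)) :
    |(ex x (mk L)).toAdd| ≤ L.length := by
  induction L with
  | nil => rw [← one_eq_mk]; simp
  | cons a L ih =>
    rw [mk_cons2]
    have h : |(ex x (if a.2 then of a.1 else (of a.1)⁻¹)).toAdd| ≤ 1 := by
      rcases a with ⟨a, _ | _⟩ <;> by_cases h : a = x <;> simp [ex, h]
    simp only [_root_.map_mul, toAdd_mul, List.length_cons]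
    have := abs_add_le (ex x (if a.2 then of a.1 else (of a.1)⁻¹)).toAdd (ex x (mk L)).toAdd
    push_cast
    omega

lemma ex_le (x : Fin 46) (g : FreeGroup (Fin 46)) : |(ex x g).toAdd| ≤ g.norm := by
  have := ex_le_len x g.toWord
  rwa [mk_toWord] at this

lemma ex_of_ne (x : Fin 46) (L : List (Fin 46 × Bool)) (h : ∀ a ∈ L, a.1 ≠ x) :
    ex x (mk L) = 1 := by
  induction L with
  | nil => rw [← one_eq_mk]; simp
  | cons a L ih =>
    rw [mk_cons2, _root_.map_mul, ih fun b hb => h b (List.mem_cons_of_mem _ hb)]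
    have := h a List.mem_cons_self
    rcases a with ⟨a, _ | _⟩ <;> simp [ex] at this ⊢ <;> exact this

lemma mk_genPow (x : Fin 46) (n : ℕ) : (mk (genPow x true n) : FreeGroup (Fin 46)) = of x ^ n := by
  induction n with
  | zero => rfl
  | succ n ih => rw [genPow, List.replicate_succ, mk_cons2]; rw [genPow] at ih; rw [ih, pow_succ']; simp

lemma toWord_mk_mem {L : List (Fin 46 × Bool)} {a} (h : a ∈ (mk L : FreeGroup (Fin 46)).toWord) : a ∈ L := by
  rw [toWord_mk] at h
  exact (reduce.red (L := L)).sublist.subset h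

lemma mk_flatten (L : List (List (Fin 46 × Bool))) :
    (mk L.flatten : FreeGroup (Fin 46)) = (L.map mk).prod := by
  induction L with
  | nil => rfl
  | cons a L ih => rw [List.flatten_cons, ← mul_mk, ih]; simp

def tailW (g : Fin 20 → Fin 46) (j : ℕ) : Word (Fin 46) :=
  (List.ofFn fun k : Fin 18 => genPow (g k.succ.succ) true j).flatten

lemma tail_mem {g : Fin 20 → Fin 46} {j} {a} (h : a ∈ tailW g j) :
    ∃ k : Fin 18, a.1 = g k.succ.succ := by
  simp only [tailW, List.mem_flatten, List.mem_ofFn] at h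
  obtain ⟨_, ⟨k, rfl⟩, h⟩ := h
  exact ⟨k, by rw [List.eq_of_mem_replicate h]⟩

lemma genPow_mem {x : Fin 46} {s n} {a} (h : a ∈ genPow x s n) : a.1 = x := by
  rw [List.eq_of_mem_replicate h]

lemma ex_tail (g : Fin 20 → Fin 46) (hg : Function.Injective g) (j : ℕ) :
    (ex (g 19) (mk (tailW g j))).toAdd = j := by
  rw [tailW, mk_flatten, map_list_prod, List.map_map, List.map_ofFn, List.prod_ofFn]
  have : ∀ k : Fin 18, ((⇑(ex (g 19)) ∘ mk) ∘ fun k : Fin 18 => genPow (g k.succ.succ) true j) k =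
      if k = 17 then Multiplicative.ofAdd (j : ℤ) else 1 := by
    intro k
    simp only [Function.comp, mk_genPow, _root_.map_pow]
    have e : g k.succ.succ = g 19 ↔ k = 17 := by
      rw [hg.eq_iff]; clear hg; revert k; decide
    by_cases hk : k = 17
    · simp [ex, hk, ← ofAdd_nsmul]
    · simp [ex, e, hk]
  simp only [this]
  simp

/-- the leaf for a family of blocks -/
def mkLf (g : Fin 20 → Fin 46) (hg : Function.Injective g) (c : ℕ → Word (Fin 46))
    (hc : ∀ i, ∀ a ∈ c i, ∀ k, a.1 ≠ g k) (n : ℕ → ℕ) (hn : Function.Injective n)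
    (hn1 : ∀ i, 1 ≤ n i) : Leaf (Fin 46) where
  z := g 1
  p := fun i => mk (invRev (c i) ++ genPow (g 0) true (n i))
  q := fun i => mk (tailW g (n i) ++ c i)
  n := n
  e1 := ex (g 0)
  e2 := ex (g 19)
  n_inj := hn
  n_pos := hn1
  zp := by
    intro i a ha
    rcases List.mem_append.1 (toWord_mk_mem ha) with h | h
    · simp only [invRev, List.mem_reverse, List.mem_map] at h
      obtain ⟨b, hb, rfl⟩ := h
      exact hc i b hb 1
    · rw [genPow_mem h]; exact hg.ne (by decide)
  zq := by
    intro i a ha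
    rcases List.mem_append.1 (toWord_mk_mem ha) with h | h
    · obtain ⟨k, hk⟩ := tail_mem h
      rw [hk]; refine hg.ne ?_
      clear hk; revert k; decide
    · exact hc i a h 1
  e1_le := ex_le _
  e2_le := ex_le _
  e1_z := by simp [ex, hg.eq_iff]
  e2_z := by simp [ex, hg.eq_iff]
  e1_p := by
    intro i
    rw [← mul_mk, ← inv_mk, _root_.map_mul, _root_.map_inv, mk_genPow,
      ex_of_ne _ (c i) fun a ha => hc i a ha 0]
    simp [ex]
  e1_q := by
    intro i
    rw [← mul_mk, _root_.map_mul, ex_of_ne _ (c i) fun a ha => hc i a ha 0, ex_of_ne]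
    · simp
    · intro a ha
      obtain ⟨k, hk⟩ := tail_mem ha
      rw [hk]; refine hg.ne ?_
      clear hk; revert k; decide
  e2_p := by
    intro i
    rw [← mul_mk, ← inv_mk, _root_.map_mul, _root_.map_inv, mk_genPow,
      ex_of_ne _ (c i) fun a ha => hc i a ha 19]
    simp [ex, hg.eq_iff]
  e2_q := by
    intro i
    rw [← mul_mk, _root_.map_mul, ex_of_ne _ (c i) fun a ha => hc i a ha 19]
    simpa using ex_tail g hg (n i)

lemma genA_inj : Function.Injective genA := by
  intro a b h; simp [genA, Fin.ext_iff] at h ⊢; exact h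
lemma genB_inj : Function.Injective genB := by
  intro a b h; simp [genB, Fin.ext_iff] at h ⊢; exact h

lemma conjWord_mem {i ti : ℕ} {a} (h : a ∈ conjWord i ti) : 40 ≤ (a.1 : ℕ) := by
  simp only [conjWord, List.mem_append] at h
  rcases h with ((((h | h) | h) | h) | h) | h <;> rw [genPow_mem h] <;> simp [genC, genD]

variable (f t : ℕ → ℕ) (hf : Function.Injective f) (hf1 : ∀ i, 1 ≤ i → 1 ≤ f i)

def cw (l : Bool) (i : ℕ) : Word (Fin 46) := if l then [] else conjWord (i + 1) (t (i + 1))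
def gg (l : Bool) : Fin 20 → Fin 46 := if l then genB else genA

/-- generator words of the two edge embeddings -/
def gw (l : Bool) (i : ℕ) : Word (Fin 46) :=
  invRev (cw t l i) ++ (if l then bWord (f (i + 1)) else aWord (f (i + 1))) ++ cw t l i

def Lf (l : Bool) : Leaf (Fin 46) :=
  mkLf (gg l) (by cases l; exacts [genA_inj, genB_inj]) (cw t l)
    (by
      intro i a ha k
      cases l
      · have := conjWord_mem (by simpa [cw] using ha)
        intro h
        simp [h, gg, genA] at this; omega
      · simp [cw] at ha)
    (fun i => f (i + 1)) (fun i j h => by have := hf h; omega) (fun i => hf1 _ (by omega))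

lemma blk_split (l : Bool) (j : ℕ) : (if l then bWord j else aWord j) =
    genPow (gg l 0) true j ++ genPow (gg l 1) true j ++ tailW (gg l) j := by
  cases l <;>
  · simp only [bWord, aWord, tailW, gg, if_true, if_false, Bool.false_eq_true]
    rw [List.ofFn_succ, List.ofFn_succ]
    simp

lemma Lf_phi (l : Bool) (i : ℕ) : (Lf f t hf hf1 l).phi (of i) = mk (gw f t l i) := by
  rw [gw, blk_split]
  simp [Leaf.phi, Lf, mkLf, ← mul_mk, mk_genPow, mul_assoc]

lemma Lf_n (l : Bool) (i : ℕ) : (Lf f t hf hf1 l).n i = f (i + 1) := rfl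

end LeafInst
end CD

namespace CD
section Crit
open FreeGroup
variable (f t : ℕ → ℕ) (hf : Function.Injective f) (hf1 : ∀ i, 1 ≤ i → 1 ≤ f i)

abbrev FF := FreeGroup (Fin 46)

def ph (l : Bool) : FreeGroup ℕ →* FF := (Lf f t hf hf1 l).phi

/-- weight of an edge group word -/
def wgt (f : ℕ → ℕ) (e : List (ℕ × Bool)) : ℕ := (e.map fun x => f (x.1 + 1)).sum

lemma wgt_eq (l : Bool) (e) : (Lf f t hf hf1 l).wt e = wgt f e := rfl

abbrev PP := Pu (ph f t hf hf1)

lemma ph_inj (l : Bool) : Function.Injective (ph f t hf hf1 l) := Leaf.phi_inj _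

lemma am : Amalg (HH (ph f t hf hf1)) (BB (ph f t hf hf1)) :=
  amalg_push (ph_inj f t hf hf1) fun _ _ hy _ _ h => Leaf.malnormal _ hy h

def pf (l : Bool) : FF →* PP f t hf hf1 := pof (ph f t hf hf1) l

def Pw (w : List (Bool × FF)) : PP f t hf hf1 := (w.map fun x => pf f t hf hf1 x.1 x.2).prod

def CR (w : List (Bool × FF)) : Prop :=
  (∀ x ∈ w, x.2 ∉ (ph f t hf hf1 x.1).range) ∧ (w.map Prod.fst).IsChain (· ≠ ·) ∧
    (w.map Prod.fst).head? ≠ (w.map Prod.fst).getLast?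

lemma Pw_eq (w) : Pw f t hf hf1 w = P (toP (ph f t hf hf1) w) := by
  simp [Pw, P, toP, List.map_map, Function.comp_def, pf]

lemma toP_fst (w : List (Bool × FF)) : (toP (ph f t hf hf1) w).map Prod.fst = w.map Prod.fst := by
  simp [toP, Function.comp_def]

lemma CR_iff (w) : CR f t hf hf1 w ↔ CycRed (HH (ph f t hf hf1)) (BB (ph f t hf hf1)) (toP (ph f t hf hf1) w) := by
  rw [CycRed, Red, toP_fst, CR]
  constructor
  · rintro ⟨h1, h2, h3⟩
    refine ⟨?_, ⟨?_, h2⟩, h3⟩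
    · rintro h
      have : w = [] := by simpa [toP] using h
      subst this; exact h3 rfl
    · intro x hx
      obtain ⟨y, hy, rfl⟩ := List.mem_map.1 hx
      exact ⟨⟨_, rfl⟩, fun h => h1 y hy ((pof_mem_BB (ph_inj f t hf hf1)).1 h)⟩
  · rintro ⟨-, ⟨h1, h2⟩, h3⟩
    refine ⟨fun x hx h => ?_, h2, h3⟩
    exact (h1 _ (List.mem_map_of_mem hx)).2 ((pof_mem_BB (ph_inj f t hf hf1)).2 h)

lemma exists_toP {w : List (Bool × PP f t hf hf1)} (h : ∀ x ∈ w, x.2 ∈ HH (ph f t hf hf1) x.1) :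
    ∃ v, w = toP (ph f t hf hf1) v := by
  have : ∀ x ∈ w, ∃ y : Bool × FF, (y.1, pof (ph f t hf hf1) y.1 y.2) = x := by
    intro x hx
    obtain ⟨y, hy⟩ := h x hx
    exact ⟨(x.1, y), by simp [hy]⟩
  choose! k hk using this
  refine ⟨w.map k, ?_⟩
  rw [toP, List.map_map]
  conv_lhs => rw [← List.map_id w]
  exact List.map_congr_left fun x hx => by simp [hk x hx]

def Can (l : Bool) (y : FF) : Prop := l = true → ∀ c, ¬ IsConj y (ph f t hf hf1 true c)

lemma pf_phi (l l' c) : pf f t hf hf1 l (ph f t hf hf1 l c) = pf f t hf hf1 l' (ph f t hf hf1 l' c) := by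
  simp only [pf]
  rw [pof_phi, pof_phi]

lemma can_nc {y : FF} (h : Can f t hf hf1 true y) :
    NC (HH (ph f t hf hf1)) (BB (ph f t hf hf1)) true (pof (ph f t hf hf1) true y) := by
  rintro _ ⟨h', rfl⟩ hm
  have : pof (ph f t hf hf1) true (h'⁻¹ * y * h') ∈ BB (ph f t hf hf1) := by simpa using hm
  obtain ⟨c, hc⟩ := (pof_mem_BB (ph_inj f t hf hf1)).1 this
  exact h rfl c (isConj_iff.2 ⟨h'⁻¹, by rw [hc]; group⟩)

theorem T_class (g : PP f t hf hf1) :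
    (∃ h l y, Can f t hf hf1 l y ∧ g = h * pf f t hf hf1 l y * h⁻¹) ∨
    ∃ h w, CR f t hf hf1 w ∧ g = h * Pw f t hf hf1 w * h⁻¹ := by
  rcases classify (am f t hf hf1) g with ⟨h, l, _, ⟨y, rfl⟩, hg⟩ | ⟨h, w, hw, hg⟩
  · left
    by_cases hc : Can f t hf hf1 l y
    · exact ⟨h, l, y, hc, hg⟩
    · simp only [Can, not_forall, not_not] at hc
      obtain ⟨rfl, c, hc⟩ := hc
      obtain ⟨k, hk⟩ := isConj_iff.1 hc
      refine ⟨h * pf f t hf hf1 true k⁻¹, false, ph f t hf hf1 false c, by simp [Can], ?_⟩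
      rw [pf_phi _ _ _ _ false true, ← hk, hg]
      simp only [pf, _root_.map_mul, _root_.map_inv]; group
  · right
    obtain ⟨v, rfl⟩ := exists_toP f t hf hf1 fun x hx => (hw.2.1.1 x hx).1
    exact ⟨h, v, (CR_iff f t hf hf1 v).2 hw, by rw [Pw_eq]; exact hg⟩

theorem T_ell {l l' y y'} (h : Can f t hf hf1 l y) (h' : Can f t hf hf1 l' y') :
    IsConj (pf f t hf hf1 l y) (pf f t hf hf1 l' y') ↔ l = l' ∧ IsConj y y' := by
  constructor
  · intro hc
    obtain ⟨g, hg⟩ := isConj_iff.1 hc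
    have hl : l = l' := by
      by_contra hne
      rcases l with _ | _
      · have hl' : l' = true := by cases l'; exact absurd rfl hne; rfl
        subst hl'
        refine ell_diff (am f t hf hf1) (l := true) (l' := false) (y := pf f t hf hf1 true y') (g := g) ⟨_, rfl⟩ ?_
          (by simp) (can_nc _ _ _ _ h')
        rw [← hg]; exact ⟨y, by simp only [pf]; group⟩
      · have hl' : l' = false := by cases l'; rfl; exact absurd rfl hne
        subst hl'
        refine ell_diff (am f t hf hf1) (l := true) (l' := false) (y := pf f t hf hf1 true y) (g := g⁻¹) ⟨_, rfl⟩ ?_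
          (by simp) (can_nc _ _ _ _ h)
        rw [inv_inv, hg]; exact ⟨y', rfl⟩
    subst hl
    refine ⟨rfl, ?_⟩
    obtain ⟨_, ⟨k, rfl⟩, hk⟩ := ell_same (am f t hf hf1) (l := l) (y := pf f t hf hf1 l y) (g := g⁻¹)
      ⟨_, rfl⟩ (by rw [inv_inv, hg]; exact ⟨y', rfl⟩)
    rw [inv_inv, hg] at hk
    refine isConj_iff.2 ⟨k⁻¹, ?_⟩
    apply pof_inj (ph_inj f t hf hf1) l
    simp only [pf] at hk
    rw [_root_.map_mul, _root_.map_mul, inv_inv, _root_.map_inv, hk]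
  · rintro ⟨rfl, hc⟩
    obtain ⟨k, hk⟩ := isConj_iff.1 hc
    exact isConj_iff.2 ⟨pf f t hf hf1 l k, by rw [← hk]; simp⟩

theorem T_eh {l y w} (hw : CR f t hf hf1 w) : ¬ IsConj (pf f t hf hf1 l y) (Pw f t hf hf1 w) := by
  intro hc
  obtain ⟨g, hg⟩ := isConj_iff.1 hc
  refine ell_hyp (am f t hf hf1) (l := l) (y := pf f t hf hf1 l y) ⟨_, rfl⟩ ((CR_iff f t hf hf1 w).1 hw) g⁻¹ ?_
  rw [inv_inv, hg, Pw_eq]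

lemma pf_inj (l : Bool) : Function.Injective (pf f t hf hf1 l) := pof_inj (ph_inj f t hf hf1) l

theorem T_one {w} (hw : CR f t hf hf1 w) : Pw f t hf hf1 w ≠ 1 := by
  intro h
  apply T_eh f t hf hf1 (l := true) (y := 1) hw
  rw [h, _root_.map_one]

lemma toP_rotate (w : List (Bool × FF)) (k : ℕ) :
    (toP (ph f t hf hf1) w).rotate k = toP (ph f t hf hf1) (w.rotate k) := by
  simp [toP, List.map_rotate]

def nsum (w : List (Bool × FF)) : ℕ := (w.map fun x => x.2.norm).sum

lemma le_nsum {w : List (Bool × FF)} {x} (h : x ∈ w) : x.2.norm ≤ nsum w :=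
  List.single_le_sum (fun _ _ => Nat.zero_le _) _ (List.mem_map_of_mem h)

theorem T_hh {w w'} (hw : CR f t hf hf1 w) (hw' : CR f t hf hf1 w') :
    IsConj (Pw f t hf hf1 w') (Pw f t hf hf1 w) ↔
    ∃ k ≤ w'.length, ∃ c : FreeGroup ℕ, wgt f c.toWord ≤ 3 * (nsum w + nsum w') ∧
      (pf f t hf hf1 false (ph f t hf hf1 false c))⁻¹ * Pw f t hf hf1 (w'.rotate k) *
        pf f t hf hf1 false (ph f t hf hf1 false c) = Pw f t hf hf1 w := by
  constructor
  · intro hc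
    obtain ⟨g, hg⟩ := isConj_iff.1 hc
    obtain ⟨n, hn⟩ := exists_len (am f t hf hf1) g⁻¹
    have hwc := (CR_iff f t hf hf1 w).1 hw
    have hwc' := (CR_iff f t hf hf1 w').1 hw'
    obtain ⟨w'', b, hr, hw'', ⟨c, rfl⟩, hb⟩ := conj_cyc (am f t hf hf1) hwc n g⁻¹ _ hn hwc'
      (by rw [inv_inv, ← Pw_eq, ← Pw_eq, hg])
    obtain ⟨k, hk, rfl⟩ := List.isRotated_iff_mod.1 hr.symm
    rw [toP_rotate] at hw'' hb
    refine ⟨k, by simpa [toP] using hk, c, ?_, ?_⟩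
    · have hv := (CR_iff f t hf hf1 _).2 hw''
      obtain ⟨x, v0, z, hv0⟩ : ∃ x v0 z, w'.rotate k = x :: (v0 ++ [z]) := by
        revert hv
        rcases w'.rotate k with _ | ⟨x, v⟩
        · rintro ⟨-, -, h⟩; exact absurd rfl h
        · rcases List.eq_nil_or_concat v with rfl | ⟨v0, z, rfl⟩
          · rintro ⟨-, -, h⟩; exact absurd rfl h
          · intro _; exact ⟨x, v0, z, by simp⟩
      rw [hv0] at hv hb
      obtain ⟨y, v1, hw1⟩ : ∃ y v1, w = y :: v1 := by
        rcases w with _ | ⟨y, v1⟩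
        · exact absurd rfl hw.2.2
        · exact ⟨_, _, rfl⟩
      have hR : Red (HH (ph f t hf hf1)) (BB (ph f t hf hf1))
          (toP (ph f t hf hf1) (x :: (v0 ++ [(z.1, z.2 * ph f t hf hf1 z.1 c)]))) := by
        refine ⟨?_, ?_⟩
        · intro q0 hq0
          obtain ⟨q, hq, rfl⟩ := List.mem_map.1 hq0
          refine ⟨⟨_, rfl⟩, fun h => ?_⟩
          rw [pof_mem_BB (ph_inj f t hf hf1)] at h
          have hq' : q ∈ x :: (v0 ++ [z]) ∨ q = (z.1, z.2 * ph f t hf hf1 z.1 c) := by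
            rcases List.mem_cons.1 hq with h | h
            · exact Or.inl (h ▸ List.mem_cons_self)
            · rcases List.mem_append.1 h with h | h
              · exact Or.inl (List.mem_cons_of_mem _ (List.mem_append_left _ h))
              · exact Or.inr (List.mem_singleton.1 h)
          rcases hq' with hq' | rfl
          · exact hv.1 q hq' h
          · refine hv.1 z (by simp) ?_
            exact ((ph f t hf hf1 z.1).range.mul_mem_cancel_right ⟨c, rfl⟩).1 h
        · rw [toP_fst]; simpa using hv.2.1
      have hlink := (link (am f t hf hf1) _ _ hR hwc.2.1 (Monoid.PushoutI.base (ph f t hf hf1) c)⁻¹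
        (inv_mem ⟨c, rfl⟩) (by rw [← hb]; simp [toP, pof_phi, mul_assoc])).2
      obtain ⟨_, ⟨d, rfl⟩, hd⟩ := hlink (x.1, pof (ph f t hf hf1) x.1 x.2) (by simp [toP])
        (y.1, pof (ph f t hf hf1) y.1 y.2) (by simp [hw1, toP])
      have hxy : x.1 = y.1 := by
        have := (link (am f t hf hf1) _ _ hR hwc.2.1 (Monoid.PushoutI.base (ph f t hf hf1) c)⁻¹
          (inv_mem ⟨c, rfl⟩) (by rw [← hb]; simp [toP, pof_phi, mul_assoc])).1
        rw [hw1, toP_fst, toP_fst] at this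
        simpa using congrArg List.head? this
      obtain ⟨x1, x2⟩ := x
      obtain ⟨y1, y2⟩ := y
      simp only at hxy
      subst hxy
      have he : (Lf f t hf hf1 x1).phi c⁻¹ * x2 = y2 * (Lf f t hf hf1 x1).phi d := by
        apply pf_inj f t hf hf1 x1
        have e1 := pof_phi (φ := ph f t hf hf1) x1 c⁻¹
        have e2 := pof_phi (φ := ph f t hf hf1) x1 d
        change pof (ph f t hf hf1) x1 (ph f t hf hf1 x1 c⁻¹ * x2) =
          pof (ph f t hf hf1) x1 (y2 * ph f t hf hf1 x1 d)
        rw [_root_.map_mul, _root_.map_mul, e1, e2]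
        simpa using hd
      have hy2 : y2 ∉ (Lf f t hf hf1 x1).phi.range := hw.1 (x1, y2) (by simp [hw1])
      have := Leaf.wt_le_of_eq _ hy2 he
      rw [Leaf.wt_inv, wgt_eq] at this
      have h1 : x2.norm ≤ nsum w' := le_nsum (x := (x1, x2)) (by
        rw [← List.mem_rotate (n := k), hv0]; simp)
      have h2 : y2.norm ≤ nsum w := le_nsum (x := (x1, y2)) (by simp [hw1])
      omega
    · rw [Pw_eq, Pw_eq, ← hb, pf, pof_phi]
  · rintro ⟨k, -, c, -, h⟩
    have : IsConj (Pw f t hf hf1 w') (Pw f t hf hf1 (w'.rotate k)) := by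
      have e := List.rotate_eq_drop_append_take_mod (l := w') (n := k)
      rw [e]
      conv_lhs => rw [← List.take_append_drop (k % w'.length) w']
      simp only [Pw, List.map_append, List.prod_append]
      exact isConj_iff.2 ⟨(List.map (fun x => pf f t hf hf1 x.1 x.2) (List.take (k % w'.length) w')).prod⁻¹, by group⟩
    refine this.trans (isConj_iff.2 ⟨(pf f t hf hf1 false (ph f t hf hf1 false c))⁻¹, ?_⟩)
    rw [← h, inv_inv]

theorem T_range {l} {y : FF} : y ∈ (ph f t hf hf1 l).range ↔
    ∃ c : FreeGroup ℕ, wgt f c.toWord ≤ y.norm ∧ ph f t hf hf1 l c = y := by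
  constructor
  · rintro ⟨c, rfl⟩
    exact ⟨c, Leaf.wt_le (Lf f t hf hf1 l) c, rfl⟩
  · rintro ⟨c, -, rfl⟩
    exact ⟨c, rfl⟩

theorem T_conj {l} {y : FF} : (∃ c, IsConj y (ph f t hf hf1 l c)) ↔
    ∃ c : FreeGroup ℕ, wgt f c.toWord ≤ y.norm ∧ IsConj y (ph f t hf hf1 l c) := by
  constructor
  · rintro ⟨c, hc⟩
    obtain ⟨e, he, h⟩ := Leaf.conj_range (Lf f t hf hf1 l) hc
    exact ⟨e, h, he⟩
  · rintro ⟨c, -, h⟩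
    exact ⟨c, h⟩

end Crit
end CD

namespace CD
section Comp
open Encodable
variable {α β γ σ : Type} [Primcodable α] [Primcodable β] [Primcodable γ] [Primcodable σ]

theorem comp_foldl {f : α → List β} {g : α → σ} {h : α → σ × β → σ}
    (hf : Computable f) (hg : Computable g) (hh : Computable₂ h) :
    Computable fun a => (f a).foldl (fun s b => h a (s, b)) (g a) := by
  have step : Computable₂ fun (a : α) (x : ℕ × σ) =>
      (Option.casesOn ((f a)[x.1]?) x.2 (fun b => h a (x.2, b)) : σ) := by
    refine Computable.option_casesOn (o := fun y : α × (ℕ × σ) => (f y.1)[y.2.1]?)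
      (f := fun y : α × (ℕ × σ) => y.2.2) (g := fun y b => h y.1 (y.2.2, b)) ?_ ?_ ?_
    · exact Computable.list_getElem?.comp (hf.comp Computable.fst) (Computable.fst.comp Computable.snd)
    · exact Computable.snd.comp Computable.snd
    · exact (hh.comp (Computable.fst.comp Computable.fst)
        ((Computable.snd.comp (Computable.snd.comp Computable.fst)).pair Computable.snd)).to₂
  have := Computable.nat_rec (Computable.list_length.comp hf) hg step
  refine this.of_eq fun a => ?_
  have key : ∀ n ≤ (f a).length, (Nat.rec (g a) (fun y IH =>
      (Option.casesOn ((f a)[y]?) IH (fun b => h a (IH, b)) : σ)) n : σ) =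
      ((f a).take n).foldl (fun s b => h a (s, b)) (g a) := by
    intro n
    induction n with
    | zero => intro _; simp
    | succ n ih =>
      intro hn
      have hlt : n < (f a).length := hn
      rw [List.take_succ_eq_append_getElem hlt, List.foldl_append]
      simp only [List.foldl_cons, List.foldl_nil]
      rw [← ih hlt.le, List.getElem?_eq_getElem hlt]
  have := key _ le_rfl
  rw [List.take_length] at this
  exact this

theorem comp_foldr {f : α → List β} {g : α → σ} {h : α → β × σ → σ}
    (hf : Computable f) (hg : Computable g) (hh : Computable₂ h) :
    Computable fun a => (f a).foldr (fun b s => h a (b, s)) (g a) := by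
  have := comp_foldl (h := fun a x => h a (x.2, x.1)) (Computable.list_reverse.comp hf) hg
    ((hh.comp Computable.fst ((Computable.snd.comp Computable.snd).pair
      (Computable.fst.comp Computable.snd))).to₂)
  exact this.of_eq fun a => by simp [List.foldl_reverse]

theorem comp_map {f : α → List β} {g : α → β → σ} (hf : Computable f) (hg : Computable₂ g) :
    Computable fun a => (f a).map (g a) := by
  have := comp_foldr (h := fun a (x : β × List σ) => g a x.1 :: x.2) hf (Computable.const [])
    ((Computable.list_cons.comp (hg.comp Computable.fst (Computable.fst.comp Computable.snd))
      (Computable.snd.comp Computable.snd)).to₂)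
  exact this.of_eq fun a => by induction f a <;> simp_all

theorem comp_flatMap {f : α → List β} {g : α → β → List σ} (hf : Computable f) (hg : Computable₂ g) :
    Computable fun a => (f a).flatMap (g a) := by
  have := comp_foldr (h := fun a (x : β × List σ) => g a x.1 ++ x.2) hf (Computable.const [])
    ((Computable.list_append.comp (hg.comp Computable.fst (Computable.fst.comp Computable.snd))
      (Computable.snd.comp Computable.snd)).to₂)
  exact this.of_eq fun a => by induction f a <;> simp_all

theorem CPred.comp {p : β → Prop} {f : α → β} (hp : ComputablePred p) (hf : Computable f) :
    ComputablePred fun a => p (f a) := by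
  obtain ⟨_, h⟩ := hp
  exact ⟨fun a => inferInstanceAs (Decidable (p (f a))), h.comp hf⟩

theorem CPred.and {p q : α → Prop} (hp : ComputablePred p) (hq : ComputablePred q) :
    ComputablePred fun a => p a ∧ q a := by
  obtain ⟨_, hp⟩ := hp
  obtain ⟨_, hq⟩ := hq
  refine ⟨fun a => inferInstance, ?_⟩
  exact (Primrec.and.to_comp.comp hp hq).of_eq fun a => by simp

theorem CPred.or {p q : α → Prop} (hp : ComputablePred p) (hq : ComputablePred q) :
    ComputablePred fun a => p a ∨ q a := by
  obtain ⟨_, hp⟩ := hp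
  obtain ⟨_, hq⟩ := hq
  refine ⟨fun a => inferInstance, ?_⟩
  exact (Primrec.or.to_comp.comp hp hq).of_eq fun a => by simp

theorem CPred.neg {p : α → Prop} (hp : ComputablePred p) : ComputablePred fun a => ¬ p a := by
  obtain ⟨_, hp⟩ := hp
  refine ⟨fun a => inferInstance, ?_⟩
  exact (Primrec.not.to_comp.comp hp).of_eq fun a => by simp

theorem CPred.imp {p q : α → Prop} (hp : ComputablePred p) (hq : ComputablePred q) :
    ComputablePred fun a => p a → q a :=
  (CPred.or (CPred.neg hp) hq).of_eq fun a => by tauto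

theorem CPred.eq [DecidableEq β] {f g : α → β} (hf : Computable f) (hg : Computable g) :
    ComputablePred fun a => f a = g a := by
  refine ⟨fun a => inferInstance, ?_⟩
  have : Primrec fun x : β × β => decide (x.1 = x.2) := Primrec.eq.decide
  exact (this.to_comp.comp (hf.pair hg)).of_eq fun a => rfl

theorem CPred.bool {p : α → β → Prop} (hp : ComputablePred fun x : α × β => p x.1 x.2) :
    ∃ b : α × β → Bool, Computable b ∧ ∀ a x, p a x ↔ b (a, x) = true := by
  obtain ⟨b, hb, e⟩ := ComputablePred.computable_iff.1 hp
  exact ⟨b, hb, fun a x => by have := congrFun e (a, x); simpa using this⟩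

theorem CPred.ex {l : α → List β} {p : α → β → Prop} (hl : Computable l)
    (hp : ComputablePred fun x : α × β => p x.1 x.2) :
    ComputablePred fun a => ∃ b ∈ l a, p a b := by
  obtain ⟨q, hq, e⟩ := CPred.bool hp
  have := comp_foldr (h := fun a (x : β × Bool) => q (a, x.1) || x.2) hl
    (Computable.const false) ((Primrec.or.to_comp.comp
      (hq.comp (Computable.fst.pair (Computable.fst.comp Computable.snd)))
        (Computable.snd.comp Computable.snd)).to₂)
  refine ComputablePred.computable_iff.2 ⟨_, this, funext fun a => propext ?_⟩
  simp only [e]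
  induction l a with
  | nil => simp
  | cons b l ih => simp [ih]

theorem CPred.all {l : α → List β} {p : α → β → Prop} (hl : Computable l)
    (hp : ComputablePred fun x : α × β => p x.1 x.2) :
    ComputablePred fun a => ∀ b ∈ l a, p a b :=
  (CPred.neg (CPred.ex (p := fun a b => ¬ p a b) hl (CPred.neg hp))).of_eq fun a => by simp

theorem CPred.exRE {p : α → β → Prop} (hp : ComputablePred fun x : α × β => p x.1 x.2) :
    REPred fun a => ∃ b, p a b := by
  obtain ⟨q, hq, e⟩ := CPred.bool hp
  have hb : Computable₂ fun (a : α) (n : ℕ) =>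
      (Option.casesOn (decode (α := β) n) false (fun b => q (a, b)) : Bool) := by
    refine Computable.option_casesOn (o := fun x : α × ℕ => decode (α := β) x.2)
      (f := fun _ => false) (g := fun x b => q (x.1, b)) ?_ (Computable.const _) ?_
    · exact Computable.decode.comp Computable.snd
    · exact (hq.comp ((Computable.fst.comp Computable.fst).pair Computable.snd)).to₂
  have := (Partrec.rfind (p := fun a n => Part.some _) (Computable₂.partrec₂ hb)).dom_re
  refine this.of_eq fun a => Nat.rfind_dom.trans ?_
  simp only [e]
  constructor
  · rintro ⟨n, h, -⟩
    simp only [Part.mem_some_iff] at h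
    rcases hd : decode (α := β) n with _ | b
    · rw [hd] at h; simp at h
    · rw [hd] at h; exact ⟨b, by simpa using h.symm⟩
  · rintro ⟨b, hb⟩
    exact ⟨encode b, by simp [hb], fun _ => trivial⟩

/-- total search -/
theorem comp_find {p : α → ℕ → Prop} (hp : ComputablePred fun x : α × ℕ => p x.1 x.2)
    (h : ∀ a, ∃ n, p a n) : ∃ g : α → ℕ, Computable g ∧ ∀ a, p a (g a) := by
  classical
  exact ⟨fun a => Nat.find (h a), Computable.find hp h, fun a => Nat.find_spec (h a)⟩

end Comp
end CD

namespace CD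
section Words
open FreeGroup
variable (f t : ℕ → ℕ) (hf : Function.Injective f) (hf1 : ∀ i, 1 ≤ i → 1 ≤ f i)

abbrev VV := Bool × Fin 46
abbrev SW := List (Bool × Word (Fin 46))

def ev : FreeGroup VV →* PP f t hf hf1 := FreeGroup.lift fun x => pf f t hf hf1 x.1 (of x.2)

def tagw (l : Bool) (w : Word (Fin 46)) : Word VV := w.map fun a => ((l, a.1), a.2)

def tg (l : Bool) : FF →* FreeGroup VV := FreeGroup.map fun a => (l, a)

lemma mk_tagw (l : Bool) (w) : (mk (tagw l w) : FreeGroup VV) = tg l (mk w) := by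
  rw [tg, FreeGroup.map.mk]; rfl

lemma ev_tg (l : Bool) (x : FF) : ev f t hf hf1 (tg l x) = pf f t hf hf1 l x := by
  have : (ev f t hf hf1).comp (tg l) = pf f t hf hf1 l := by
    ext a; simp [ev, tg]
  exact DFunLike.congr_fun this x

/-- relator words over the doubled alphabet -/
def RW (k : ℕ) : Word VV := tagw false (gw f t false k) ++ invRev (tagw true (gw f t true k))

def relStep (x : Word VV × ℕ × Bool) : Word VV :=
  x.1 ++ (if x.2.2 then RW f t x.2.1 else invRev (RW f t x.2.1)) ++ invRev x.1

def relw (L : List (Word VV × ℕ × Bool)) : Word VV := L.flatMap (relStep f t)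

lemma ph_of (l k) : ph f t hf hf1 l (of k) = mk (gw f t l k) := Lf_phi f t hf hf1 l k

lemma ev_RW (k) : ev f t hf hf1 (mk (RW f t k)) = 1 := by
  rw [RW, ← mul_mk, ← inv_mk, mk_tagw, mk_tagw, _root_.map_mul, _root_.map_inv, ev_tg, ev_tg,
    ← ph_of f t hf hf1, ← ph_of f t hf hf1, pf_phi f t hf hf1 false true]
  simp

lemma ev_relStep (x) : ev f t hf hf1 (mk (relStep f t x)) = 1 := by
  rw [relStep, ← mul_mk, ← mul_mk, ← inv_mk, _root_.map_mul, _root_.map_mul, _root_.map_inv]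
  split
  · rw [ev_RW]; simp
  · rw [← inv_mk, _root_.map_inv, ev_RW]; simp

lemma ev_relw (L) : ev f t hf hf1 (mk (relw f t L)) = 1 := by
  induction L with
  | nil => rw [relw, List.flatMap_nil, ← one_eq_mk, _root_.map_one]
  | cons x L ih =>
    rw [relw, List.flatMap_cons, ← mul_mk, _root_.map_mul, ev_relStep, one_mul]; exact ih

def RR : Set (FreeGroup VV) := Set.range fun k => mk (RW f t k)

lemma ev_ker {x : FreeGroup VV} (h : ev f t hf hf1 x = 1) : x ∈ Subgroup.normalClosure (RR f t) := by
  let N := Subgroup.normalClosure (RR f t)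
  let q : FreeGroup VV →* FreeGroup VV ⧸ N := QuotientGroup.mk' N
  have hk : ∀ l : Bool, (q.comp (tg l)).comp (ph f t hf hf1 l) = (q.comp (tg false)).comp (ph f t hf hf1 false) := by
    intro l
    cases l
    · rfl
    · ext k
      simp only [MonoidHom.comp_apply, ph_of, ← mk_tagw]
      symm
      apply QuotientGroup.eq_iff_div_mem.2
      rw [div_eq_mul_inv, inv_mk, mul_mk]
      exact Subgroup.subset_normalClosure ⟨k, rfl⟩
  let κ : PP f t hf hf1 →* FreeGroup VV ⧸ N :=
    Monoid.PushoutI.lift (fun l => q.comp (tg l)) ((q.comp (tg false)).comp (ph f t hf hf1 false)) hk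
  have hκ : κ.comp (ev f t hf hf1) = q := by
    ext ⟨l, a⟩
    simp [ev, κ, pf, pof, tg]
  have : q x = 1 := by rw [← hκ, MonoidHom.comp_apply, h, _root_.map_one]
  exact (QuotientGroup.eq_one_iff x).1 this

lemma exists_relw {x : FreeGroup VV} (h : ev f t hf hf1 x = 1) : ∃ L, x = mk (relw f t L) := by
  have hx : x ∈ (Subgroup.closure (Group.conjugatesOfSet (RR f t))).toSubmonoid := ev_ker f t hf hf1 h
  rw [Subgroup.closure_toSubmonoid] at hx
  obtain ⟨l, hl, rfl⟩ := Submonoid.exists_list_of_mem_closure hx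
  clear hx
  clear h
  induction l with
  | nil => exact ⟨[], rfl⟩
  | cons y l ih =>
    obtain ⟨L, hL⟩ := ih fun z hz => hl z (List.mem_cons_of_mem _ hz)
    have key : ∀ z ∈ Group.conjugatesOfSet (RR f t), ∃ (h : Word VV) (k : ℕ), z = mk h * mk (RW f t k) * (mk h)⁻¹ := by
      intro z hz
      obtain ⟨_, ⟨k, rfl⟩, hc⟩ := Group.mem_conjugatesOfSet_iff.1 hz
      obtain ⟨g, hg⟩ := isConj_iff.1 hc
      exact ⟨g.toWord, k, by rw [mk_toWord, ← hg]⟩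
    have : ∃ x, y = mk (relStep f t x) := by
      rcases hl y List.mem_cons_self with hy | hy
      · obtain ⟨h, k, e⟩ := key _ hy
        exact ⟨(h, k, true), by simp [relStep, ← mul_mk, ← inv_mk, e, mul_assoc]⟩
      · obtain ⟨h, k, e⟩ := key _ hy
        refine ⟨(h, k, false), ?_⟩
        rw [inv_eq_iff_eq_inv] at e
        simp [relStep, ← mul_mk, ← inv_mk, e, mul_assoc]
    obtain ⟨x, rfl⟩ := this
    exact ⟨x :: L, by rw [List.prod_cons, hL, relw, relw, List.flatMap_cons, mul_mk]⟩

def WP (u : Word VV) : Prop := ev f t hf hf1 (mk u) = 1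

theorem WP_iff (u) : WP f t hf hf1 u ↔ ∃ L, reduce u = reduce (relw f t L) := by
  constructor
  · intro h
    obtain ⟨L, hL⟩ := exists_relw f t hf hf1 h
    exact ⟨L, reduce.sound hL⟩
  · rintro ⟨L, hL⟩
    rw [WP, reduce.exact hL, ev_relw]

def tw (w : SW) : Word VV := w.flatMap fun x => tagw x.1 x.2

def toF (w : SW) : List (Bool × FF) := w.map fun x => (x.1, mk x.2)

lemma ev_tagw (l w) : ev f t hf hf1 (mk (tagw l w)) = pf f t hf hf1 l (mk w) := by
  rw [mk_tagw, ev_tg]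

lemma ev_tw (w : SW) : ev f t hf hf1 (mk (tw w)) = Pw f t hf hf1 (toF w) := by
  induction w with
  | nil => rw [tw, List.flatMap_nil, ← one_eq_mk, _root_.map_one]; rfl
  | cons x w ih =>
    rw [tw, List.flatMap_cons, ← mul_mk, _root_.map_mul, ev_tagw]
    rw [tw] at ih
    rw [ih]; simp [Pw, toF]

def phw (l : Bool) (c : Word ℕ) : Word (Fin 46) :=
  c.flatMap fun x => if x.2 then gw f t l x.1 else invRev (gw f t l x.1)

lemma mk_phw (l c) : mk (phw f t l c) = ph f t hf hf1 l (mk c) := by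
  induction c with
  | nil => rw [phw, List.flatMap_nil, ← one_eq_mk, ← one_eq_mk, _root_.map_one]
  | cons x c ih =>
    rw [phw, List.flatMap_cons, ← mul_mk, mk_cons2, _root_.map_mul, ← ih]
    congr 1
    rcases x with ⟨a, _ | _⟩
    · simp [ph_of]
    · simp [ph_of]

variable (cands : ℕ → List (Word ℕ))

def inR (x : Bool × Word (Fin 46)) : Prop :=
  ∃ c ∈ cands x.2.length, reduce (phw f t x.1 c) = reduce x.2

def pre (r : Word (Fin 46)) (k : ℕ) : Word (Fin 46) := reduce (invRev (r.take k) ++ r ++ r.take k)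

def conjF (y y' : Word (Fin 46)) : Prop :=
  ∃ k ∈ List.range ((reduce y).length + 1), ∃ j ∈ List.range ((reduce y').length + 1),
    pre (reduce y) k = pre (reduce y') j

def inC (y : Word (Fin 46)) : Prop :=
  ∃ c ∈ cands y.length, conjF y (phw f t true c)

lemma mk_pre (y : Word (Fin 46)) (k : ℕ) : mk (pre (reduce y) k) =
    (mk ((reduce y).take k))⁻¹ * mk y * mk ((reduce y).take k) := by
  rw [pre, reduce.self, ← mul_mk, ← mul_mk, ← inv_mk, reduce.self]

lemma conjF_iff (y y') : conjF y y' ↔ IsConj (mk y : FF) (mk y') := by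
  constructor
  · rintro ⟨k, -, j, -, h⟩
    have := congrArg (mk : _ → FF) h
    rw [mk_pre, mk_pre] at this
    have h1 : IsConj (mk y : FF) (mk (pre (reduce y) k)) :=
      isConj_iff.2 ⟨(mk ((reduce y).take k))⁻¹, by rw [mk_pre]; group⟩
    have h2 : IsConj (mk y' : FF) (mk (pre (reduce y') j)) :=
      isConj_iff.2 ⟨(mk ((reduce y').take j))⁻¹, by rw [mk_pre]; group⟩
    rw [← h] at h2
    exact h1.trans h2.symm
  · intro h
    obtain ⟨k, hk, j, hj, e⟩ := conj_pfx h
    simp only [toWord_mk] at hk hj e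
    refine ⟨k, List.mem_range.2 (by omega), j, List.mem_range.2 (by omega), ?_⟩
    rw [← mk_pre, ← mk_pre] at e
    have := reduce.sound e
    rw [pre, pre] at this ⊢
    rwa [reduce.idem, reduce.idem] at this

variable (hc : ∀ s c, wgt f c ≤ s → c ∈ cands s)

include hc in
lemma inR_iff (x : Bool × Word (Fin 46)) :
    inR f t cands x ↔ (mk x.2 : FF) ∈ (ph f t hf hf1 x.1).range := by
  constructor
  · rintro ⟨c, -, h⟩
    exact ⟨mk c, by rw [← mk_phw, reduce.exact h]⟩
  · intro h
    obtain ⟨c, h1, h2⟩ := (T_range f t hf hf1).1 h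
    refine ⟨c.toWord, hc _ _ (h1.trans norm_mk_le), ?_⟩
    apply reduce.sound
    rw [mk_phw f t hf hf1, mk_toWord, h2]

include hc in
lemma inC_iff (y : Word (Fin 46)) :
    inC f t cands y ↔ ∃ c, IsConj (mk y : FF) (ph f t hf hf1 true c) := by
  constructor
  · rintro ⟨c, -, h⟩
    exact ⟨mk c, by rw [← mk_phw, ← conjF_iff]; exact h⟩
  · intro h
    obtain ⟨c, h1, h2⟩ := (T_conj f t hf hf1).1 h
    refine ⟨c.toWord, hc _ _ (h1.trans norm_mk_le), ?_⟩
    rw [conjF_iff, mk_phw f t hf hf1, mk_toWord]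
    exact h2

def CRw (w : SW) : Prop := (∀ x ∈ w, ¬ inR f t cands x) ∧
  (∀ k ∈ List.range w.length, (w.map Prod.fst)[k]? ≠ (w.map Prod.fst)[k+1]?) ∧
  (w.map Prod.fst)[0]? ≠ (w.map Prod.fst)[w.length - 1]?

lemma toF_fst (w : SW) : (toF w).map Prod.fst = w.map Prod.fst := by
  simp [toF, Function.comp_def]

include hc in
lemma CRw_iff (w : SW) : CRw f t cands w ↔ CR f t hf hf1 (toF w) := by
  rw [CRw, CR, toF_fst]
  refine and_congr ?_ (and_congr ?_ ?_)
  · simp only [toF, List.mem_map, forall_exists_index, and_imp, forall_apply_eq_imp_iff₂]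
    simp only [inR_iff f t hf hf1 cands hc]
  · rw [List.isChain_iff_getElem]
    constructor
    · intro h i hi heq
      simp only [List.length_map] at hi
      refine h i (List.mem_range.2 (by omega)) ?_
      rw [List.getElem?_eq_getElem (by simp; omega), List.getElem?_eq_getElem (by simp; omega), heq]
    · intro h k hk heq
      have hk := List.mem_range.1 hk
      rw [List.getElem?_eq_getElem (by simp; omega)] at heq
      obtain ⟨h1, h2⟩ := List.getElem?_eq_some_iff.1 heq.symm
      exact h k (by simpa using h1) h2.symm
  · rw [List.head?_eq_getElem?, List.getLast?_eq_getElem?, List.length_map]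

def Ew (w : SW) : Prop := w.length = 1 ∧ ∀ x ∈ w, x.1 = true → ¬ inC f t cands x.2

def goodw (w : SW) : Prop := (w.length = 1 ∧ ∀ x ∈ w, reduce x.2 ≠ []) ∨ CRw f t cands w

lemma exists_toF (w : List (Bool × FF)) : ∃ v : SW, toF v = w :=
  ⟨w.map fun x => (x.1, x.2.toWord), by simp [toF, Function.comp_def, mk_toWord]⟩

lemma ev_surj (g : PP f t hf hf1) : ∃ h : Word VV, ev f t hf hf1 (mk h) = g := by
  induction g using Monoid.PushoutI.induction_on with
  | of i g => exact ⟨tagw i g.toWord, by rw [ev_tagw, mk_toWord]; rfl⟩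
  | base c => exact ⟨tagw true (ph f t hf hf1 true c).toWord, by
      rw [ev_tagw, mk_toWord]; exact pof_phi _ _⟩
  | mul x y hx hy =>
    obtain ⟨a, rfl⟩ := hx
    obtain ⟨b, rfl⟩ := hy
    exact ⟨a ++ b, by rw [← mul_mk, _root_.map_mul]⟩

include hc in
/-- every element has a certificate -/
lemma exists_cert (u : Word VV) : ∃ (h : Word VV) (w : SW), (Ew f t cands w ∨ CRw f t cands w) ∧
    ev f t hf hf1 (mk u) = ev f t hf hf1 (mk (h ++ tw w ++ invRev h)) := by
  rcases T_class f t hf hf1 (ev f t hf hf1 (mk u)) with ⟨g, l, y, hy, e⟩ | ⟨g, w, hw, e⟩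
  · obtain ⟨h, rfl⟩ := ev_surj f t hf hf1 g
    refine ⟨h, [(l, y.toWord)], Or.inl ⟨rfl, ?_⟩, ?_⟩
    · intro x hx hl hi
      rw [List.mem_singleton] at hx
      subst hx
      obtain ⟨c, hcc⟩ := (inC_iff f t hf hf1 cands hc _).1 hi
      rw [mk_toWord] at hcc
      exact hy hl c hcc
    · rw [e, ← mul_mk, ← mul_mk, ← inv_mk, _root_.map_mul, _root_.map_mul, _root_.map_inv, ev_tw]
      simp [Pw, toF, mk_toWord]
  · obtain ⟨h, rfl⟩ := ev_surj f t hf hf1 g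
    obtain ⟨w, rfl⟩ := exists_toF w
    refine ⟨h, w, Or.inr ((CRw_iff f t hf hf1 cands hc w).2 hw), ?_⟩
    rw [e, ← mul_mk, ← mul_mk, ← inv_mk, _root_.map_mul, _root_.map_mul, _root_.map_inv, ev_tw]

include hc in
lemma good_ne {w : SW} (h : goodw f t cands w) : Pw f t hf hf1 (toF w) ≠ 1 := by
  rcases h with ⟨h1, h2⟩ | h
  · obtain ⟨⟨l, y⟩, rfl⟩ := List.length_eq_one_iff.1 h1
    intro he
    have : pf f t hf hf1 l (mk y) = 1 := by simpa [Pw, toF] using he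
    rw [← _root_.map_one (pf f t hf hf1 l)] at this
    have := pf_inj f t hf hf1 l this
    refine h2 _ (List.mem_singleton_self _) ?_
    rw [one_eq_mk] at this
    simpa using reduce.sound this
  · exact T_one f t hf hf1 ((CRw_iff f t hf hf1 cands hc w).1 h)

include hc in
theorem nWP_iff (u) : ¬ WP f t hf hf1 u ↔ ∃ x : (Word VV × SW) × List (Word VV × ℕ × Bool),
    goodw f t cands x.1.2 ∧
    reduce (x.1.1 ++ tw x.1.2 ++ invRev x.1.1 ++ relw f t x.2) = reduce u := by
  constructor
  · intro hu
    obtain ⟨h, w, hw, e⟩ := exists_cert f t hf hf1 cands hc u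
    obtain ⟨L, hL⟩ := exists_relw f t hf hf1 (x := (mk (h ++ tw w ++ invRev h))⁻¹ * mk u)
      (by rw [_root_.map_mul, _root_.map_inv, e]; simp)
    refine ⟨((h, w), L), ?_, ?_⟩
    · rcases hw with ⟨h1, h2⟩ | hw
      · left
        refine ⟨h1, fun x hx hr => hu ?_⟩
        obtain ⟨y, rfl⟩ := List.length_eq_one_iff.1 h1
        rw [List.mem_singleton] at hx
        subst hx
        have : (mk x.2 : FF) = 1 := by rw [one_eq_mk]; apply reduce.exact; rw [hr]; rfl
        rw [WP, e, ← mul_mk, ← mul_mk, ← inv_mk, _root_.map_mul, _root_.map_mul, _root_.map_inv, ev_tw]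
        simp [Pw, toF, this]
      · right; exact hw
    · apply reduce.sound
      simp only
      rw [← mul_mk, ← hL]; group
  · rintro ⟨⟨⟨h, w⟩, L⟩, hg, e⟩ hu
    have := congrArg (ev f t hf hf1) (reduce.exact e)
    simp only at this
    rw [hu, ← mul_mk, ← mul_mk, ← mul_mk, ← inv_mk, _root_.map_mul, _root_.map_mul, _root_.map_mul, _root_.map_inv, ev_tw, ev_relw] at this
    refine good_ne f t hf hf1 cands hc hg ?_
    simpa using this

def lsum (w : SW) : ℕ := (w.map fun x => x.2.length).sum

lemma nsum_le (w : SW) : nsum (toF w) ≤ lsum w := by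
  induction w with
  | nil => exact le_rfl
  | cons x w ih =>
    have : (mk x.2 : FF).norm ≤ x.2.length := norm_mk_le
    simp only [nsum, toF, lsum, List.map_cons, List.sum_cons, List.map_map] at ih ⊢
    omega

def rot (w : SW) (k : ℕ) : SW := w.drop k ++ w.take k

def Ecj (w w' : SW) : Prop := ∀ x ∈ w, ∀ x' ∈ w', x.1 = x'.1 ∧ conjF x.2 x'.2

def Hw (w w' : SW) (k : ℕ) (c : Word ℕ) : Word VV :=
  invRev (tagw false (phw f t false c)) ++ tw (rot w' k) ++ tagw false (phw f t false c) ++ invRev (tw w)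

def Hcj (w w' : SW) : Prop := ∃ k ∈ List.range (w'.length + 1),
  ∃ c ∈ cands (3 * (lsum w + lsum w')), WP f t hf hf1 (Hw f t w w' k c)

lemma toF_rot (w : SW) {k : ℕ} (hk : k ≤ w.length) : toF (rot w k) = (toF w).rotate k := by
  rw [List.rotate_eq_drop_append_take (by simpa [toF] using hk)]
  simp [toF, rot, List.map_drop, List.map_take]

lemma ev_Hw (w w' k c) : WP f t hf hf1 (Hw f t w w' k c) ↔
    (pf f t hf hf1 false (ph f t hf hf1 false (mk c)))⁻¹ * Pw f t hf hf1 (toF (rot w' k)) *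
        pf f t hf hf1 false (ph f t hf hf1 false (mk c)) = Pw f t hf hf1 (toF w) := by
  rw [WP, Hw, ← mul_mk, ← mul_mk, ← mul_mk, ← inv_mk, ← inv_mk]
  simp only [_root_.map_mul, _root_.map_inv, ev_tw, ev_tagw, mk_phw f t hf hf1]
  rw [mul_inv_eq_one]

lemma rot_conj (w : SW) (k) : IsConj (Pw f t hf hf1 (toF w)) (Pw f t hf hf1 (toF (rot w k))) := by
  rw [rot]
  conv_lhs => rw [← List.take_append_drop k w]
  simp only [Pw, toF, List.map_append, List.prod_append]
  exact isConj_iff.2 ⟨(List.map (fun x => pf f t hf hf1 x.1 x.2) (List.map (fun x => (x.1, mk x.2)) (List.take k w))).prod⁻¹, by group⟩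

include hc in
lemma Hcj_iff {w w' : SW} (hw : CRw f t cands w) (hw' : CRw f t cands w') :
    Hcj f t hf hf1 cands w w' ↔ IsConj (Pw f t hf hf1 (toF w)) (Pw f t hf hf1 (toF w')) := by
  constructor
  · rintro ⟨k, -, c, -, h⟩
    rw [ev_Hw] at h
    refine IsConj.symm ((rot_conj f t hf hf1 w' k).trans (isConj_iff.2
      ⟨(pf f t hf hf1 false (ph f t hf hf1 false (mk c)))⁻¹, ?_⟩))
    rw [← h, inv_inv]
  · intro h
    obtain ⟨k, hk, c, hcw, e⟩ := (T_hh f t hf hf1 ((CRw_iff f t hf hf1 cands hc w).1 hw)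
      ((CRw_iff f t hf hf1 cands hc w').1 hw')).1 h.symm
    have hk : k ≤ w'.length := by simpa [toF] using hk
    refine ⟨k, List.mem_range.2 (by omega), c.toWord, hc _ _ (hcw.trans ?_), ?_⟩
    · have := nsum_le w
      have := nsum_le w'
      omega
    · rw [ev_Hw, mk_toWord, toF_rot _ hk]; exact e

def Bad (w w' : SW) : Prop :=
  (Ew f t cands w ∧ Ew f t cands w' ∧ ¬ Ecj w w') ∨ (Ew f t cands w ∧ CRw f t cands w') ∨
  (CRw f t cands w ∧ Ew f t cands w') ∨
  (CRw f t cands w ∧ CRw f t cands w' ∧ ¬ Hcj f t hf hf1 cands w w')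

def CJ (u v : Word VV) : Prop := IsConj (ev f t hf hf1 (mk u)) (ev f t hf hf1 (mk v))

include hc in
lemma Ew_form {w : SW} (h : Ew f t cands w) : ∃ l y, w = [(l, y)] ∧ Can f t hf hf1 l (mk y) := by
  obtain ⟨h1, h2⟩ := h
  obtain ⟨⟨l, y⟩, rfl⟩ := List.length_eq_one_iff.1 h1
  refine ⟨l, y, rfl, fun hl c hcc => ?_⟩
  exact h2 _ (List.mem_singleton_self _) hl ((inC_iff f t hf hf1 cands hc _).2 ⟨c, hcc⟩)

lemma Pw_single (l y) : Pw f t hf hf1 (toF [(l, y)]) = pf f t hf hf1 l (mk y) := by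
  simp [Pw, toF]

include hc in
lemma bad_iff {w w' : SW} (hw : Ew f t cands w ∨ CRw f t cands w) (hw' : Ew f t cands w' ∨ CRw f t cands w') :
    Bad f t hf hf1 cands w w' ↔ ¬ IsConj (Pw f t hf hf1 (toF w)) (Pw f t hf hf1 (toF w')) := by
  have hEE : Ew f t cands w → Ew f t cands w' →
      (Ecj w w' ↔ IsConj (Pw f t hf hf1 (toF w)) (Pw f t hf hf1 (toF w'))) := by
    intro h h'
    obtain ⟨l, y, rfl, hy⟩ := Ew_form f t hf hf1 cands hc h
    obtain ⟨l', y', rfl, hy'⟩ := Ew_form f t hf hf1 cands hc h'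
    rw [Pw_single, Pw_single, T_ell f t hf hf1 hy hy', Ecj]
    simp [conjF_iff]
  have hEC : ∀ w w', Ew f t cands w → CRw f t cands w' →
      ¬ IsConj (Pw f t hf hf1 (toF w)) (Pw f t hf hf1 (toF w')) := by
    intro w w' h h'
    obtain ⟨l, y, rfl, hy⟩ := Ew_form f t hf hf1 cands hc h
    rw [Pw_single]
    exact T_eh f t hf hf1 ((CRw_iff f t hf hf1 cands hc w').1 h')
  have hCC : CRw f t cands w → CRw f t cands w' → _ := fun h h' => Hcj_iff f t hf hf1 cands hc h h'
  constructor
  · rintro (⟨h, h', hn⟩ | ⟨h, h'⟩ | ⟨h, h'⟩ | ⟨h, h', hn⟩)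
    · rwa [← hEE h h']
    · exact hEC _ _ h h'
    · exact fun hcj => hEC _ _ h' h hcj.symm
    · rwa [← hCC h h']
  · intro hn
    rcases hw with h | h <;> rcases hw' with h' | h'
    · exact Or.inl ⟨h, h', by rwa [hEE h h']⟩
    · exact Or.inr (Or.inl ⟨h, h'⟩)
    · exact Or.inr (Or.inr (Or.inl ⟨h, h'⟩))
    · exact Or.inr (Or.inr (Or.inr ⟨h, h', by rwa [hCC h h']⟩))

include hc in
theorem nCJ_iff (u v) : ¬ CJ f t hf hf1 u v ↔ ∃ x : (Word VV × SW) × (Word VV × SW),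
    Bad f t hf hf1 cands x.1.2 x.2.2 ∧
    WP f t hf hf1 (x.1.1 ++ tw x.1.2 ++ invRev x.1.1 ++ invRev u) ∧
    WP f t hf hf1 (x.2.1 ++ tw x.2.2 ++ invRev x.2.1 ++ invRev v) := by
  have hWP : ∀ a b : Word VV, WP f t hf hf1 (a ++ invRev b) ↔ ev f t hf hf1 (mk b) = ev f t hf hf1 (mk a) := by
    intro a b
    rw [WP, ← mul_mk, ← inv_mk, _root_.map_mul, _root_.map_inv, mul_inv_eq_one, eq_comm]
  have hcj : ∀ (h : Word VV) w, IsConj (Pw f t hf hf1 (toF w)) (ev f t hf hf1 (mk (h ++ tw w ++ invRev h))) := by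
    intro h w
    refine isConj_iff.2 ⟨ev f t hf hf1 (mk h), ?_⟩
    rw [← mul_mk, ← mul_mk, ← inv_mk, _root_.map_mul, _root_.map_mul, _root_.map_inv, ev_tw]
  constructor
  · intro hn
    obtain ⟨h, w, hw, e⟩ := exists_cert f t hf hf1 cands hc u
    obtain ⟨h', w', hw', e'⟩ := exists_cert f t hf hf1 cands hc v
    refine ⟨((h, w), (h', w')), (bad_iff f t hf hf1 cands hc hw hw').2 ?_, (hWP _ _).2 e, (hWP _ _).2 e'⟩
    intro hc'
    apply hn
    rw [CJ, e, e']
    exact ((hcj h w).symm.trans hc').trans (hcj h' w')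
  · rintro ⟨⟨⟨h, w⟩, ⟨h', w'⟩⟩, hb, e, e'⟩ hn
    simp only at hb e e'
    rw [hWP] at e e'
    have hw : Ew f t cands w ∨ CRw f t cands w := by
      rcases hb with h | h | h | h <;> tauto
    have hw' : Ew f t cands w' ∨ CRw f t cands w' := by
      rcases hb with h | h | h | h <;> tauto
    refine (bad_iff f t hf hf1 cands hc hw hw').1 hb ?_
    rw [CJ, e, e'] at hn
    exact ((hcj h w).trans hn).trans (hcj h' w').symm

theorem CJ_iff (u v) : CJ f t hf hf1 u v ↔ ∃ h : Word VV, WP f t hf hf1 (h ++ u ++ invRev h ++ invRev v) := by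
  have : ∀ h : Word VV, WP f t hf hf1 (h ++ u ++ invRev h ++ invRev v) ↔
      ev f t hf hf1 (mk h) * ev f t hf hf1 (mk u) * (ev f t hf hf1 (mk h))⁻¹ = ev f t hf hf1 (mk v) := by
    intro h
    rw [WP, ← mul_mk, ← mul_mk, ← mul_mk, ← inv_mk, ← inv_mk]
    simp only [_root_.map_mul, _root_.map_inv]
    rw [mul_inv_eq_one]
  simp only [this]
  rw [CJ, isConj_iff]
  constructor
  · rintro ⟨g, hg⟩
    obtain ⟨h, rfl⟩ := ev_surj f t hf hf1 g
    exact ⟨h, hg⟩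
  · rintro ⟨h, hg⟩
    exact ⟨_, hg⟩

end Words
end CD

namespace CD
section HComp
open FreeGroup
open Computable (fst snd)

variable {α β γ σ : Type} [Primcodable α] [Primcodable β] [Primcodable γ] [Primcodable σ]

section red
variable [DecidableEq β]

def redStep (x : (β × Bool) × List (β × Bool)) : List (β × Bool) :=
  List.casesOn x.2 [x.1] fun hd tl => if x.1.1 = hd.1 ∧ x.1.2 = !hd.2 then tl else x.1 :: hd :: tl

lemma redStep_prim : Primrec (redStep (β := β)) := by
  refine Primrec.list_casesOn (f := fun x : (β × Bool) × List (β × Bool) => x.2)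
    (g := fun x => [x.1])
    (h := fun x (y : (β × Bool) × List (β × Bool)) =>
      if x.1.1 = y.1.1 ∧ x.1.2 = !y.1.2 then y.2 else x.1 :: y.1 :: y.2) ?_ ?_ ?_
  · exact Primrec.snd
  · exact Primrec.list_cons.comp Primrec.fst (Primrec.const [])
  · have hp : PrimrecPred fun y : ((β × Bool) × List (β × Bool)) × ((β × Bool) × List (β × Bool)) =>
        y.1.1.1 = y.2.1.1 ∧ y.1.1.2 = !y.2.1.2 := by
      refine PrimrecPred.and ?_ ?_
      · exact Primrec.eq.comp (Primrec.fst.comp (Primrec.fst.comp Primrec.fst))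
          (Primrec.fst.comp (Primrec.fst.comp Primrec.snd))
      · exact Primrec.eq.comp (Primrec.snd.comp (Primrec.fst.comp Primrec.fst))
          (Primrec.not.comp (Primrec.snd.comp (Primrec.fst.comp Primrec.snd)))
    have h1 : Primrec fun y : ((β × Bool) × List (β × Bool)) × ((β × Bool) × List (β × Bool)) => y.2.2 :=
      Primrec.snd.comp Primrec.snd
    have h2 : Primrec fun y : ((β × Bool) × List (β × Bool)) × ((β × Bool) × List (β × Bool)) =>
        y.1.1 :: y.2.1 :: y.2.2 := Primrec.list_cons.comp (Primrec.fst.comp Primrec.fst)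
        (Primrec.list_cons.comp (Primrec.fst.comp Primrec.snd) (Primrec.snd.comp Primrec.snd))
    exact Primrec.ite hp h1 h2

lemma reduce_comp : Computable (reduce : List (β × Bool) → List (β × Bool)) := by
  have : Primrec fun L : List (β × Bool) => L.foldr (fun b s => redStep (b, s)) [] :=
    Primrec.list_foldr (h := fun _ x => redStep x) Primrec.id (Primrec.const []) (redStep_prim.comp Primrec.snd).to₂
  refine this.to_comp.of_eq fun L => ?_
  induction L with
  | nil => rfl
  | cons x L ih =>
    rw [List.foldr_cons, ih, reduce.cons]
    rfl

end red

lemma invRev_comp : Computable (invRev : List (β × Bool) → List (β × Bool)) := by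
  have : Primrec fun L : List (β × Bool) => (L.map fun x => (x.1, !x.2)).reverse :=
    Primrec.list_reverse.comp (Primrec.list_map Primrec.id
      ((Primrec.fst.comp Primrec.snd).pair (Primrec.not.comp (Primrec.snd.comp Primrec.snd))).to₂)
  exact this.to_comp.of_eq fun L => rfl

lemma app {f g : α → List β} (hf : Computable f) (hg : Computable g) :
    Computable fun a => f a ++ g a := Computable.list_append.comp hf hg

lemma genPow_comp (x : Fin 46) (s : Bool) : Computable (genPow x s) := by
  have : Primrec fun n : ℕ => (List.range n).map fun _ => (x, s) :=
    Primrec.list_map Primrec.list_range (Primrec.const (x, s)).to₂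
  exact this.to_comp.of_eq fun n => by simp [genPow]

lemma flat_comp : Computable (List.flatten : List (List β) → List β) := Primrec.list_flatten.to_comp

lemma aWord_comp : Computable aWord :=
  flat_comp.comp (Computable.list_ofFn fun k => genPow_comp _ _)
lemma bWord_comp : Computable bWord :=
  flat_comp.comp (Computable.list_ofFn fun k => genPow_comp _ _)

lemma conjWord_comp : Computable fun x : ℕ × ℕ => conjWord x.1 x.2 := by
  unfold conjWord
  exact app (app (app (app (app ((genPow_comp _ _).comp fst) ((genPow_comp _ _).comp snd))
    ((genPow_comp _ _).comp fst)) ((genPow_comp _ _).comp snd))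
    ((genPow_comp _ _).comp fst)) ((genPow_comp _ _).comp snd)

lemma bcond {c : α → Bool} {f g : α → σ} (hc : Computable c) (hf : Computable f) (hg : Computable g) :
    Computable fun a => if c a then f a else g a :=
  (Computable.cond hc hf hg).of_eq fun a => by cases c a <;> rfl

variable (f t : ℕ → ℕ) (hf : Function.Injective f) (hf1 : ∀ i, 1 ≤ i → 1 ≤ f i)
variable (hfc : Computable f) (htc : Computable t)

include hfc htc in
lemma gw_comp : Computable fun x : Bool × ℕ => gw f t x.1 x.2 := by
  have hs : Computable fun x : Bool × ℕ => x.2 + 1 := Computable.succ.comp snd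
  have hcc := conjWord_comp.comp (hs.pair (htc.comp hs))
  have h0 : Computable fun _ : Bool × ℕ => ([] : Word (Fin 46)) := Computable.const []
  have hcw : Computable fun x : Bool × ℕ => cw t x.1 x.2 := by
    refine (bcond (c := fun x : Bool × ℕ => x.1) fst h0 hcc).of_eq fun x => ?_
    rcases x with ⟨_ | _, k⟩ <;> simp [cw]
  have hB : Computable fun x : Bool × ℕ => bWord (f (x.2 + 1)) := bWord_comp.comp (hfc.comp hs)
  have hA : Computable fun x : Bool × ℕ => aWord (f (x.2 + 1)) := aWord_comp.comp (hfc.comp hs)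
  have hm : Computable fun x : Bool × ℕ => if x.1 then bWord (f (x.2 + 1)) else aWord (f (x.2 + 1)) :=
    bcond (c := fun x => x.1) fst hB hA
  have hi : Computable fun x : Bool × ℕ => invRev (cw t x.1 x.2) := invRev_comp.comp hcw
  refine (app (app hi hm) hcw).of_eq fun x => ?_
  simp only [gw]

lemma tagw_comp : Computable fun x : Bool × Word (Fin 46) => tagw x.1 x.2 := by
  have : Primrec fun x : Bool × Word (Fin 46) => x.2.map fun a => ((x.1, a.1), a.2) :=
    Primrec.list_map Primrec.snd (((Primrec.fst.comp Primrec.fst).pair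
      (Primrec.fst.comp Primrec.snd)).pair (Primrec.snd.comp Primrec.snd)).to₂
  exact this.to_comp

include hfc htc in
lemma RW_comp : Computable (RW f t) := by
  have h : ∀ l, Computable fun k => tagw l (gw f t l k) := fun l =>
    tagw_comp.comp ((Computable.const l).pair ((gw_comp f t hfc htc).comp ((Computable.const l).pair Computable.id)))
  exact app (h false) (invRev_comp.comp (h true))

include hfc htc in
lemma relw_comp : Computable (relw f t) := by
  have h : Computable (relStep f t) := by
    have hR := (RW_comp f t hfc htc).comp (α := Word VV × ℕ × Bool) (fst.comp snd)
    exact app (app fst (bcond (snd.comp snd) hR (invRev_comp.comp hR))) (invRev_comp.comp fst)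
  exact comp_flatMap Computable.id (h.comp snd).to₂

lemma tw_comp : Computable tw := comp_flatMap Computable.id (tagw_comp.comp snd).to₂

include hfc htc in
lemma phw_comp : Computable fun x : Bool × Word ℕ => phw f t x.1 x.2 := by
  have hy : Computable fun y : (Bool × Word ℕ) × (ℕ × Bool) => (y.1.1, y.2.1) :=
    (fst.comp fst).pair (fst.comp snd)
  have hg := (gw_comp f t hfc htc).comp hy
  have hb : Computable fun y : (Bool × Word ℕ) × (ℕ × Bool) => y.2.2 := snd.comp snd
  have := bcond hb hg (invRev_comp.comp hg)
  have h2 : Computable₂ fun (x : Bool × Word ℕ) (y : ℕ × Bool) =>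
    if y.2 then gw f t x.1 y.1 else invRev (gw f t x.1 y.1) := this
  have h3 := comp_flatMap snd h2
  exact h3

lemma lsum_comp : Computable lsum := by
  have : Primrec fun w : SW => w.foldr (fun x n => x.2.length + n) 0 :=
    Primrec.list_foldr (h := fun _ (x : (Bool × Word (Fin 46)) × ℕ) => x.1.2.length + x.2) Primrec.id (Primrec.const 0)
      (Primrec.nat_add.comp (Primrec.list_length.comp (Primrec.snd.comp (Primrec.fst.comp Primrec.snd)))
        (Primrec.snd.comp Primrec.snd)).to₂
  exact this.to_comp.of_eq fun w => by induction w <;> simp_all [lsum]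

/-- candidate lists -/
def alph (N : ℕ) : List (ℕ × Bool) := (List.range N).flatMap fun i => [(i, true), (i, false)]

def cs (N n : ℕ) : List (Word ℕ) :=
  Nat.rec [[]] (fun _ ih => [] :: ih.flatMap fun c => (alph N).map fun x => x :: c) n

lemma mem_cs (N : ℕ) : ∀ n (c : Word ℕ), c.length ≤ n → (∀ x ∈ c, x.1 < N) → c ∈ cs N n := by
  intro n
  induction n with
  | zero => intro c h _; rw [List.length_eq_zero_iff.1 (Nat.le_zero.1 h)]; simp [cs]
  | succ n ih =>
    intro c h hx
    change c ∈ [] :: (cs N n).flatMap fun c => (alph N).map fun x => x :: c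
    rcases c with _ | ⟨x, c⟩
    · simp
    · refine List.mem_cons_of_mem _ (List.mem_flatMap.2 ⟨c, ih c (by simpa using h)
        (fun y hy => hx y (List.mem_cons_of_mem _ hy)), List.mem_map.2 ⟨x, ?_, rfl⟩⟩)
      have := hx x List.mem_cons_self
      simp only [alph, List.mem_flatMap, List.mem_range]
      refine ⟨x.1, this, ?_⟩
      rcases x with ⟨a, _ | _⟩ <;> simp

lemma alph_prim : Primrec alph := by
  refine Primrec.list_flatMap Primrec.list_range (Primrec.list_cons.comp (Primrec.snd.pair (Primrec.const true))
    (Primrec.list_cons.comp (Primrec.snd.pair (Primrec.const false)) (Primrec.const []))).to₂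

lemma cs_prim : Primrec₂ cs := by
  have : Primrec₂ fun (N : ℕ) (x : ℕ × List (Word ℕ)) =>
      ([] :: x.2.flatMap fun c => (alph N).map fun y => y :: c : List (Word ℕ)) := by
    have h1 : Primrec₂ fun (z : (ℕ × (ℕ × List (Word ℕ))) × Word ℕ) (y : ℕ × Bool) => y :: z.2 :=
      Primrec.list_cons.comp Primrec.snd (Primrec.snd.comp Primrec.fst)
    have h0 : Primrec fun z : (ℕ × (ℕ × List (Word ℕ))) × Word ℕ => alph z.1.1 :=
      alph_prim.comp (Primrec.fst.comp Primrec.fst)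
    have h2 : Primrec₂ fun (z : ℕ × (ℕ × List (Word ℕ))) (c : Word ℕ) => (alph z.1).map fun y => y :: c :=
      Primrec.list_map h0 h1
    have h4 : Primrec fun z : ℕ × (ℕ × List (Word ℕ)) => z.2.2 := Primrec.snd.comp Primrec.snd
    have h3 := Primrec.list_flatMap h4 h2
    exact Primrec.list_cons.comp (Primrec.const []) h3
  exact Primrec.nat_rec (f := fun _ => [[]]) (Primrec.const _) this

include hf hf1 hfc in
lemma exists_cands (hA : ComputablePred fun j : ℕ => ∃ i : ℕ, 1 ≤ i ∧ f i = j) :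
    ∃ cands : ℕ → List (Word ℕ), Computable cands ∧ ∀ s c, wgt f c ≤ s → c ∈ cands s := by
  have hs : Computable fun i => f (i + 1) := hfc.comp Computable.succ
  obtain ⟨h, hh, hp⟩ := comp_find (α := ℕ)
    (p := fun s N => ∀ j ∈ List.range (s + 1), (∃ i : ℕ, 1 ≤ i ∧ f i = j) → ∃ i ∈ List.range N, f (i + 1) = j) (by
      refine CPred.all (Primrec.list_range.to_comp.comp (Computable.succ.comp fst)) ?_
      refine CPred.imp (CPred.comp (p := fun j => ∃ i : ℕ, 1 ≤ i ∧ f i = j) (f := fun x : (ℕ × ℕ) × ℕ => x.2) hA snd) ?_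
      refine CPred.ex (Primrec.list_range.to_comp.comp (snd.comp fst)) ?_
      exact CPred.eq (hs.comp snd) (snd.comp fst)) (by
      intro s
      have : ∀ j, ∃ N, (∃ i : ℕ, 1 ≤ i ∧ f i = j) → ∃ i < N, f (i + 1) = j := by
        intro j
        by_cases hj : ∃ i : ℕ, 1 ≤ i ∧ f i = j
        · obtain ⟨i, h1, h2⟩ := hj
          exact ⟨i, fun _ => ⟨i - 1, by omega, by rw [Nat.sub_add_cancel h1, h2]⟩⟩
        · exact ⟨0, fun h => absurd h hj⟩
      choose N hN using this
      refine ⟨((List.range (s + 1)).map N).sum, fun j hj hA => ?_⟩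
      obtain ⟨i, hi, e⟩ := hN j hA
      have : N j ≤ ((List.range (s + 1)).map N).sum :=
        List.single_le_sum (fun _ _ => Nat.zero_le _) _ (List.mem_map_of_mem hj)
      exact ⟨i, List.mem_range.2 (by omega), e⟩)
  refine ⟨fun s => cs (h s) s, cs_prim.to_comp.comp hh Computable.id, fun s c hw => ?_⟩
  have hlen : ∀ c : Word ℕ, c.length ≤ wgt f c ∧ ∀ x ∈ c, f (x.1 + 1) ≤ wgt f c := by
    intro c
    induction c with
    | nil => simp
    | cons y c ih =>
      have := hf1 (y.1 + 1) (by omega)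
      have e : wgt f (y :: c) = f (y.1 + 1) + wgt f c := by simp [wgt]
      refine ⟨by rw [e, List.length_cons]; omega, fun x hx => ?_⟩
      rcases List.mem_cons.1 hx with rfl | hx
      · omega
      · have := ih.2 x hx; omega
  refine mem_cs _ _ _ ((hlen c).1.trans hw) fun x hx => ?_
  have h1 := (hlen c).2 x hx
  obtain ⟨i, hi, e⟩ := hp s (f (x.1 + 1)) (List.mem_range.2 (by omega)) ⟨x.1 + 1, by omega, rfl⟩
  have := hf e
  have := List.mem_range.1 hi
  omega

variable (cands : ℕ → List (Word ℕ)) (hcc : Computable cands)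

include hfc htc hcc in
lemma inR_comp : ComputablePred (inR f t cands) := by
  refine CPred.ex (hcc.comp (Computable.list_length.comp snd)) ?_
  have hy : Computable fun y : (Bool × Word (Fin 46)) × Word ℕ => (y.1.1, y.2) := (fst.comp fst).pair snd
  have h1 := reduce_comp.comp ((phw_comp f t hfc htc).comp hy)
  have hz : Computable fun y : (Bool × Word (Fin 46)) × Word ℕ => y.1.2 := snd.comp fst
  have h2 := reduce_comp.comp hz
  have := CPred.eq h1 h2
  exact this

lemma pre_comp : Computable fun x : Word (Fin 46) × ℕ => pre x.1 x.2 := by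
  have : Computable fun x : Word (Fin 46) × ℕ => x.1.take x.2 := Primrec.list_take.to_comp.comp snd fst
  have h2 := reduce_comp.comp (app (app (invRev_comp.comp this) fst) this)
  exact h2

lemma conjF_comp : ComputablePred fun x : Word (Fin 46) × Word (Fin 46) => conjF x.1 x.2 := by
  have hr : ∀ {g : Word (Fin 46) × Word (Fin 46) → Word (Fin 46)}, Computable g →
      Computable fun x => List.range ((reduce (g x)).length + 1) := fun hg =>
    Primrec.list_range.to_comp.comp (Computable.succ.comp (Computable.list_length.comp (reduce_comp.comp hg)))
  refine CPred.ex (hr fst) ?_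
  refine CPred.ex ((hr snd).comp fst) ?_
  have a1 : Computable fun x : ((Word (Fin 46) × Word (Fin 46)) × ℕ) × ℕ => x.1.1.1 := fst.comp (fst.comp fst)
  have a2 : Computable fun x : ((Word (Fin 46) × Word (Fin 46)) × ℕ) × ℕ => x.1.1.2 := snd.comp (fst.comp fst)
  have a3 : Computable fun x : ((Word (Fin 46) × Word (Fin 46)) × ℕ) × ℕ => x.1.2 := snd.comp fst
  have h1 := pre_comp.comp ((reduce_comp.comp a1).pair a3)
  have h2 := pre_comp.comp ((reduce_comp.comp a2).pair snd)
  have := CPred.eq h1 h2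
  exact this

include hfc htc hcc in
lemma inC_comp : ComputablePred (inC f t cands) := by
  refine CPred.ex (hcc.comp Computable.list_length) ?_
  have h0 : Computable fun y : Word (Fin 46) × Word ℕ => (true, y.2) := (Computable.const true).pair snd
  have h1 := fst.pair ((phw_comp f t hfc htc).comp h0)
  have := CPred.comp conjF_comp h1
  exact this

include hfc htc hcc in
lemma CRw_comp : ComputablePred (CRw f t cands) := by
  have hm : Computable fun w : SW => w.map Prod.fst := comp_map Computable.id (fst.comp snd).to₂
  refine CPred.and (CPred.all Computable.id (CPred.neg (CPred.comp (inR_comp f t hfc htc cands hcc) snd)))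
    (CPred.and ?_ ?_)
  · refine CPred.all (Primrec.list_range.to_comp.comp Computable.list_length) (CPred.neg (CPred.eq ?_ ?_))
    · exact Computable.list_getElem?.comp (hm.comp fst) snd
    · exact Computable.list_getElem?.comp (hm.comp fst) (Computable.succ.comp snd)
  · refine CPred.neg (CPred.eq ?_ ?_)
    · exact Computable.list_getElem?.comp hm (Computable.const 0)
    · exact Computable.list_getElem?.comp hm (Primrec.pred.to_comp.comp Computable.list_length)

lemma len1_comp : ComputablePred fun w : SW => w.length = 1 :=
  CPred.eq Computable.list_length (Computable.const 1)

include hfc htc hcc in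
lemma Ew_comp : ComputablePred (Ew f t cands) := by
  refine CPred.and len1_comp (CPred.all Computable.id ?_)
  exact CPred.imp (CPred.eq (fst.comp snd) (Computable.const true))
    (CPred.neg (CPred.comp (inC_comp f t hfc htc cands hcc) (snd.comp snd)))

include hfc htc hcc in
lemma goodw_comp : ComputablePred (goodw f t cands) := by
  refine CPred.or (CPred.and len1_comp (CPred.all Computable.id ?_)) (CRw_comp f t hfc htc cands hcc)
  exact CPred.neg (CPred.eq (reduce_comp.comp (snd.comp snd)) (Computable.const []))

variable (hc : ∀ s c, wgt f c ≤ s → c ∈ cands s)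

include hfc htc hcc hc in
theorem WP_comp : ComputablePred (WP f t hf hf1) := by
  rw [ComputablePred.computable_iff_re_compl_re']
  constructor
  · refine (CPred.exRE (p := fun u L => reduce u = reduce (relw f t L)) ?_).of_eq
      fun u => (WP_iff f t hf hf1 u).symm
    exact CPred.eq (reduce_comp.comp fst) (reduce_comp.comp ((relw_comp f t hfc htc).comp snd))
  · refine (CPred.exRE (p := fun u (x : (Word VV × SW) × List (Word VV × ℕ × Bool)) =>
      goodw f t cands x.1.2 ∧
      reduce (x.1.1 ++ tw x.1.2 ++ invRev x.1.1 ++ relw f t x.2) = reduce u) ?_).of_eq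
      fun u => (nWP_iff f t hf hf1 cands hc u).symm
    have h1 := fst.comp (fst.comp (snd (α := Word VV) (β := (Word VV × SW) × List (Word VV × ℕ × Bool))))
    refine CPred.and (CPred.comp (goodw_comp f t hfc htc cands hcc) (snd.comp (fst.comp snd))) ?_
    exact CPred.eq (reduce_comp.comp (app (app (app h1
      (tw_comp.comp (snd.comp (fst.comp snd)))) (invRev_comp.comp h1))
        ((relw_comp f t hfc htc).comp (snd.comp snd)))) (reduce_comp.comp fst)

lemma Ecj_comp : ComputablePred fun x : SW × SW => Ecj x.1 x.2 := by
  refine CPred.all fst (CPred.all (snd.comp fst) (CPred.and ?_ ?_))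
  · exact CPred.eq (fst.comp (snd.comp fst)) (fst.comp snd)
  · have h1 : Computable fun x : ((SW × SW) × (Bool × Word (Fin 46))) × (Bool × Word (Fin 46)) => (x.1.2.2, x.2.2) :=
      (snd.comp (snd.comp fst)).pair (snd.comp snd)
    have := CPred.comp conjF_comp h1
    exact this

lemma rot_comp : Computable fun x : SW × ℕ => rot x.1 x.2 :=
  app (Primrec.list_drop.to_comp.comp snd fst) (Primrec.list_take.to_comp.comp snd fst)

include hfc htc in
lemma Hw_comp : Computable fun x : ((SW × SW) × ℕ) × Word ℕ => Hw f t x.1.1.1 x.1.1.2 x.1.2 x.2 := by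
  have h0 : Computable fun x : ((SW × SW) × ℕ) × Word ℕ => (false, x.2) := (Computable.const false).pair snd
  have h1 := (phw_comp f t hfc htc).comp h0
  have h2 : Computable fun x : ((SW × SW) × ℕ) × Word ℕ => (false, phw f t false x.2) :=
    (Computable.const false).pair h1
  have hp := tagw_comp.comp h2
  have h3 : Computable fun x : ((SW × SW) × ℕ) × Word ℕ => (x.1.1.2, x.1.2) :=
    (snd.comp (fst.comp fst)).pair (snd.comp fst)
  have h4 : Computable fun x : ((SW × SW) × ℕ) × Word ℕ => x.1.1.1 := fst.comp (fst.comp fst)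
  have := app (app (app (invRev_comp.comp hp) (tw_comp.comp (rot_comp.comp h3))) hp)
    (invRev_comp.comp (tw_comp.comp h4))
  exact this

include hfc htc hcc hc in
lemma Hcj_comp : ComputablePred fun x : SW × SW => Hcj f t hf hf1 cands x.1 x.2 := by
  have hb : Computable fun x : SW × SW => 3 * (lsum x.1 + lsum x.2) :=
    Primrec.nat_mul.to_comp.comp (Computable.const 3)
      (Primrec.nat_add.to_comp.comp (lsum_comp.comp fst) (lsum_comp.comp snd))
  refine CPred.ex (Primrec.list_range.to_comp.comp (Computable.succ.comp (Computable.list_length.comp snd))) ?_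
  refine CPred.ex ((hcc.comp hb).comp fst) ?_
  exact CPred.comp (WP_comp f t hf hf1 hfc htc cands hcc hc) (Hw_comp f t hfc htc)

include hfc htc hcc hc in
lemma Bad_comp : ComputablePred fun x : SW × SW => Bad f t hf hf1 cands x.1 x.2 := by
  have hE := Ew_comp f t hfc htc cands hcc
  have hC := CRw_comp f t hfc htc cands hcc
  exact CPred.or (CPred.and (CPred.comp hE fst) (CPred.and (CPred.comp hE snd) (CPred.neg Ecj_comp)))
    (CPred.or (CPred.and (CPred.comp hE fst) (CPred.comp hC snd))
    (CPred.or (CPred.and (CPred.comp hC fst) (CPred.comp hE snd))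
    (CPred.and (CPred.comp hC fst) (CPred.and (CPred.comp hC snd)
      (CPred.neg (Hcj_comp f t hf hf1 hfc htc cands hcc hc))))))

include hfc htc hcc hc in
theorem CJ_comp : ComputablePred fun x : Word VV × Word VV => CJ f t hf hf1 x.1 x.2 := by
  have hW := WP_comp f t hf hf1 hfc htc cands hcc hc
  rw [ComputablePred.computable_iff_re_compl_re']
  constructor
  · refine (CPred.exRE (p := fun (x : Word VV × Word VV) (h : Word VV) =>
      WP f t hf hf1 (h ++ x.1 ++ invRev h ++ invRev x.2)) ?_).of_eq
      fun x => (CJ_iff f t hf hf1 x.1 x.2).symm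
    exact CPred.comp hW (app (app (app snd (fst.comp fst)) (invRev_comp.comp snd))
      (invRev_comp.comp (snd.comp fst)))
  · refine (CPred.exRE (p := fun (u : Word VV × Word VV) (x : (Word VV × SW) × (Word VV × SW)) =>
      Bad f t hf hf1 cands x.1.2 x.2.2 ∧
      WP f t hf hf1 (x.1.1 ++ tw x.1.2 ++ invRev x.1.1 ++ invRev u.1) ∧
      WP f t hf hf1 (x.2.1 ++ tw x.2.2 ++ invRev x.2.1 ++ invRev u.2)) ?_).of_eq
      fun x => (nCJ_iff f t hf hf1 cands hc x.1 x.2).symm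
    refine CPred.and (CPred.comp (Bad_comp f t hf hf1 hfc htc cands hcc hc)
      ((snd.comp (fst.comp snd)).pair (snd.comp (snd.comp snd)))) (CPred.and ?_ ?_)
    · exact CPred.comp hW (app (app (app (fst.comp (fst.comp snd)) (tw_comp.comp (snd.comp (fst.comp snd))))
        (invRev_comp.comp (fst.comp (fst.comp snd)))) (invRev_comp.comp (fst.comp fst)))
    · exact CPred.comp hW (app (app (app (fst.comp (snd.comp snd)) (tw_comp.comp (snd.comp (snd.comp snd))))
        (invRev_comp.comp (fst.comp (snd.comp snd)))) (invRev_comp.comp (snd.comp fst)))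

end HComp
end CD

namespace CD
section Asm
open FreeGroup

lemma hom_letters {K : Type*} [Group K] (x y : FF →* K) (w : Word (Fin 46))
    (h : ∀ a ∈ w, x (of a.1) = y (of a.1)) : x (mk w) = y (mk w) := by
  induction w with
  | nil => rw [← one_eq_mk, _root_.map_one, _root_.map_one]
  | cons a w ih =>
    rw [mk_cons2, _root_.map_mul, _root_.map_mul, ih fun b hb => h b (List.mem_cons_of_mem _ hb)]
    have := h a List.mem_cons_self
    rcases a with ⟨a, _ | _⟩ <;> simp_all

lemma invRev_genPow (x : Fin 46) (n : ℕ) : genPow x false n = invRev (genPow x true n) := by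
  simp [genPow, invRev]

lemma conjWordInv_eq (i k) : conjWordInv i k = invRev (conjWord i k) := by
  simp [conjWordInv, conjWord, invRev_append, invRev_genPow]

lemma bWordRevInv_eq (j) : bWordRevInv j = invRev (bWord j) := by
  simp only [bWordRevInv, bWord, invRev_genPow, invRev, List.map_flatten, List.reverse_flatten,
    List.map_ofFn]
  congr 1

def isB (a : Fin 46) : Bool := decide (20 ≤ a.1 ∧ a.1 < 40)

lemma aWord_letter {j} {a} (h : a ∈ aWord j) : isB a.1 = false := by
  simp only [aWord, List.mem_flatten, List.mem_ofFn, genPow] at h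
  obtain ⟨_, ⟨k, rfl⟩, h⟩ := h
  rw [List.eq_of_mem_replicate h]
  have := k.2
  simp only [isB, genA]
  exact decide_eq_false (by omega)

lemma bWord_letter {j} {a} (h : a ∈ bWord j) : isB a.1 = true := by
  simp only [bWord, List.mem_flatten, List.mem_ofFn, genPow] at h
  obtain ⟨_, ⟨k, rfl⟩, h⟩ := h
  rw [List.eq_of_mem_replicate h]
  have := k.2
  simp only [isB, genB]
  exact decide_eq_true (by omega)

lemma conjWord_letter {i k} {a} (h : a ∈ conjWord i k) : isB a.1 = false := by
  simp only [conjWord, List.mem_append, genPow] at h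
  rcases h with ((((h | h) | h) | h) | h) | h <;> rw [List.eq_of_mem_replicate h] <;> rfl

variable (f t : ℕ → ℕ) (hf : Function.Injective f) (hf1 : ∀ i, 1 ≤ i → 1 ≤ f i)

lemma relator_mk (i) : (mk (relatorWord f t i) : FF) =
    mk (aWord (f i)) * mk (conjWord i (t i)) * (mk (bWord (f i)))⁻¹ * (mk (conjWord i (t i)))⁻¹ := by
  rw [relatorWord, conjWordInv_eq, bWordRevInv_eq, ← mul_mk, ← mul_mk, ← mul_mk, inv_mk, inv_mk]

lemma mk_gw_false (k) : (mk (gw f t false k) : FF) =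
    (mk (conjWord (k + 1) (t (k + 1))))⁻¹ * mk (aWord (f (k + 1))) * mk (conjWord (k + 1) (t (k + 1))) := by
  simp only [gw, cw, ← mul_mk, ← inv_mk]; rfl

lemma mk_gw_true (k) : (mk (gw f t true k) : FF) = mk (bWord (f (k + 1))) := by
  simp only [gw, cw, ← mul_mk, ← inv_mk, if_true]
  rw [← one_eq_mk]; simp

def Phi0 : FF →* PP f t hf hf1 := FreeGroup.lift fun a => pf f t hf hf1 (isB a) (of a)

lemma Phi0_eq (l : Bool) (w) (h : ∀ a ∈ w, isB a.1 = l) : Phi0 f t hf hf1 (mk w) = pf f t hf hf1 l (mk w) :=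
  hom_letters _ _ _ fun a ha => by simp [Phi0, h a ha]

lemma Phi0_rel (i) (hi : 1 ≤ i) : Phi0 f t hf hf1 (mk (relatorWord f t i)) = 1 := by
  obtain ⟨k, rfl⟩ : ∃ k, i = k + 1 := ⟨i - 1, by omega⟩
  rw [relator_mk]
  simp only [_root_.map_mul, _root_.map_inv]
  rw [Phi0_eq f t hf hf1 false (aWord _) fun a => aWord_letter,
    Phi0_eq f t hf hf1 false (conjWord _ _) fun a => conjWord_letter,
    Phi0_eq f t hf hf1 true (bWord _) fun a => bWord_letter, ← mk_gw_true f t,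
    ← ph_of f t hf hf1, pf_phi f t hf hf1 true false, ph_of f t hf hf1, mk_gw_false]
  simp only [_root_.map_mul, _root_.map_inv]
  group

def Phi : GroupG f t →* PP f t hf hf1 :=
  QuotientGroup.lift _ (Phi0 f t hf hf1) (by
    intro x hx
    have : Subgroup.normalClosure (relatorSet f t) ≤ (Phi0 f t hf hf1).ker := by
      apply Subgroup.normalClosure_le_normal
      rintro _ ⟨i, hi, rfl⟩
      exact Phi0_rel f t hf hf1 i hi
    exact this hx)

def qG : FF →* GroupG f t := QuotientGroup.mk' _

def psl (l : Bool) : FF →* GroupG f t := FreeGroup.lift fun a => if isB a = l then qG f t (of a) else 1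

lemma psl_eq (l : Bool) (w) (h : ∀ a ∈ w, isB a.1 = l) : psl f t l (mk w) = qG f t (mk w) :=
  hom_letters _ _ _ fun a ha => by simp [psl, h a ha]

lemma qG_rel (i) (hi : 1 ≤ i) : qG f t (mk (aWord (f i))) * qG f t (mk (conjWord i (t i))) =
    qG f t (mk (conjWord i (t i))) * qG f t (mk (bWord (f i))) := by
  have : qG f t (mk (relatorWord f t i)) = 1 :=
    (QuotientGroup.eq_one_iff _).2 (Subgroup.subset_normalClosure ⟨i, hi, rfl⟩)
  rw [relator_mk] at this
  simp only [_root_.map_mul, _root_.map_inv] at this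
  rw [mul_inv_eq_one, mul_inv_eq_iff_eq_mul] at this
  exact this

def Psi : PP f t hf hf1 →* GroupG f t :=
  Monoid.PushoutI.lift (fun l => psl f t l) ((psl f t true).comp (ph f t hf hf1 true)) (by
    intro l
    cases l
    · ext k
      simp only [MonoidHom.comp_apply, ph_of, mk_gw_false, mk_gw_true, _root_.map_mul, _root_.map_inv]
      rw [psl_eq f t false (aWord _) fun a => aWord_letter,
        psl_eq f t false (conjWord _ _) fun a => conjWord_letter,
        psl_eq f t true (bWord _) fun a => bWord_letter, mul_assoc, qG_rel f t (k + 1) (by omega)]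
      simp
    · rfl)

lemma Psi_Phi (x) : Psi f t hf hf1 (Phi f t hf hf1 x) = x := by
  have : ((Psi f t hf hf1).comp (Phi f t hf hf1)).comp (qG f t) = qG f t := by
    ext a
    change Psi f t hf hf1 (Phi0 f t hf hf1 (of a)) = _
    rw [Phi0, FreeGroup.lift_apply_of, pf, pof, Psi]
    erw [Monoid.PushoutI.lift_of]
    simp [psl]
  obtain ⟨y, rfl⟩ := QuotientGroup.mk_surjective x
  exact DFunLike.congr_fun this y

def tagG (w : Word (Fin 46)) : Word VV := w.map fun a => ((isB a.1, a.1), a.2)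

lemma ev_tagG (w) : ev f t hf hf1 (mk (tagG w)) = Phi f t hf hf1 (mkG f t w) := by
  change _ = Phi0 f t hf hf1 (mk w)
  have : (mk (tagG w) : FreeGroup VV) = FreeGroup.map (fun a => (isB a, a)) (mk w) := by
    rw [FreeGroup.map.mk]; rfl
  rw [this]
  have : (ev f t hf hf1).comp (FreeGroup.map (fun a => (isB a, a))) = Phi0 f t hf hf1 := by
    ext a; simp [ev, Phi0]
  exact DFunLike.congr_fun this (mk w)

lemma conj_iff (u v) : IsConj (mkG f t u) (mkG f t v) ↔ CJ f t hf hf1 (tagG u) (tagG v) := by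
  rw [CJ, ev_tagG, ev_tagG]
  constructor
  · exact fun h => (Phi f t hf hf1).map_isConj h
  · intro h
    have := (Psi f t hf hf1).map_isConj h
    rwa [Psi_Phi, Psi_Phi] at this

lemma tagG_comp : Computable tagG := by
  have h0 : Primrec isB := Primrec.dom_finite _
  have h1 : Primrec₂ fun (_ : Word (Fin 46)) (a : Fin 46 × Bool) => ((isB a.1, a.1), a.2) :=
    (((h0.comp (Primrec.fst.comp Primrec.snd)).pair (Primrec.fst.comp Primrec.snd)).pair
      (Primrec.snd.comp Primrec.snd))
  exact (Primrec.list_map Primrec.id h1).to_comp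

include hf hf1 in
theorem back (hfc : Computable f) (htc : Computable t)
    (hA : ComputablePred fun j : ℕ => ∃ i : ℕ, 1 ≤ i ∧ f i = j) :
    ComputablePred fun p : Word (Fin 46) × Word (Fin 46) => IsConj (mkG f t p.1) (mkG f t p.2) := by
  obtain ⟨cands, hcc, hc⟩ := exists_cands f hf hf1 hfc hA
  have h1 : Computable fun p : Word (Fin 46) × Word (Fin 46) => (tagG p.1, tagG p.2) :=
    (tagG_comp.comp Computable.fst).pair (tagG_comp.comp Computable.snd)
  have := CPred.comp (CJ_comp f t hf hf1 hfc htc cands hcc hc) h1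
  exact this.of_eq fun p => (conj_iff f t hf hf1 p.1 p.2).symm

end Asm
end CD

namespace CD
section Forw
open FreeGroup

def tau : Equiv.Perm (ℤ × ℚ) where
  toFun x := (x.1 + 1, x.2)
  invFun x := (x.1 - 1, x.2)
  left_inv x := by simp
  right_inv x := by simp

def pp : Equiv.Perm (ℤ × ℚ) where
  toFun x := (x.1, if x.1 = 0 then x.2 + 1 else x.2)
  invFun x := (x.1, if x.1 = 0 then x.2 - 1 else x.2)
  left_inv x := by rcases x with ⟨a, b⟩; by_cases h : a = 0 <;> simp [h]
  right_inv x := by rcases x with ⟨a, b⟩; by_cases h : a = 0 <;> simp [h]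

def qq (j : ℕ) : Equiv.Perm (ℤ × ℚ) where
  toFun x := (x.1, if x.1 = j then 2 * x.2 else x.2)
  invFun x := (x.1, if x.1 = j then x.2 / 2 else x.2)
  left_inv x := by rcases x with ⟨a, b⟩; by_cases h : a = j <;> simp [h]
  right_inv x := by
    rcases x with ⟨a, b⟩; by_cases h : a = j <;> simp [h]; ring

lemma tau_pow (n : ℕ) (m : ℤ) (x : ℚ) : (tau ^ n) (m, x) = (m + n, x) := by
  induction n with
  | zero => simp
  | succ n ih =>
    rw [pow_succ', Equiv.Perm.mul_apply, ih]
    simp [tau]; ring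

lemma tau_pow_inv (n : ℕ) (m : ℤ) (x : ℚ) : (tau ^ n)⁻¹ (m, x) = (m - n, x) := by
  rw [Equiv.Perm.inv_eq_iff_eq, tau_pow]; simp

lemma pp_pow (n : ℕ) (m : ℤ) (x : ℚ) : (pp ^ n) (m, x) = (m, if m = 0 then x + n else x) := by
  induction n with
  | zero => simp
  | succ n ih =>
    rw [pow_succ', Equiv.Perm.mul_apply, ih]
    by_cases h : m = 0 <;> simp [pp, h]; ring

lemma qq_pow (j n : ℕ) (m : ℤ) (x : ℚ) : (qq j ^ n) (m, x) = (m, if m = j then 2 ^ n * x else x) := by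
  induction n with
  | zero => simp
  | succ n ih =>
    rw [pow_succ', Equiv.Perm.mul_apply, ih]
    by_cases h : m = j <;> simp [qq, h]; ring

/-- images of the generators -/
def im (j : ℕ) (a : Fin 46) : Equiv.Perm (ℤ × ℚ) :=
  if a.1 = 0 then tau else if a.1 = 1 then pp else if a.1 = 2 then tau⁻¹ else if a.1 = 3 then qq j
  else if a.1 = 4 then tau else if a.1 = 5 then pp⁻¹ else if a.1 = 6 then tau⁻¹
  else if a.1 = 7 then (qq j)⁻¹ else 1

def th (j : ℕ) : FF →* Equiv.Perm (ℤ × ℚ) := FreeGroup.lift (im j)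

def PJ (n : ℕ) : Equiv.Perm (ℤ × ℚ) := tau ^ n * pp ^ n * (tau ^ n)⁻¹

lemma PJ_apply (n : ℕ) (m : ℤ) (x : ℚ) : PJ n (m, x) = (m, if m = n then x + n else x) := by
  simp only [PJ, Equiv.Perm.mul_apply]
  rw [tau_pow_inv, pp_pow, tau_pow]
  simp [sub_eq_zero]

lemma th_aWord (j n : ℕ) : th j (mk (aWord n)) = PJ n * qq j ^ n * (PJ n)⁻¹ * (qq j ^ n)⁻¹ := by
  rw [aWord, mk_flatten, map_list_prod]
  have key : ∀ x : Fin 46, th j (mk (genPow x true n)) = im j x ^ n := fun x => by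
    rw [mk_genPow, _root_.map_pow, th, FreeGroup.lift_apply_of]
  simp only [List.map_ofFn, Function.comp_def, key]
  simp only [List.ofFn_succ, List.ofFn_zero, List.prod_cons, List.prod_nil, im, genA, PJ]
  simp [Fin.succ, mul_assoc]

lemma th_bWord (j n : ℕ) : th j (mk (bWord n)) = 1 := by
  refine (hom_letters (th j) 1 (bWord n) fun a ha => ?_).trans rfl
  have := bWord_letter ha
  have := of_decide_eq_true this
  simp only [th, FreeGroup.lift_apply_of, im]
  repeat rw [if_neg (by omega)]
  rfl

lemma th_conjWord (j i n : ℕ) : th j (mk (conjWord i n)) = 1 := by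
  refine (hom_letters (th j) 1 (conjWord i n) fun a ha => ?_).trans rfl
  have := conjWord_mem ha
  simp only [th, FreeGroup.lift_apply_of, im]
  repeat rw [if_neg (by omega)]
  rfl

lemma th_ne {j n : ℕ} (h : n ≠ j) : th j (mk (aWord n)) = 1 := by
  rw [th_aWord, mul_inv_eq_one, mul_inv_eq_iff_eq_mul]
  ext1 ⟨m, x⟩
  simp only [Equiv.Perm.mul_apply]
  rw [qq_pow, PJ_apply, PJ_apply, qq_pow]
  by_cases h1 : m = n
  · subst h1; simp [h]
  · simp [h1]

lemma th_self {j : ℕ} (h : 1 ≤ j) : th j (mk (aWord j)) ≠ 1 := by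
  rw [th_aWord, Ne, mul_inv_eq_one, mul_inv_eq_iff_eq_mul]
  intro e
  have := DFunLike.congr_fun e ((j : ℤ), (0 : ℚ))
  simp only [Equiv.Perm.mul_apply] at this
  rw [qq_pow, PJ_apply, PJ_apply, qq_pow] at this
  simp only [if_true, mul_zero, zero_add, Prod.mk.injEq, true_and] at this
  have h2 : (1 : ℚ) < 2 ^ j := one_lt_pow₀ (by norm_num) (by omega)
  have h3 : (0 : ℚ) < j := by exact_mod_cast h
  nlinarith

variable (f t : ℕ → ℕ) (hf1 : ∀ i, 1 ≤ i → 1 ≤ f i)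

include hf1 in
lemma mem_iff (j : ℕ) : (∃ i : ℕ, 1 ≤ i ∧ f i = j) ↔
    1 ≤ j ∧ IsConj (mkG f t (aWord j)) (mkG f t (bWord j)) := by
  constructor
  · rintro ⟨i, hi, rfl⟩
    refine ⟨hf1 i hi, isConj_iff.2 ⟨(qG f t (mk (conjWord i (t i))))⁻¹, ?_⟩⟩
    have := qG_rel f t i hi
    change _ * qG f t (mk (aWord (f i))) * _ = qG f t (mk (bWord (f i)))
    rw [inv_inv, mul_assoc, this]
    simp
  · rintro ⟨hj, hc⟩
    by_contra hA
    let χ : GroupG f t →* Equiv.Perm (ℤ × ℚ) := QuotientGroup.lift _ (th j) (by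
      intro x hx
      have : Subgroup.normalClosure (relatorSet f t) ≤ (th j).ker := by
        apply Subgroup.normalClosure_le_normal
        rintro _ ⟨i, hi, rfl⟩
        change th j _ = 1
        rw [relator_mk]
        simp only [_root_.map_mul, _root_.map_inv]
        rw [th_ne fun e => hA ⟨i, hi, e⟩, th_bWord, th_conjWord]
        simp
      exact this hx)
    have h2 := χ.map_isConj hc
    change IsConj (th j (mk (aWord j))) (th j (mk (bWord j))) at h2
    rw [th_bWord, isConj_comm, isConj_one_right] at h2
    exact th_self hj h2

include hf1 in
theorem forw (h : ComputablePred fun p : Word (Fin 46) × Word (Fin 46) =>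
    IsConj (mkG f t p.1) (mkG f t p.2)) : ComputablePred fun j : ℕ => ∃ i : ℕ, 1 ≤ i ∧ f i = j := by
  have h1 := aWord_comp.pair bWord_comp
  have h2 := CPred.comp h h1
  have h3 : ComputablePred fun j : ℕ => 1 ≤ j :=
    (CPred.neg (CPred.eq Computable.id (Computable.const 0))).of_eq fun j => Nat.one_le_iff_ne_zero.symm
  exact (CPred.and h3 h2).of_eq fun j => (mem_iff f t hf1 j).symm

end Forw
end CD

/-- If `f` and `t` are computable, the global conjugacy problem of `G` is decidable if and
only if `A = {f(i) : i ≥ 1}` is decidable. -/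
theorem conjugacy_decidable_iff (f t : ℕ → ℕ) (hf : Function.Injective f)
    (hf1 : ∀ i : ℕ, 1 ≤ i → 1 ≤ f i) (ht1 : ∀ i : ℕ, 1 ≤ i → 1 ≤ t i)
    (hfc : Computable f) (htc : Computable t) :
    (ComputablePred fun p : Word (Fin 46) × Word (Fin 46) =>
        IsConj (mkG f t p.1) (mkG f t p.2)) ↔
      ComputablePred fun j : ℕ => ∃ i : ℕ, 1 ≤ i ∧ f i = j := by
  exact ⟨CD.forw f t hf1, CD.back f t hf hf1 hfc htc⟩
end

section
/- Suppose in addition that f and t are computable. Then the set A = {f(i) : i ≥ 1} is many-one reducible to the conjugacy problem of G: there is a computable map μ : ℕ → F × F such that for every j ∈ ℕ, j ∈ A if and only if the two components of μ(j) have conjugate images in G. (One may take μ(j) = (a₁^j ⋯ a₂₀^j, b₁^j ⋯ b₂₀^j) for j ≥ 1.) -/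
open Equiv in
/-- The shift on `ℤ × Fin 3`. -/
def shX : Perm (ℤ × Fin 3) := (Equiv.addRight (1 : ℤ)).prodCongr (Equiv.refl (Fin 3))

theorem shX_pow (k : ℕ) (n : ℤ) (s : Fin 3) : (shX ^ k) (n, s) = (n + k, s) := by
  induction k generalizing n with
  | zero => simp
  | succ k ih =>
    rw [pow_succ, Equiv.Perm.mul_apply]
    have : shX (n, s) = (n + 1, s) := rfl
    rw [this, ih]
    push_cast
    congr 1
    ring

def swY : Equiv.Perm (ℤ × Fin 3) := Equiv.swap (0, 0) (0, 1)

def swZ (j : ℕ) : Equiv.Perm (ℤ × Fin 3) := Equiv.swap ((j : ℤ), 1) ((j : ℤ), 2)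

theorem conj_swY (k : ℕ) :
    shX ^ k * swY * (shX ^ k)⁻¹ = Equiv.swap ((k : ℤ), (0 : Fin 3)) ((k : ℤ), 1) := by
  rw [swY, ← Equiv.swap_apply_apply, shX_pow, shX_pow]
  simp

theorem comm_ne (j k : ℕ) (h : k ≠ j) :
    (shX ^ k * swY * (shX ^ k)⁻¹) * swZ j = swZ j * (shX ^ k * swY * (shX ^ k)⁻¹) := by
  rw [conj_swY]
  have h' : (k : ℤ) ≠ j := by exact_mod_cast h
  have e : ∀ s : Fin 3, swZ j ((k : ℤ), s) = ((k : ℤ), s) := by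
    intro s
    apply Equiv.swap_apply_of_ne_of_ne <;> simp [h']
  have := Equiv.swap_apply_apply (swZ j) ((k : ℤ), (0 : Fin 3)) ((k : ℤ), 1)
  rw [e, e] at this
  exact eq_mul_inv_iff_mul_eq.mp this

theorem comm_eq (j : ℕ) :
    (shX ^ j * swY * (shX ^ j)⁻¹) * swZ j ≠ swZ j * (shX ^ j * swY * (shX ^ j)⁻¹) := by
  rw [conj_swY]
  intro h
  have := congrArg (fun p : Equiv.Perm (ℤ × Fin 3) => p ((j : ℤ), 0)) h
  simp [swZ, Equiv.swap_apply_def] at this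

/-- Images of the generators. -/
def phi (j : ℕ) : Fin 46 → Equiv.Perm (ℤ × Fin 3) := fun i =>
  if i = 0 then shX else
  if i = 1 then swY * shX⁻¹ * swY⁻¹ else
  if i = 2 then (swY * swZ j) * shX * (swY * swZ j)⁻¹ else
  if i = 3 then (swY * swZ j * swY⁻¹) * shX⁻¹ * (swY * swZ j * swY⁻¹)⁻¹ else 1

theorem lift_genPow_true {H : Type*} [Group H] (φ : Fin 46 → H) (x : Fin 46) (n : ℕ) :
    FreeGroup.lift φ (FreeGroup.mk (genPow x true n)) = φ x ^ n := by
  simp [genPow]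

theorem lift_genPow_false {H : Type*} [Group H] (φ : Fin 46 → H) (x : Fin 46) (n : ℕ) :
    FreeGroup.lift φ (FreeGroup.mk (genPow x false n)) = (φ x ^ n)⁻¹ := by
  simp [genPow]

theorem mk_append {α : Type*} (u v : Word α) :
    FreeGroup.mk (u ++ v) = FreeGroup.mk u * FreeGroup.mk v := FreeGroup.mul_mk.symm

theorem mk_flatten (L : List (Word (Fin 46))) :
    FreeGroup.mk L.flatten = (L.map FreeGroup.mk).prod := by
  induction L with
  | nil => rfl
  | cons a L ih => simp [mk_append, ih]

theorem lift_aWord {H : Type*} [Group H] (φ : Fin 46 → H) (n : ℕ) :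
    FreeGroup.lift φ (FreeGroup.mk (aWord n)) =
      (List.ofFn fun k : Fin 20 => φ (genA k) ^ n).prod := by
  rw [aWord, mk_flatten, map_list_prod, List.map_map, List.map_ofFn]
  congr 2
  funext k
  exact lift_genPow_true φ _ n

theorem lift_bWord {H : Type*} [Group H] (φ : Fin 46 → H) (n : ℕ) :
    FreeGroup.lift φ (FreeGroup.mk (bWord n)) =
      (List.ofFn fun k : Fin 20 => φ (genB k) ^ n).prod := by
  rw [bWord, mk_flatten, map_list_prod, List.map_map, List.map_ofFn]
  congr 2
  funext k
  exact lift_genPow_true φ _ n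

theorem invRev_genPow (x : Fin 46) (n : ℕ) :
    FreeGroup.mk (genPow x false n) = (FreeGroup.mk (genPow x true n))⁻¹ := by
  simp [genPow, FreeGroup.inv_mk, FreeGroup.invRev]

theorem mk_bWordRevInv (n : ℕ) :
    FreeGroup.mk (bWordRevInv n) = (FreeGroup.mk (bWord n))⁻¹ := by
  rw [bWordRevInv, bWord, mk_flatten, mk_flatten, List.prod_inv_reverse, List.map_ofFn,
    List.map_ofFn, List.map_ofFn]
  congr 1
  apply List.ext_getElem
  · simp
  · intro k h1 h2
    simp only [List.getElem_reverse, List.getElem_ofFn, Function.comp_apply, invRev_genPow,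
      List.length_ofFn]
    have h3 : k < 20 := by simpa using h1
    congr 4
    apply Fin.ext
    simp [Fin.val_rev]

theorem mk_conjWordInv (i n : ℕ) :
    FreeGroup.mk (conjWordInv i n) = (FreeGroup.mk (conjWord i n))⁻¹ := by
  simp only [conjWordInv, conjWord, mk_append, invRev_genPow, mul_inv_rev, mul_assoc]

theorem mk_relator (f t : ℕ → ℕ) (i : ℕ) :
    FreeGroup.mk (relatorWord f t i) = FreeGroup.mk (aWord (f i)) *
      FreeGroup.mk (conjWord i (t i)) * (FreeGroup.mk (bWord (f i)))⁻¹ *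
      (FreeGroup.mk (conjWord i (t i)))⁻¹ := by
  rw [relatorWord, mk_append, mk_append, mk_append, mk_bWordRevInv, mk_conjWordInv]

theorem isConj_of_mem (f t : ℕ → ℕ) (i : ℕ) (hi : 1 ≤ i) :
    IsConj (mkG f t (aWord (f i))) (mkG f t (bWord (f i))) := by
  have h : FreeGroup.mk (relatorWord f t i) ∈ Subgroup.normalClosure (relatorSet f t) :=
    Subgroup.subset_normalClosure ⟨i, hi, rfl⟩
  rw [← QuotientGroup.eq_one_iff, mk_relator] at h
  apply IsConj.symm
  rw [isConj_iff]
  refine ⟨QuotientGroup.mk (FreeGroup.mk (conjWord i (t i))), ?_⟩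
  simp only [QuotientGroup.mk_mul, QuotientGroup.mk_inv] at h
  simp only [mkG]
  rw [← mul_inv_eq_one, ← inv_eq_one]
  simpa only [mul_inv_rev, inv_inv, mul_assoc] using h

theorem isConj_lift (f t : ℕ → ℕ) {H : Type*} [Group H] (φ : Fin 46 → H)
    (hφ : ∀ i, 1 ≤ i → FreeGroup.lift φ (FreeGroup.mk (relatorWord f t i)) = 1)
    (u v : Word (Fin 46)) (h : IsConj (mkG f t u) (mkG f t v)) :
    IsConj (FreeGroup.lift φ (FreeGroup.mk u)) (FreeGroup.lift φ (FreeGroup.mk v)) := by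
  have hle : Subgroup.normalClosure (relatorSet f t) ≤ (FreeGroup.lift φ).ker := by
    apply Subgroup.normalClosure_le_normal
    rintro r ⟨i, hi, rfl⟩
    exact hφ i hi
  exact (QuotientGroup.lift _ (FreeGroup.lift φ) hle).map_isConj h

theorem phi_aWord (j n : ℕ) (hj : 1 ≤ j) :
    FreeGroup.lift (phi j) (FreeGroup.mk (aWord n)) =
      (shX ^ n * swY * (shX ^ n)⁻¹) * swZ j * (shX ^ n * swY * (shX ^ n)⁻¹)⁻¹ * (swZ j)⁻¹ := by
  have hc : swY * swZ j = swZ j * swY := by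
    have := comm_ne j 0 (by omega)
    simpa using this
  have hA : ∀ k : Fin 20, phi j (genA k) =
      if k = 0 then shX else
      if k = 1 then swY * shX⁻¹ * swY⁻¹ else
      if k = 2 then (swY * swZ j) * shX * (swY * swZ j)⁻¹ else
      if k = 3 then (swY * swZ j * swY⁻¹) * shX⁻¹ * (swY * swZ j * swY⁻¹)⁻¹ else 1 := by
    intro k
    fin_cases k <;> rfl
  rw [lift_aWord]
  simp only [hA]
  have e4 : swY * swZ j * swY⁻¹ = swZ j := by rw [hc]; group
  rw [e4]
  simp only [List.ofFn_succ, List.ofFn_zero, List.prod_cons, List.prod_nil]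
  simp [Fin.ext_iff, conj_pow]
  have hc2 : (swZ j)⁻¹ * (swY⁻¹ * swZ j) = swY⁻¹ := by
    rw [inv_mul_eq_iff_eq_mul, inv_mul_eq_iff_eq_mul, ← mul_assoc, hc, mul_assoc, mul_inv_cancel,
      mul_one]
  rw [← mul_inv_rev, conj_pow, mul_inv_rev]
  generalize shX ^ n = X
  generalize swZ j = z at *
  calc X * (swY * X⁻¹ * swY⁻¹ * (swY * z * X * (z⁻¹ * swY⁻¹) * (z * X⁻¹ * z⁻¹)))
      = X * swY * X⁻¹ * z * X * (z⁻¹ * (swY⁻¹ * z)) * X⁻¹ * z⁻¹ := by group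
    _ = _ := by rw [hc2]; group

theorem phi_bWord (j n : ℕ) : FreeGroup.lift (phi j) (FreeGroup.mk (bWord n)) = 1 := by
  have hB : ∀ k : Fin 20, phi j (genB k) = 1 := by
    intro k
    fin_cases k <;> rfl
  rw [lift_bWord]
  simp [hB]

theorem not_isConj (f t : ℕ → ℕ) (j : ℕ) (hj : 1 ≤ j) (hA : ¬ ∃ i : ℕ, 1 ≤ i ∧ f i = j) :
    ¬ IsConj (mkG f t (aWord j)) (mkG f t (bWord j)) := by
  intro h
  have := isConj_lift f t (phi j) ?_ _ _ h
  · rw [phi_bWord, isConj_one_left, phi_aWord j j hj] at this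
    apply comm_eq j
    rw [mul_inv_eq_one, mul_inv_eq_iff_eq_mul] at this
    exact this
  · intro i hi
    rw [mk_relator]
    simp only [map_mul, map_inv, phi_bWord, inv_one, mul_one]
    rw [mul_inv_cancel_right, phi_aWord j _ hj, comm_ne j _ (fun e => hA ⟨i, hi, e⟩)]
    group

theorem not_isConj_zero (f t : ℕ → ℕ) :
    ¬ IsConj (mkG f t [(genC 0, true)]) (mkG f t []) := by
  intro h
  let φ : Fin 46 → Multiplicative ℤ := fun i => if i = genC 0 then Multiplicative.ofAdd 1 else 1
  have := isConj_lift f t φ ?_ _ _ h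
  · rw [show FreeGroup.mk ([] : Word (Fin 46)) = 1 from rfl, map_one, isConj_one_left] at this
    simp [φ] at this
  · intro i hi
    have hA : ∀ k : Fin 20, φ (genA k) = 1 := by
      intro k
      fin_cases k <;> rfl
    have hB : ∀ k : Fin 20, φ (genB k) = 1 := by
      intro k
      fin_cases k <;> rfl
    rw [mk_relator]
    simp only [map_mul, map_inv, lift_aWord, lift_bWord, hA, hB]
    simp

theorem primrec_replicate {α : Type*} [Primcodable α] (a : α) :
    Primrec (fun n : ℕ => List.replicate n a) := by
  have : Primrec (fun n : ℕ => (List.range n).map (fun _ => a)) :=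
    Primrec.list_map Primrec.list_range (Primrec.const a).to₂
  refine this.of_eq fun n => ?_
  simp [List.map_const']

theorem primrec_flat (L : List (Fin 46)) :
    Primrec (fun n : ℕ => (L.map fun x => genPow x true n).flatten) := by
  induction L with
  | nil => exact Primrec.const []
  | cons x L ih =>
    simp only [List.map_cons, List.flatten_cons]
    exact Primrec.list_append.comp (primrec_replicate _) ih

theorem primrec_aWord : Primrec aWord := by
  refine (primrec_flat (List.ofFn genA)).of_eq fun n => ?_
  rw [aWord, List.map_ofFn]
  rfl

theorem primrec_bWord : Primrec bWord := by
  refine (primrec_flat (List.ofFn genB)).of_eq fun n => ?_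
  rw [bWord, List.map_ofFn]
  rfl

/-- If `f` and `t` are computable, the set `A = {f(i) : i ≥ 1}` is many-one reducible to
the conjugacy problem of `G`: there is a computable `μ : ℕ → F × F` such that `j ∈ A` if and
only if the two components of `μ j` have conjugate images in `G`. -/
theorem A_manyOneReducible_conjugacy (f t : ℕ → ℕ) (hf : Function.Injective f)
    (hf1 : ∀ i : ℕ, 1 ≤ i → 1 ≤ f i) (ht1 : ∀ i : ℕ, 1 ≤ i → 1 ≤ t i)
    (hfc : Computable f) (htc : Computable t) :
    ∃ μ : ℕ → Word (Fin 46) × Word (Fin 46), Computable μ ∧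
      ∀ j : ℕ, (∃ i : ℕ, 1 ≤ i ∧ f i = j) ↔ IsConj (mkG f t (μ j).1) (mkG f t (μ j).2) := by
  refine ⟨fun j => if j = 0 then ([(genC 0, true)], []) else (aWord j, bWord j), ?_, ?_⟩
  · apply Primrec.to_comp
    exact Primrec.ite (Primrec.eq.comp Primrec.id (Primrec.const 0)) (Primrec.const _)
      (Primrec.pair primrec_aWord primrec_bWord)
  · intro j
    by_cases hj : j = 0
    · subst hj
      simp only [if_true]
      refine iff_of_false ?_ (not_isConj_zero f t)
      rintro ⟨i, hi, h⟩
      have := hf1 i hi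
      omega
    · simp only [if_neg hj]
      constructor
      · rintro ⟨i, hi, rfl⟩
        exact isConj_of_mem f t i hi
      · intro h
        by_contra hA
        exact not_isConj f t j (by omega) hA h
end
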